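/- arXiv:1103.2531 — 3 statements merged into one kernel-verified Lean document; each statement's English description precedes it below -/
import Mathlib

section
/- Let E and F be disjoint nonempty closed subsets of the Riemann sphere ℂ̂ with ∞ ∈ F, and suppose that U := ℂ̂ ∖ (E ∪ F) is connected. Then there exists a Jordan loop γ whose image is contained in U ∩ ℂ and is a finite union of horizontal and vertical segments, such that the winding number n(γ, z) equals 1 for every z ∈ E and equals 0 for every z ∈ F ∖ {∞}. -/
open Set OnePoint

/-- A Jordan loop: a continuous map `γ : [0,1] → ℂ` with `γ 0 = γ 1` whose
restriction to `[0,1)` is injective. -/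
def IsJordanLoop (γ : ℝ → ℂ) : Prop :=
  ContinuousOn γ (Set.Icc 0 1) ∧ γ 0 = γ 1 ∧ Set.InjOn γ (Set.Ico 0 1)

/-- A set is a finite union of horizontal and vertical closed segments in `ℂ`. -/
def FinUnionHV (S : Set ℂ) : Prop :=
  ∃ (n : ℕ) (p q : Fin n → ℂ),
    (∀ i, (p i).re = (q i).re ∨ (p i).im = (q i).im) ∧
    S = ⋃ i, segment ℝ (p i) (q i)

/-- `IsWindingNumber γ z n` : the winding number of the loop `γ` about `z` is `n`,
expressed via logarithmic lifts: every continuous `ℓ` on `[0,1]` with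
`γ t - z = exp (ℓ t)` satisfies `ℓ 1 - ℓ 0 = 2 π i n`. -/
def IsWindingNumber (γ : ℝ → ℂ) (z : ℂ) (n : ℤ) : Prop :=
  ∀ ℓ : ℝ → ℂ, ContinuousOn ℓ (Set.Icc 0 1) →
    (∀ t ∈ Set.Icc (0:ℝ) 1, γ t - z = Complex.exp (ℓ t)) →
    ℓ 1 - ℓ 0 = 2 * Real.pi * Complex.I * n

open Set
set_option linter.all false
namespace JL

/-- A directed cell side. -/
@[ext] structure Dt where
  x : ℤ
  y : ℤ
  d : Fin 4

def dx : Fin 4 → ℤ := ![1, 0, -1, 0]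
def dy : Fin 4 → ℤ := ![0, 1, 0, -1]
def ox : Fin 4 → ℤ := ![1, 1, 0, 0]
def oy : Fin 4 → ℤ := ![0, 1, 1, 0]

def Dt.st (f : Dt) : ℤ × ℤ := (f.x + ox f.d, f.y + oy f.d)
def Dt.en (f : Dt) : ℤ × ℤ := (f.x + ox (f.d + 1), f.y + oy (f.d + 1))
def Dt.rev (f : Dt) : Dt := ⟨f.x + dx f.d, f.y + dy f.d, f.d + 2⟩

abbrev Col := ℤ → ℤ → Bool

def bd (K : Col) (f : Dt) : Prop := K f.x f.y ≠ K (f.x + dx f.d) (f.y + dy f.d)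
def BD (K : Col) : Set Dt := {f | K f.x f.y = true ∧ K (f.x + dx f.d) (f.y + dy f.d) = false}

def Cn (P : Dt → Prop) : (ℤ × ℤ) → (ℤ × ℤ) → Prop :=
  Relation.EqvGen (fun v w => ∃ f, P f ∧ f.st = v ∧ f.en = w)

def NP (K : Col) : Prop := ∀ x y, ¬ (K x y = K (x+1) (y+1) ∧ K (x+1) y = K x (y+1) ∧ K x y ≠ K (x+1) y)

def nx (K : Col) (f : Dt) : Dt :=
  if K (f.x + dx (f.d+1)) (f.y + dy (f.d+1)) = false then ⟨f.x, f.y, f.d+1⟩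
  else if K (f.x + dx f.d + dx (f.d+1)) (f.y + dy f.d + dy (f.d+1)) = false then
    ⟨f.x + dx (f.d+1), f.y + dy (f.d+1), f.d⟩
  else ⟨f.x + dx f.d + dx (f.d+1), f.y + dy f.d + dy (f.d+1), f.d+3⟩

def pv (K : Col) (f : Dt) : Dt :=
  if K (f.x + dx (f.d+3)) (f.y + dy (f.d+3)) = false then ⟨f.x, f.y, f.d+3⟩
  else if K (f.x + dx f.d + dx (f.d+3)) (f.y + dy f.d + dy (f.d+3)) = false then
    ⟨f.x + dx (f.d+3), f.y + dy (f.d+3), f.d⟩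
  else ⟨f.x + dx f.d + dx (f.d+3), f.y + dy f.d + dy (f.d+3), f.d+1⟩

lemma Cn.refl {P} (v) : Cn P v v := Relation.EqvGen.refl v
lemma Cn.symm {P v w} (h : Cn P v w) : Cn P w v := Relation.EqvGen.symm _ _ h
lemma Cn.trans {P u v w} (h : Cn P u v) (h' : Cn P v w) : Cn P u w := Relation.EqvGen.trans _ _ _ h h'
lemma Cn.of {P : Dt → Prop} (f : Dt) (h : P f) : Cn P f.st f.en := Relation.EqvGen.rel _ _ ⟨f, h, rfl, rfl⟩

lemma forall4 {P : Fin 4 → Prop} (h0 : P 0) (h1 : P 1) (h2 : P 2) (h3 : P 3) : ∀ d, P d := by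
  intro d; fin_cases d <;> assumption

@[simp] lemma dx0 : dx 0 = 1 := rfl
@[simp] lemma dx1 : dx 1 = 0 := rfl
@[simp] lemma dx2 : dx 2 = -1 := rfl
@[simp] lemma dx3 : dx 3 = 0 := rfl
@[simp] lemma dy0 : dy 0 = 0 := rfl
@[simp] lemma dy1 : dy 1 = 1 := rfl
@[simp] lemma dy2 : dy 2 = 0 := rfl
@[simp] lemma dy3 : dy 3 = -1 := rfl
@[simp] lemma ox0 : ox 0 = 1 := rfl
@[simp] lemma ox1 : ox 1 = 1 := rfl
@[simp] lemma ox2 : ox 2 = 0 := rfl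
@[simp] lemma ox3 : ox 3 = 0 := rfl
@[simp] lemma oy0 : oy 0 = 0 := rfl
@[simp] lemma oy1 : oy 1 = 1 := rfl
@[simp] lemma oy2 : oy 2 = 1 := rfl
@[simp] lemma oy3 : oy 3 = 0 := rfl
lemma f01 : (0:Fin 4)+1 = 1 := rfl
lemma f11 : (1:Fin 4)+1 = 2 := rfl
lemma f21 : (2:Fin 4)+1 = 3 := rfl
lemma f31 : (3:Fin 4)+1 = 0 := rfl
lemma f02 : (0:Fin 4)+2 = 2 := rfl
lemma f12 : (1:Fin 4)+2 = 3 := rfl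
lemma f22 : (2:Fin 4)+2 = 0 := rfl
lemma f32 : (3:Fin 4)+2 = 1 := rfl
lemma f03 : (0:Fin 4)+3 = 3 := rfl
lemma f13 : (1:Fin 4)+3 = 0 := rfl
lemma f23 : (2:Fin 4)+3 = 1 := rfl
lemma f33 : (3:Fin 4)+3 = 2 := rfl

lemma rev_rev (f : Dt) : f.rev.rev = f := by
  obtain ⟨x, y, d⟩ := f
  revert d
  apply forall4 <;> simp [Dt.rev, f02, f12, f22, f32]

lemma st_rev (f : Dt) : f.rev.st = f.en := by
  obtain ⟨x, y, d⟩ := f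
  revert d
  apply forall4 <;> simp [Dt.rev, Dt.st, Dt.en, f02, f12, f22, f32, f01, f11, f21, f31]

lemma en_rev (f : Dt) : f.rev.en = f.st := by
  rw [← st_rev, rev_rev]

lemma bd_rev {K : Col} {f : Dt} : bd K f.rev ↔ bd K f := by
  obtain ⟨x, y, d⟩ := f
  revert d
  apply forall4 <;> simp [Dt.rev, bd, f02, f12, f22, f32] <;> tauto

lemma BD_bd {K : Col} {f : Dt} (h : f ∈ BD K) : bd K f := by
  obtain ⟨h1, h2⟩ := h
  simp [bd, h1, h2]

lemma bd_BD {K : Col} {f : Dt} (h : bd K f) : f ∈ BD K ∨ f.rev ∈ BD K := by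
  rcases hb : K f.x f.y with _ | _
  · right
    have h2 := bd_rev.2 h
    refine ⟨?_, ?_⟩
    · simp only [bd] at h; simp only [Dt.rev]; rw [hb] at h; revert h
      cases K (f.x + dx f.d) (f.y + dy f.d) <;> simp
    · have := rev_rev f
      have hx : f.rev.x + dx f.rev.d = f.x := congrArg Dt.x this
      have hy : f.rev.y + dy f.rev.d = f.y := congrArg Dt.y this
      rw [hx, hy, hb]
  · left
    refine ⟨hb, ?_⟩
    simp only [bd] at h; rw [hb] at h; revert h
    cases K (f.x + dx f.d) (f.y + dy f.d) <;> simp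

lemma rev_not_BD {K : Col} {f : Dt} (h : f ∈ BD K) : f.rev ∉ BD K := by
  intro h'
  have := h'.1
  simp only [Dt.rev] at this
  rw [h.2] at this; cases this

lemma nx_BD {K : Col} {f : Dt} (h : f ∈ BD K) : nx K f ∈ BD K := by
  obtain ⟨x, y, d⟩ := f
  obtain ⟨h1, h2⟩ := h
  simp only [nx, BD]
  split_ifs with h3 h4
  · exact ⟨h1, h3⟩
  · refine ⟨by simpa using h3, ?_⟩
    simp only
    rw [← h4]; congr 1 <;> ring
  · refine ⟨by simpa using h4, ?_⟩
    revert d; apply forall4 <;> simp [f03, f13, f23, f33, f01, f11, f21, f31] <;> tauto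

lemma nx_st {K : Col} {f : Dt} : (nx K f).st = f.en := by
  obtain ⟨x, y, d⟩ := f
  simp only [nx]
  split_ifs <;> revert d <;> apply forall4 <;>
   simp [f03, f13, f23, f33, f01, f11, f21, f31, Dt.st, Dt.en]

lemma pv_nx {K : Col} {f : Dt} (h : f ∈ BD K) : pv K (nx K f) = f := by
  obtain ⟨x, y, d⟩ := f
  obtain ⟨h1, h2⟩ := h
  simp only at h1 h2
  simp only [nx]
  split_ifs with h3 h4 <;> revert d <;> apply forall4 <;>
   simp +contextual [f03, f13, f23, f33, f01, f11, f21, f31, pv, h1]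

lemma st_inj {K : Col} (np : NP K) {f g : Dt} (hf : f ∈ BD K) (hg : g ∈ BD K) (h : f.st = g.st) : f = g := by
  obtain ⟨x, y, d⟩ := f
  obtain ⟨x', y', d'⟩ := g
  obtain ⟨h1, h2⟩ := hf
  obtain ⟨h3, h4⟩ := hg
  simp only [Dt.st, Prod.mk.injEq] at h
  obtain ⟨hx, hy⟩ := h
  simp only at h1 h2 h3 h4
  have n1 := np (x-1) (y-1)
  have n2 := np (x-1) y
  have n3 := np x (y-1)
  have n4 := np x y
  obtain rfl : x' = x + ox d - ox d' := by omega
  obtain rfl : y' = y + oy d - oy d' := by omega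
  clear hx hy
  revert d' d
  apply forall4 <;> apply forall4 <;> intro h2 h3 h4 <;> simp at h1 h2 h3 h4 n1 n2 n3 n4 ⊢ <;> grind

def Fin' (K : Col) : Prop := {c : ℤ × ℤ | K c.1 c.2 = true}.Finite

lemma BD_finite {K : Col} (h : Fin' K) : (BD K).Finite := by
  have h2 : ((fun f : Dt => ((f.x, f.y), f.d)) '' (BD K)).Finite := by
    apply (h.prod (Set.finite_univ (α := Fin 4))).subset
    rintro _ ⟨f, hf, rfl⟩
    exact ⟨hf.1, trivial⟩
  apply h2.of_finite_image
  rintro ⟨x, y, d⟩ _ ⟨x', y', d'⟩ _ h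
  simp at h
  simp [h]

lemma nx_iter_BD {K : Col} {f : Dt} (h : f ∈ BD K) (n : ℕ) : (nx K)^[n] f ∈ BD K := by
  induction n with
  | zero => exact h
  | succ n ih => rw [Function.iterate_succ_apply']; exact nx_BD ih

lemma nx_iter_inj {K : Col} {f g : Dt} (hf : f ∈ BD K) (hg : g ∈ BD K) (n : ℕ)
    (h : (nx K)^[n] f = (nx K)^[n] g) : f = g := by
  induction n with
  | zero => exact h
  | succ n ih =>
    rw [Function.iterate_succ_apply', Function.iterate_succ_apply'] at h
    apply ih
    rw [← pv_nx (nx_iter_BD hf n), ← pv_nx (nx_iter_BD hg n), h]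

lemma nx_per {K : Col} (hK : Fin' K) {f : Dt} (h : f ∈ BD K) : 0 < Function.minimalPeriod (nx K) f := by
  apply Function.minimalPeriod_pos_of_mem_periodicPts
  have hmaps : Set.MapsTo (fun n : ℕ => (nx K)^[n] f) Set.univ (BD K) := fun n _ => nx_iter_BD h n
  obtain ⟨m, -, n, -, hmn, he⟩ := Set.infinite_univ.exists_lt_map_eq_of_mapsTo hmaps (BD_finite hK)
  refine ⟨n - m, by omega, ?_⟩
  apply nx_iter_inj (nx_iter_BD h _) h m
  rw [← Function.iterate_add_apply]
  rw [show m + (n - m) = n by omega]; exact he.symm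

lemma bridge {K : Col} (hK : Fin' K) {e : Dt} (he : bd K e) :
    Cn (fun f => bd K f ∧ f ≠ e ∧ f ≠ e.rev) e.st e.en := by
  have main : ∀ e, e ∈ BD K → Cn (fun f => bd K f ∧ f ≠ e ∧ f ≠ e.rev) e.st e.en := by
    intro e he
    set n := Function.minimalPeriod (nx K) e with hn
    have hpos := nx_per hK he
    have key : ∀ i, i + 1 ≤ n → Cn (fun f => bd K f ∧ f ≠ e ∧ f ≠ e.rev) e.en ((nx K)^[i+1] e).st := by
      intro i
      induction i with
      | zero => intro _; simp only [zero_add, Function.iterate_one, nx_st]; exact Cn.refl _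
      | succ i ih =>
        intro hi
        refine (ih (by omega)).trans ?_
        rw [Function.iterate_succ_apply' _ (i+1), nx_st]
        apply Cn.of
        have hb := nx_iter_BD he (i+1)
        refine ⟨BD_bd hb, ?_, ?_⟩
        · intro h
          have := Function.not_isPeriodicPt_of_pos_of_lt_minimalPeriod (n := i+1) (f := nx K) (x := e) (by omega) (by omega)
          exact this h
        · intro h
          rw [h] at hb
          exact rev_not_BD he hb
    have := key (n-1) (by omega)
    rw [show n - 1 + 1 = n by omega, hn, Function.iterate_minimalPeriod] at this
    exact this.symm
  rcases bd_BD he with h | h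
  · exact main e h
  · have := main _ h
    rw [st_rev, en_rev, rev_rev] at this
    refine this.symm.mono ?_
    rintro v w ⟨f, ⟨h1, h2, h3⟩, h4⟩
    exact ⟨f, ⟨h1, h3, h2⟩, h4⟩

end JL

open Set
set_option linter.all false
namespace JL

def strand : Fin 4 → Fin 4 → List (ℤ × ℤ × Fin 4) :=
  ![![[], [(2, 0, 1), (1, 0, 1), (0, 1, 0), (0, 2, 0)], [(2, 0, 1), (1, 0, 1), (0, 0, 1)], [(2, 0, 1), (2, 0, 2)]],
  ![[(2, 2, 2), (2, 2, 3)], [], [(2, 2, 2), (2, 1, 2), (1, 0, 1), (0, 0, 1)], [(2, 2, 2), (2, 1, 2), (2, 0, 2)]],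
  ![[(0, 2, 3), (1, 2, 3), (2, 2, 3)], [(0, 2, 3), (0, 2, 0)], [], [(0, 2, 3), (1, 2, 3), (2, 1, 2), (2, 0, 2)]],
  ![[(0, 0, 0), (0, 1, 0), (1, 2, 3), (2, 2, 3)], [(0, 0, 0), (0, 1, 0), (0, 2, 0)], [(0, 0, 0), (0, 0, 1)], []]]

def loc (a : Fin 4 → Bool) (i j : ℤ) : Bool :=
  if i = 1 ∧ j = 1 then a 0 || a 1 || a 2 || a 3
  else if i = 2 ∧ j = 1 then a 0 else if i = 1 ∧ j = 2 then a 1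
  else if i = 0 ∧ j = 1 then a 2 else if i = 1 ∧ j = 0 then a 3 else false

def rf (K : Col) (A : ℤ → ℤ → Fin 4 → Bool) : Col := fun X Y =>
  xor (K (X/3) (Y/3)) (loc (A (X/3) (Y/3)) (X%3) (Y%3))

lemma rf_eq (K A) (x y i j : ℤ) (hi : 0 ≤ i) (hi' : i ≤ 2) (hj : 0 ≤ j) (hj' : j ≤ 2) :
    rf K A (3*x+i) (3*y+j) = xor (K x y) (loc (A x y) i j) := by
  have h1 : (3*x+i)/3 = x := by omega
  have h2 : (3*y+j)/3 = y := by omega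
  have h3 : (3*x+i)%3 = i := by omega
  have h4 : (3*y+j)%3 = j := by omega
  simp only [rf, h1, h2, h3, h4]

def valid (a : Fin 4 → Bool) (i j : ℤ) (d : Fin 4) : Bool :=
  decide (0 ≤ i ∧ i ≤ 2 ∧ 0 ≤ j ∧ j ≤ 2 ∧ 0 ≤ i + dx d ∧ i + dx d ≤ 2 ∧ 0 ≤ j + dy d ∧ j + dy d ≤ 2
    ∧ loc a i j ≠ loc a (i + dx d) (j + dy d))

lemma valid_bd {K A x y i j d} (h : valid (A x y) i j d = true) : bd (rf K A) ⟨3*x+i, 3*y+j, d⟩ := by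
  simp only [valid, decide_eq_true_eq] at h
  obtain ⟨h1, h2, h3, h4, h5, h6, h7, h8, h9⟩ := h
  simp only [bd]
  rw [rf_eq K A x y i j h1 h2 h3 h4, show 3*x+i+dx d = 3*x+(i+dx d) by ring,
    show 3*y+j+dy d = 3*y+(j+dy d) by ring, rf_eq K A x y _ _ h5 h6 h7 h8]
  simpa using h9

def chk (a : Fin 4 → Bool) : ℤ × ℤ → List (ℤ × ℤ × Fin 4) → ℤ × ℤ → Bool
  | s, [], t => decide (s = t)
  | s, (i, j, d) :: l, t => valid a i j d && (decide (s = (i + ox d, j + oy d)) &&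
      chk a (i + ox (d+1), j + oy (d+1)) l t)

lemma chk_sound {K A x y} (l) : ∀ s t, chk (A x y) s l t = true →
    Cn (bd (rf K A)) (3*x+s.1, 3*y+s.2) (3*x+t.1, 3*y+t.2) ∧
    ∀ q ∈ l, Cn (bd (rf K A)) (3*x+s.1, 3*y+s.2) (3*x+q.1+ox q.2.2, 3*y+q.2.1+oy q.2.2) := by
  induction l with
  | nil => intro s t h; simp [chk] at h; subst h; exact ⟨Cn.refl _, by simp⟩
  | cons p l ih =>
    obtain ⟨i, j, d⟩ := p
    intro s t h
    simp only [chk, Bool.and_eq_true, decide_eq_true_eq] at h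
    obtain ⟨h1, h2, h3⟩ := h
    have h4 := Cn.of (P := bd (rf K A)) _ (valid_bd (K := K) h1)
    have h5 := ih _ _ h3
    subst h2
    simp only [Dt.st, Dt.en] at h4
    simp only [← add_assoc] at h5 ⊢
    refine ⟨h4.trans h5.1, ?_⟩
    intro q hq
    rcases List.mem_cons.1 hq with rfl | hq
    · exact Cn.refl _
    · exact h4.trans (h5.2 q hq)

def Tl (d : Fin 4) (i : ℤ) : ℤ × ℤ := (3*ox d + i*(ox (d+1) - ox d), 3*oy d + i*(oy (d+1) - oy d))
def TT (x y : ℤ) (d : Fin 4) (i : ℤ) : ℤ × ℤ := (3*x+(Tl d i).1, 3*y+(Tl d i).2)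

def ind (u w : Fin 4) : Fin 4 → Bool := fun d => decide (d = u ∨ d = w)

lemma chk_all : ∀ u w : Fin 4, u ≠ w → chk (ind u w) (Tl u 1) (strand u w) (Tl w 2) = true := by
  decide +kernel

lemma chk_complete : ∀ u w : Fin 4, u ≠ w → ∀ i j : Fin 3, ∀ d : Fin 4, valid (ind u w) (i.val:ℤ) (j.val:ℤ) d = true →
    ∃ q ∈ strand u w ++ strand w u, 
      (i.val:ℤ) + ox d = q.1 + ox q.2.2 ∧ (j.val:ℤ) + oy d = q.2.1 + oy q.2.2 ∨ (((i.val:ℤ) + ox d, (j.val:ℤ) + oy d) = Tl w 2 ∨ ((i.val:ℤ) + ox d, (j.val:ℤ) + oy d) = Tl u 2) := by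
  decide +kernel

lemma ind_comm (u w) : ind u w = ind w u := by
  funext d; simp [ind, or_comm]

lemma strand1 {K A x y u w} (huw : u ≠ w) (hA : A x y = ind u w) :
    Cn (bd (rf K A)) (TT x y u 1) (TT x y w 2) := by
  have := chk_all u w huw
  rw [← hA] at this
  exact (chk_sound _ _ _ this).1

lemma strand2 {K A x y u w} (huw : u ≠ w) (hA : A x y = ind u w) :
    Cn (bd (rf K A)) (TT x y u 2) (TT x y w 1) :=
  (strand1 huw.symm (by rw [hA, ind_comm])).symm

lemma strand_complete {K A x y u w i j d} (huw : u ≠ w) (hA : A x y = ind u w)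
    (h : valid (A x y) i j d = true) :
    Cn (bd (rf K A)) (TT x y u 1) (Dt.st ⟨3*x+i, 3*y+j, d⟩) ∨
    Cn (bd (rf K A)) (TT x y w 1) (Dt.st ⟨3*x+i, 3*y+j, d⟩) := by
  have hv := h
  simp only [valid, decide_eq_true_eq] at hv
  obtain ⟨h1, h2, h3, h4, -⟩ := hv
  obtain ⟨i', rfl⟩ : ∃ i' : Fin 3, i = (i'.val : ℤ) := ⟨⟨i.toNat, by omega⟩, by simp; omega⟩
  obtain ⟨j', rfl⟩ : ∃ j' : Fin 3, j = (j'.val : ℤ) := ⟨⟨j.toNat, by omega⟩, by simp; omega⟩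
  rw [hA] at h
  obtain ⟨q, hq, hh⟩ := chk_complete u w huw i' j' d h
  have c1 := chk_all u w huw
  have c2 := chk_all w u huw.symm
  rw [← hA] at c1
  rw [ind_comm, ← hA] at c2
  have s1 := chk_sound (K := K) _ _ _ c1
  have s2 := chk_sound (K := K) _ _ _ c2
  simp only [Dt.st, add_assoc]
  rcases hh with ⟨e1, e2⟩ | e | e
  · rw [e1, e2]
    simp only [add_assoc] at s1 s2
    rcases List.mem_append.1 hq with hq | hq
    · exact Or.inl (s1.2 q hq)
    · exact Or.inr (s2.2 q hq)
  · left
    have e1 := congrArg Prod.fst e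
    have e2 := congrArg Prod.snd e
    simp only at e1 e2
    rw [e1, e2]; exact s1.1
  · right
    have e1 := congrArg Prod.fst e
    have e2 := congrArg Prod.snd e
    simp only at e1 e2
    rw [e1, e2]; exact s2.1

end JL

open Set
set_option linter.all false
namespace JL

def Ad (A : ℤ → ℤ → Fin 4 → Bool) (f : Dt) : Bool := A f.x f.y f.d

structure Cons (K : Col) (A : ℤ → ℤ → Fin 4 → Bool) : Prop where
  a1 : ∀ f, ¬ bd K f → Ad A f = Ad A f.rev
  a2 : ∀ f, bd K f → ¬ (Ad A f = true ∧ Ad A f.rev = true)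

lemma l00 (a) : loc a 0 0 = false := rfl
lemma l01 (a) : loc a 0 1 = a 2 := rfl
lemma l02 (a) : loc a 0 2 = false := rfl
lemma l10 (a) : loc a 1 0 = a 3 := rfl
lemma l11 (a) : loc a 1 1 = (a 0 || a 1 || a 2 || a 3) := rfl
lemma l12 (a) : loc a 1 2 = a 1 := rfl
lemma l20 (a) : loc a 2 0 = false := rfl
lemma l21 (a) : loc a 2 1 = a 0 := rfl
lemma l22 (a) : loc a 2 2 = false := rfl

lemma rf_eq' {K A} (X Y x y i j : ℤ) (hX : X = 3*x+i) (hY : Y = 3*y+j) (hi : 0 ≤ i) (hi' : i ≤ 2) (hj : 0 ≤ j) (hj' : j ≤ 2) :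
    rf K A X Y = xor (K x y) (loc (A x y) i j) := by
  rw [hX, hY, rf_eq K A x y i j hi hi' hj hj']

lemma divcase (X : ℤ) : ∃ x, X = 3*x+0 ∨ X = 3*x+1 ∨ X = 3*x+2 := ⟨X/3, by omega⟩

lemma NP_rf {K A} (hc : Cons K A) (np : NP K) : NP (rf K A) := by
  intro X Y
  obtain ⟨x, hX⟩ := divcase X
  obtain ⟨y, hY⟩ := divcase Y
  have e1 := hc.a1 ⟨x, y, 0⟩
  have e2 := hc.a2 ⟨x, y, 0⟩
  have n1 := hc.a1 ⟨x, y, 1⟩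
  have n2 := hc.a2 ⟨x, y, 1⟩
  have np' := np x y
  simp only [bd, Ad, Dt.rev, dx0, dx1, dy0, dy1, f02, f12, add_zero] at e1 e2 n1 n2
  rcases hX with hX | hX | hX <;> rcases hY with hY | hY | hY
  · rw [rf_eq' X Y x y 0 0 (by omega) (by omega) (by omega) (by omega) (by omega) (by omega),
      rf_eq' (X+1) Y x y 1 0 (by omega) (by omega) (by omega) (by omega) (by omega) (by omega),
      rf_eq' X (Y+1) x y 0 1 (by omega) (by omega) (by omega) (by omega) (by omega) (by omega),
      rf_eq' (X+1) (Y+1) x y 1 1 (by omega) (by omega) (by omega) (by omega) (by omega) (by omega)]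
    simp only [l00, l01, l10, l11, l02, l12, l20, l21, l22]; grind
  · rw [rf_eq' X Y x y 0 1 (by omega) (by omega) (by omega) (by omega) (by omega) (by omega),
      rf_eq' (X+1) Y x y 1 1 (by omega) (by omega) (by omega) (by omega) (by omega) (by omega),
      rf_eq' X (Y+1) x y 0 2 (by omega) (by omega) (by omega) (by omega) (by omega) (by omega),
      rf_eq' (X+1) (Y+1) x y 1 2 (by omega) (by omega) (by omega) (by omega) (by omega) (by omega)]
    simp only [l00, l01, l10, l11, l02, l12, l20, l21, l22]; grind
  · rw [rf_eq' X Y x y 0 2 (by omega) (by omega) (by omega) (by omega) (by omega) (by omega),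
      rf_eq' (X+1) Y x y 1 2 (by omega) (by omega) (by omega) (by omega) (by omega) (by omega),
      rf_eq' X (Y+1) x (y+1) 0 0 (by omega) (by omega) (by omega) (by omega) (by omega) (by omega),
      rf_eq' (X+1) (Y+1) x (y+1) 1 0 (by omega) (by omega) (by omega) (by omega) (by omega) (by omega)]
    simp only [l00, l01, l10, l11, l02, l12, l20, l21, l22]; grind
  · rw [rf_eq' X Y x y 1 0 (by omega) (by omega) (by omega) (by omega) (by omega) (by omega),
      rf_eq' (X+1) Y x y 2 0 (by omega) (by omega) (by omega) (by omega) (by omega) (by omega),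
      rf_eq' X (Y+1) x y 1 1 (by omega) (by omega) (by omega) (by omega) (by omega) (by omega),
      rf_eq' (X+1) (Y+1) x y 2 1 (by omega) (by omega) (by omega) (by omega) (by omega) (by omega)]
    simp only [l00, l01, l10, l11, l02, l12, l20, l21, l22]; grind
  · rw [rf_eq' X Y x y 1 1 (by omega) (by omega) (by omega) (by omega) (by omega) (by omega),
      rf_eq' (X+1) Y x y 2 1 (by omega) (by omega) (by omega) (by omega) (by omega) (by omega),
      rf_eq' X (Y+1) x y 1 2 (by omega) (by omega) (by omega) (by omega) (by omega) (by omega),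
      rf_eq' (X+1) (Y+1) x y 2 2 (by omega) (by omega) (by omega) (by omega) (by omega) (by omega)]
    simp only [l00, l01, l10, l11, l02, l12, l20, l21, l22]; grind
  · rw [rf_eq' X Y x y 1 2 (by omega) (by omega) (by omega) (by omega) (by omega) (by omega),
      rf_eq' (X+1) Y x y 2 2 (by omega) (by omega) (by omega) (by omega) (by omega) (by omega),
      rf_eq' X (Y+1) x (y+1) 1 0 (by omega) (by omega) (by omega) (by omega) (by omega) (by omega),
      rf_eq' (X+1) (Y+1) x (y+1) 2 0 (by omega) (by omega) (by omega) (by omega) (by omega) (by omega)]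
    simp only [l00, l01, l10, l11, l02, l12, l20, l21, l22]; grind
  · rw [rf_eq' X Y x y 2 0 (by omega) (by omega) (by omega) (by omega) (by omega) (by omega),
      rf_eq' (X+1) Y (x+1) y 0 0 (by omega) (by omega) (by omega) (by omega) (by omega) (by omega),
      rf_eq' X (Y+1) x y 2 1 (by omega) (by omega) (by omega) (by omega) (by omega) (by omega),
      rf_eq' (X+1) (Y+1) (x+1) y 0 1 (by omega) (by omega) (by omega) (by omega) (by omega) (by omega)]
    simp only [l00, l01, l10, l11, l02, l12, l20, l21, l22]; grind
  · rw [rf_eq' X Y x y 2 1 (by omega) (by omega) (by omega) (by omega) (by omega) (by omega),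
      rf_eq' (X+1) Y (x+1) y 0 1 (by omega) (by omega) (by omega) (by omega) (by omega) (by omega),
      rf_eq' X (Y+1) x y 2 2 (by omega) (by omega) (by omega) (by omega) (by omega) (by omega),
      rf_eq' (X+1) (Y+1) (x+1) y 0 2 (by omega) (by omega) (by omega) (by omega) (by omega) (by omega)]
    simp only [l00, l01, l10, l11, l02, l12, l20, l21, l22]; grind
  · rw [rf_eq' X Y x y 2 2 (by omega) (by omega) (by omega) (by omega) (by omega) (by omega),
      rf_eq' (X+1) Y (x+1) y 0 2 (by omega) (by omega) (by omega) (by omega) (by omega) (by omega),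
      rf_eq' X (Y+1) x (y+1) 2 0 (by omega) (by omega) (by omega) (by omega) (by omega) (by omega),
      rf_eq' (X+1) (Y+1) (x+1) (y+1) 0 0 (by omega) (by omega) (by omega) (by omega) (by omega) (by omega)]
    simp only [l00, l01, l10, l11, l02, l12, l20, l21, l22]; grind

/-- The fine darts along a coarse dart. -/
def fd (f : Dt) (i : ℤ) : Dt :=
  ⟨3*f.x + 1 + dx f.d + (i-1)*dx (f.d+1), 3*f.y + 1 + dy f.d + (i-1)*dy (f.d+1), f.d⟩

lemma fd_st (f : Dt) (i : ℤ) : (fd f i).st = TT f.x f.y f.d i := by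
  obtain ⟨x, y, d⟩ := f
  revert d; apply forall4 <;> simp [fd, Dt.st, TT, Tl, f01, f11, f21, f31] <;> ring_nf <;> simp

lemma fd_en (f : Dt) (i : ℤ) : (fd f i).en = TT f.x f.y f.d (i+1) := by
  obtain ⟨x, y, d⟩ := f
  revert d; apply forall4 <;> simp [fd, Dt.en, TT, Tl, f01, f11, f21, f31] <;> ring_nf <;> simp

lemma TT0 (f : Dt) : TT f.x f.y f.d 0 = (3 * f.st.1, 3 * f.st.2) := by
  simp [TT, Tl, Dt.st]; constructor <;> ring

lemma TT3 (f : Dt) : TT f.x f.y f.d 3 = (3 * f.en.1, 3 * f.en.2) := by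
  simp [TT, Tl, Dt.en]; constructor <;> ring

lemma TT_rev (f : Dt) (i : ℤ) : TT f.rev.x f.rev.y f.rev.d i = TT f.x f.y f.d (3 - i) := by
  obtain ⟨x, y, d⟩ := f
  revert d; apply forall4 <;> simp [Dt.rev, TT, Tl, f01, f11, f21, f31, f02, f12, f22, f32] <;> ring_nf <;> simp

lemma loc_fd1 (a : Fin 4 → Bool) (i : ℤ) (h : i = 0 ∨ i = 1 ∨ i = 2) (d : Fin 4) :
    loc a (1 + dx d + (i-1)*dx (d+1)) (1 + dy d + (i-1)*dy (d+1)) = (decide (i = 1) && a d) := by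
  revert d
  rcases h with rfl | rfl | rfl <;> apply forall4 <;> rfl

lemma loc_fd2 (a : Fin 4 → Bool) (i : ℤ) (h : i = 0 ∨ i = 1 ∨ i = 2) (d : Fin 4) :
    loc a (1 - dx d + (i-1)*dx (d+1)) (1 - dy d + (i-1)*dy (d+1)) = (decide (i = 1) && a (d+2)) := by
  revert d
  rcases h with rfl | rfl | rfl <;> apply forall4 <;> rfl

lemma bnd_fd (i : ℤ) (h : i = 0 ∨ i = 1 ∨ i = 2) (d : Fin 4) :
    0 ≤ 1 + dx d + (i-1)*dx (d+1) ∧ 1 + dx d + (i-1)*dx (d+1) ≤ 2 ∧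
    0 ≤ 1 + dy d + (i-1)*dy (d+1) ∧ 1 + dy d + (i-1)*dy (d+1) ≤ 2 ∧
    0 ≤ 1 - dx d + (i-1)*dx (d+1) ∧ 1 - dx d + (i-1)*dx (d+1) ≤ 2 ∧
    0 ≤ 1 - dy d + (i-1)*dy (d+1) ∧ 1 - dy d + (i-1)*dy (d+1) ≤ 2 := by
  revert d
  rcases h with rfl | rfl | rfl <;> apply forall4 <;> decide

lemma rf_fd {K A} (f : Dt) (i : ℤ) (h : i = 0 ∨ i = 1 ∨ i = 2) :
    rf K A (fd f i).x (fd f i).y = xor (K f.x f.y) (decide (i = 1) && Ad A f) ∧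
    rf K A ((fd f i).x + dx f.d) ((fd f i).y + dy f.d) = xor (K f.rev.x f.rev.y) (decide (i = 1) && Ad A f.rev) := by
  obtain ⟨x, y, d⟩ := f
  obtain ⟨b1, b2, b3, b4, b5, b6, b7, b8⟩ := bnd_fd i h d
  simp only [fd, Ad, Dt.rev]
  rw [rf_eq' _ _ x y _ _ (by ring) (by ring) b1 b2 b3 b4, loc_fd1 _ i h]
  refine ⟨rfl, ?_⟩
  rw [rf_eq' _ _ (x + dx d) (y + dy d) _ _ (by ring) (by ring) b5 b6 b7 b8, loc_fd2 _ i h]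

lemma bd_fd02 {K A} {f : Dt} (hf : bd K f) (i : ℤ) (h : i = 0 ∨ i = 2) : bd (rf K A) (fd f i) := by
  have := rf_fd (K := K) (A := A) f i (by omega)
  have h1 : decide (i = 1) = false := by simp; omega
  simp only [bd]
  rw [show (fd f i).d = f.d from rfl, this.1, this.2, h1]
  simpa [Dt.rev, bd] using hf

lemma bd_fd1 {K A} {f : Dt} (hf : bd K f) (h1 : Ad A f = false) (h2 : Ad A f.rev = false) : bd (rf K A) (fd f 1) := by
  have := rf_fd (K := K) (A := A) f 1 (by omega)
  simp only [bd]
  rw [show (fd f 1).d = f.d from rfl, this.1, this.2, h1, h2]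
  simpa [Dt.rev, bd] using hf

lemma Cn01 {K A} {f : Dt} (hf : bd K f) : Cn (bd (rf K A)) (TT f.x f.y f.d 0) (TT f.x f.y f.d 1) := by
  have := Cn.of _ (bd_fd02 (A := A) hf 0 (by simp))
  rwa [fd_st, fd_en] at this

lemma Cn23 {K A} {f : Dt} (hf : bd K f) : Cn (bd (rf K A)) (TT f.x f.y f.d 2) (TT f.x f.y f.d 3) := by
  have := Cn.of _ (bd_fd02 (A := A) hf 2 (by simp))
  rwa [fd_st, fd_en] at this

lemma Cn12 {K A} {f : Dt} (hf : bd K f) (h1 : Ad A f = false) (h2 : Ad A f.rev = false) :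
    Cn (bd (rf K A)) (TT f.x f.y f.d 1) (TT f.x f.y f.d 2) := by
  have := Cn.of _ (bd_fd1 (A := A) hf h1 h2)
  rwa [fd_st, fd_en] at this

def t3 (v : ℤ × ℤ) : ℤ × ℤ := (3 * v.1, 3 * v.2)

lemma Cn03 {K A} {f : Dt} (hf : bd K f) (h1 : Ad A f = false) (h2 : Ad A f.rev = false) :
    Cn (bd (rf K A)) (t3 f.st) (t3 f.en) := by
  have := (Cn01 (A := A) hf).trans ((Cn12 hf h1 h2).trans (Cn23 hf))
  rwa [TT0, TT3] at this

/-- Classification of fine boundary darts. -/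
lemma fine_cases {K A} (hc : Cons K A) (g : Dt) (hg : bd (rf K A) g) :
    (∃ x y i j d, valid (A x y) i j d = true ∧ g = ⟨3*x+i, 3*y+j, d⟩) ∨
    (∃ f i, bd K f ∧ (i = 0 ∨ i = 1 ∨ i = 2) ∧ g = fd f i) := by
  obtain ⟨X, Y, d⟩ := g
  set x := X/3 with hx
  set y := Y/3 with hy
  set i := X%3 with hi
  set j := Y%3 with hj
  have hX : X = 3*x+i := by omega
  have hY : Y = 3*y+j := by omega
  have hi0 : 0 ≤ i := by omega
  have hi2 : i ≤ 2 := by omega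
  have hj0 : 0 ≤ j := by omega
  have hj2 : j ≤ 2 := by omega
  clear_value x y i j
  subst hX hY
  clear hx hy hi hj
  by_cases hin : 0 ≤ i + dx d ∧ i + dx d ≤ 2 ∧ 0 ≤ j + dy d ∧ j + dy d ≤ 2
  · left
    refine ⟨x, y, i, j, d, ?_, rfl⟩
    obtain ⟨h5, h6, h7, h8⟩ := hin
    simp only [valid, decide_eq_true_eq]
    refine ⟨hi0, hi2, hj0, hj2, h5, h6, h7, h8, ?_⟩
    simp only [bd] at hg
    rw [rf_eq K A x y i j hi0 hi2 hj0 hj2, show 3*x+i+dx d = 3*x+(i+dx d) by ring,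
      show 3*y+j+dy d = 3*y+(j+dy d) by ring, rf_eq K A x y _ _ h5 h6 h7 h8] at hg
    simpa using hg
  · right
    obtain ⟨k, hk, hgk⟩ : ∃ k : ℤ, (k = 0 ∨ k = 1 ∨ k = 2) ∧ (⟨3*x+i, 3*y+j, d⟩ : Dt) = fd ⟨x, y, d⟩ k := by
      clear hg
      revert d
      apply forall4 <;> simp only [fd, f01, f11, f21, f31, dx0, dx1, dx2, dx3, dy0, dy1, dy2, dy3, Dt.mk.injEq] <;> intro h
      · exact ⟨j, by omega, by omega, by omega, trivial⟩
      · exact ⟨2 - i, by omega, by omega, by omega, trivial⟩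
      · exact ⟨2 - j, by omega, by omega, by omega, trivial⟩
      · exact ⟨i, by omega, by omega, by omega, trivial⟩
    refine ⟨⟨x, y, d⟩, k, ?_, hk, hgk⟩
    by_contra hb
    rw [hgk] at hg
    have h1 := rf_fd (K := K) (A := A) ⟨x, y, d⟩ k hk
    have h2 := hc.a1 _ hb
    apply hg
    rw [show (fd ⟨x, y, d⟩ k).d = d from rfl, h1.1]
    have h3 := h1.2
    simp only at h3 ⊢
    rw [h3, h2]
    simp only [bd, not_not] at hb
    simp only [Dt.rev, hb]

def W3 (W : Set (ℤ × ℤ)) : Set (ℤ × ℤ) := {c | (c.1/3, c.2/3) ∈ W}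

lemma rf_fin {K A} (hK : Fin' K) (hA : {c : ℤ × ℤ | ∃ d, A c.1 c.2 d = true}.Finite) : Fin' (rf K A) := by
  have h1 : ((fun p : (ℤ × ℤ) × (Fin 3 × Fin 3) => ((3*p.1.1 + (p.2.1.val : ℤ), 3*p.1.2+(p.2.2.val:ℤ)) : ℤ × ℤ)) ''
     (({c : ℤ × ℤ | K c.1 c.2 = true} ∪ {c : ℤ × ℤ | ∃ d, A c.1 c.2 d = true}) ×ˢ Set.univ)).Finite :=
    ((hK.union hA).prod Set.finite_univ).image _
  refine h1.subset ?_
  rintro ⟨X, Y⟩ h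
  refine ⟨((X/3, Y/3), (⟨(X%3).toNat, by omega⟩, ⟨(Y%3).toNat, by omega⟩)), ⟨?_, trivial⟩, ?_⟩
  · simp only [Set.mem_setOf_eq, rf] at h
    by_cases hk : K (X/3) (Y/3) = true
    · exact Or.inl hk
    · right
      simp only [Set.mem_setOf_eq]
      by_contra hn
      push Not at hn
      simp only [Bool.not_eq_true] at hn hk
      rw [hk] at h
      simp [loc, hn] at h
  · simp only [Prod.mk.injEq]
    constructor <;> simp <;> omega

def bdW (K : Col) (W : Set (ℤ × ℤ)) : Prop := ∀ f, bd K f → (f.x, f.y) ∈ W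

lemma bdW_rf {K A W} (hc : Cons K A) (hW : bdW K W) (hA : ∀ x y d, A x y d = true → (x, y) ∈ W) :
    bdW (rf K A) (W3 W) := by
  intro g hg
  rcases fine_cases hc g hg with ⟨x, y, i, j, d, hv, rfl⟩ | ⟨f, i, hf, hi, rfl⟩
  · have hv' := hv
    simp only [valid, decide_eq_true_eq] at hv
    obtain ⟨h1, h2, h3, h4, h5, h6, h7, h8, h9⟩ := hv
    have e1 : (3*x+i)/3 = x := by omega
    have e2 : (3*y+j)/3 = y := by omega
    simp only [W3, Set.mem_setOf_eq, e1, e2]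
    by_contra hn
    have h10 : ∀ d, A x y d = false := by
      intro d; by_contra h; exact hn (hA x y d (by simpa using h))
    simp [loc, h10] at h9
  · obtain ⟨b1, b2, b3, b4, -⟩ := bnd_fd i hi f.d
    have := hW f hf
    simp only [W3, Set.mem_setOf_eq, fd]
    rwa [show (3 * f.x + 1 + dx f.d + (i-1)*dx (f.d+1))/3 = f.x by omega,
      show (3 * f.y + 1 + dy f.d + (i-1)*dy (f.d+1))/3 = f.y by omega]

lemma rf_off {K A} {W : Set (ℤ × ℤ)} (hA : ∀ x y d, A x y d = true → (x, y) ∈ W) {X Y : ℤ} (h : (X, Y) ∉ W3 W) :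
    rf K A X Y = K (X/3) (Y/3) := by
  have h10 : ∀ d, A (X/3) (Y/3) d = false := by
    intro d; by_contra hh; exact h (hA _ _ d (by simpa using hh))
  simp [rf, loc, h10]

def Wr (W : Set (ℤ × ℤ)) (a b : ℤ × ℤ) : Prop := a ∈ W ∧ b ∈ W ∧ ∃ d, b = (a.1 + dx d, a.2 + dy d)

def WConn (W : Set (ℤ × ℤ)) : Prop := ∀ a ∈ W, ∀ b ∈ W, Relation.ReflTransGen (Wr W) a b

lemma Wr_symm {W a b} (h : Wr W a b) : Wr W b a := by
  obtain ⟨h1, h2, d, rfl⟩ := h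
  refine ⟨h2, h1, d + 2, ?_⟩
  revert d; apply forall4 <;> simp [f02, f12, f22, f32]

lemma Wr_rtg_symm {W a b} (h : Relation.ReflTransGen (Wr W) a b) : Relation.ReflTransGen (Wr W) b a := by
  induction h with
  | refl => exact .refl
  | tail _ h ih => exact .head (Wr_symm h) ih

lemma W3_mem {W : Set (ℤ × ℤ)} {x y i j : ℤ} (h : (x, y) ∈ W) (hi : 0 ≤ i) (hi' : i ≤ 2) (hj : 0 ≤ j) (hj' : j ≤ 2) :
    (3*x+i, 3*y+j) ∈ W3 W := by
  simp only [W3, Set.mem_setOf_eq]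
  rwa [show (3*x+i)/3 = x by omega, show (3*y+j)/3 = y by omega]

lemma W3_block {W : Set (ℤ × ℤ)} {x y i j : ℤ} (h : (x, y) ∈ W) (hi : 0 ≤ i) (hi' : i ≤ 2) (hj : 0 ≤ j) (hj' : j ≤ 2) :
    Relation.ReflTransGen (Wr (W3 W)) (3*x+i, 3*y+j) (3*x+1, 3*y+1) := by
  have h1 : Relation.ReflTransGen (Wr (W3 W)) (3*x+i, 3*y+j) (3*x+1, 3*y+j) := by
    have hi3 : i = 0 ∨ i = 1 ∨ i = 2 := by omega
    rcases hi3 with rfl | rfl | rfl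
    · exact .single ⟨W3_mem h (by omega) (by omega) hj hj', W3_mem h (by omega) (by omega) hj hj', 0, by simp⟩
    · exact .refl
    · exact .single ⟨W3_mem h (by omega) (by omega) hj hj', W3_mem h (by omega) (by omega) hj hj', 2, by simp; ring⟩
  refine h1.trans ?_
  have hi3 : j = 0 ∨ j = 1 ∨ j = 2 := by omega
  rcases hi3 with rfl | rfl | rfl
  · exact .single ⟨W3_mem h (by omega) (by omega) hj hj', W3_mem h (by omega) (by omega) (by omega) (by omega), 1, by simp⟩
  · exact .refl
  · exact .single ⟨W3_mem h (by omega) (by omega) hj hj', W3_mem h (by omega) (by omega) (by omega) (by omega), 3, by simp; ring⟩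

lemma W3_conn {W : Set (ℤ × ℤ)} (hW : WConn W) : WConn (W3 W) := by
  have key : ∀ a b, Relation.ReflTransGen (Wr W) a b →
      Relation.ReflTransGen (Wr (W3 W)) (3*a.1+1, 3*a.2+1) (3*b.1+1, 3*b.2+1) := by
    intro a b h
    induction h with
    | refl => exact .refl
    | @tail b c _ h ih =>
      refine ih.trans ?_
      obtain ⟨h1, h2, d, rfl⟩ := h
      have bb := bnd_fd 1 (by simp) d
      simp only [sub_self, zero_mul, add_zero] at bb
      obtain ⟨b1, b2, b3, b4, b5, b6, b7, b8⟩ := bb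
      have m1 := W3_mem h1 b1 b2 b3 b4
      have m2 := W3_mem h2 b5 b6 b7 b8
      refine (Wr_rtg_symm (W3_block h1 b1 b2 b3 b4)).trans (.trans (.single ⟨m1, m2, d, ?_⟩) (W3_block h2 b5 b6 b7 b8))
      simp only [Prod.mk.injEq]; constructor <;> ring
  rintro ⟨X, Y⟩ ha ⟨X', Y'⟩ hb
  have e : ∀ Z : ℤ, 3 * (Z/3) + Z % 3 = Z := fun Z => by omega
  have h1 : Relation.ReflTransGen (Wr (W3 W)) (3*(X/3)+X%3, 3*(Y/3)+Y%3) (3*(X/3)+1, 3*(Y/3)+1) :=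
    W3_block (i := X % 3) (j := Y % 3) ha (by omega) (by omega) (by omega) (by omega)
  have h2 : Relation.ReflTransGen (Wr (W3 W)) (3*(X'/3)+X'%3, 3*(Y'/3)+Y'%3) (3*(X'/3)+1, 3*(Y'/3)+1) :=
    W3_block (i := X' % 3) (j := Y' % 3) hb (by omega) (by omega) (by omega) (by omega)
  rw [e, e] at h1 h2
  exact h1.trans ((key _ _ (hW _ ha _ hb)).trans (Wr_rtg_symm h2))

end JL

open Set
set_option linter.all false
namespace JL

def GM (K : Col) (W : Set (ℤ × ℤ)) : SimpleGraph (ℤ × ℤ) where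
  Adj a b := Wr W a b ∧ K a.1 a.2 = K b.1 b.2
  symm := ⟨fun a b h => ⟨Wr_symm h.1, h.2.symm⟩⟩
  loopless := by
    constructor
    rintro ⟨x, y⟩ ⟨⟨_, _, d, h⟩, _⟩
    revert d; apply forall4 <;> simp

lemma exists_mono {K W} (hW : bdW K W) (hWc : WConn W) {e e' : Dt} (he : bd K e) (he' : bd K e')
    (hn : ¬ Cn (bd K) e.st e'.st) :
    ∃ f f', bd K f ∧ bd K f' ∧ ¬ Cn (bd K) f.st f'.st ∧ (GM K W).Reachable (f.x, f.y) (f'.x, f'.y) := by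
  by_contra hcon
  push Not at hcon
  have hh : ∀ f f', bd K f → bd K f' → (GM K W).Reachable (f.x, f.y) (f'.x, f'.y) → Cn (bd K) f.st f'.st := by
    intro f f' h1 h2 h3
    by_contra h4
    exact hcon f f' h1 h2 h4 h3
  have key : ∀ c, Relation.ReflTransGen (Wr W) (e.x, e.y) c →
      ∃ f, bd K f ∧ (GM K W).Reachable (f.x, f.y) c ∧ Cn (bd K) e.st f.st := by
    intro c h
    induction h with
    | refl => exact ⟨e, he, SimpleGraph.Reachable.refl _, Cn.refl _⟩
    | @tail b c _ h ih =>
      obtain ⟨f, h1, h2, h3⟩ := ih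
      by_cases hk : K b.1 b.2 = K c.1 c.2
      · exact ⟨f, h1, h2.trans (SimpleGraph.Adj.reachable ⟨h, hk⟩), h3⟩
      · obtain ⟨_, _, d, rfl⟩ := h
        have hb : bd K ⟨b.1, b.2, d⟩ := hk
        have h4 := hh f _ h1 hb h2
        refine ⟨Dt.rev ⟨b.1, b.2, d⟩, bd_rev.2 hb, SimpleGraph.Reachable.refl _, ?_⟩
        rw [st_rev]
        exact h3.trans (h4.trans (Cn.of _ hb))
  obtain ⟨f, h1, h2, h3⟩ := key (e'.x, e'.y) (hWc _ (hW _ he) _ (hW _ he'))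
  exact hn (h3.trans (hh f e' h1 he' h2))

structure PathData (K : Col) (W : Set (ℤ × ℤ)) where
  k : ℕ
  s : ℕ → ℤ × ℤ
  u : ℕ → Fin 4
  w : ℕ → Fin 4
  inj : ∀ i ≤ k, ∀ j ≤ k, s i = s j → i = j
  link : ∀ j < k, Dt.rev ⟨(s j).1, (s j).2, w j⟩ = ⟨(s (j+1)).1, (s (j+1)).2, u (j+1)⟩
  mono : ∀ j ≤ k, K (s j).1 (s j).2 = K (s 0).1 (s 0).2
  mem : ∀ j ≤ k, s j ∈ W
  b0 : bd K ⟨(s 0).1, (s 0).2, u 0⟩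
  bk : bd K ⟨(s k).1, (s k).2, w k⟩
  ne : ∀ j ≤ k, u j ≠ w j
  nc : ¬ Cn (bd K) (Dt.st ⟨(s 0).1, (s 0).2, u 0⟩) (Dt.st ⟨(s k).1, (s k).2, w k⟩)

lemma exists_path {K W} (hW : bdW K W) (hWc : WConn W) {e e' : Dt} (he : bd K e) (he' : bd K e')
    (hn : ¬ Cn (bd K) e.st e'.st) : Nonempty (PathData K W) := by
  obtain ⟨f, f', h1, h2, h3, h4⟩ := exists_mono hW hWc he he' hn
  obtain ⟨p, hp⟩ := h4.exists_isPath
  set k := p.length with hk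
  have hadj : ∀ j, ∃ d, j < k → p.getVert (j+1) = ((p.getVert j).1 + dx d, (p.getVert j).2 + dy d) := by
    intro j
    by_cases h : j < k
    · obtain ⟨⟨_, _, d, hd⟩, _⟩ := p.adj_getVert_succ h
      exact ⟨d, fun _ => hd⟩
    · exact ⟨0, fun h' => absurd h' h⟩
  choose D hD using hadj
  have inj : ∀ i ≤ k, ∀ j ≤ k, p.getVert i = p.getVert j → i = j := fun i hi j hj h =>
    hp.getVert_injOn hi hj h
  have hmono : ∀ j ≤ k, K (p.getVert j).1 (p.getVert j).2 = K (p.getVert 0).1 (p.getVert 0).2 := by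
    intro j
    induction j with
    | zero => intro _; rfl
    | succ j ih =>
      intro hj
      rw [← ih (by omega)]
      exact (p.adj_getVert_succ (by omega : j < p.length)).2.symm
  have hlink : ∀ j < k, Dt.rev ⟨(p.getVert j).1, (p.getVert j).2, D j⟩ = ⟨(p.getVert (j+1)).1, (p.getVert (j+1)).2, D j + 2⟩ := by
    intro j hj
    rw [hD j hj]; rfl
  let w : ℕ → Fin 4 := fun j => if j < k then D j else f'.d
  let u : ℕ → Fin 4 := fun j => if j = 0 then f.d else D (j-1) + 2
  have hu : ∀ j, u (j+1) = D j + 2 := fun j => by simp [u]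
  have hw : ∀ j < k, w j = D j := fun j hj => by simp [w, hj]
  have s0 : p.getVert 0 = (f.x, f.y) := by simp
  have sk : p.getVert k = (f'.x, f'.y) := by simp [hk]
  have e0 : (⟨(p.getVert 0).1, (p.getVert 0).2, u 0⟩ : Dt) = f := by simp [u]
  have ek : (⟨(p.getVert k).1, (p.getVert k).2, w k⟩ : Dt) = f' := by simp [w, sk]
  have hcol : ∀ j ≤ k, ∀ g : Dt, (g.x, g.y) = p.getVert j → bd K g → ∀ i ≤ k, p.getVert i ≠ (g.x + dx g.d, g.y + dy g.d) := by
    intro j hj g hg hb i hi hne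
    apply hb
    have a := hmono j hj
    have b := hmono i hi
    rw [← hg] at a
    rw [hne] at b
    exact a.trans b.symm
  refine ⟨⟨k, p.getVert, u, w, inj, ?_, hmono, ?_, by rw [e0]; exact h1, by rw [ek]; exact h2, ?_, by rw [e0, ek]; exact h3⟩⟩
  · intro j hj
    rw [hw j hj, hu]
    exact hlink j hj
  · intro j hj
    rcases Nat.lt_or_ge j k with h | h
    · exact (p.adj_getVert_succ h).1.1
    · have : j = k := by omega
      rw [this, sk]; exact hW _ h2
  · intro j hj huw
    rcases Nat.eq_zero_or_pos j with rfl | hjp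
    · rcases Nat.eq_zero_or_pos k with hk0 | hkp
      · apply h3
        have : f = f' := e0.symm.trans (Eq.trans (by rw [hk0, huw]) ek)
        rw [this]; exact Cn.refl _
      · apply hcol 0 hj f (by rw [s0]) h1 1 hkp
        rw [hD 0 hkp, ← hw 0 hkp, ← huw, s0]; rfl
    · obtain ⟨i, rfl⟩ : ∃ i, j = i + 1 := ⟨j-1, by omega⟩
      have hl := congrArg Dt.rev (hlink i (by omega))
      rw [rev_rev, ← hu, huw] at hl
      rcases Nat.lt_or_ge (i+1) k with h | h
      · have := hlink (i+1) h
        rw [← hw _ h, ← hl] at this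
        have hx := congrArg Dt.x this
        have hy := congrArg Dt.y this
        simp only at hx hy
        have := inj i (by omega) (i+1+1) (by omega) (Prod.ext hx hy)
        omega
      · have hik : i + 1 = k := by omega
        rw [hik, ek] at hl
        apply hcol k le_rfl f' (by rw [sk]) h2 i (by omega)
        have hx := congrArg Dt.x hl
        have hy := congrArg Dt.y hl
        exact Prod.ext hx hy

end JL

open Set
set_option linter.all false
namespace JL

namespace PathData
variable {K : Col} {W : Set (ℤ × ℤ)} (p : PathData K W)

def U (j : ℕ) : Dt := ⟨(p.s j).1, (p.s j).2, p.u j⟩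
def V (j : ℕ) : Dt := ⟨(p.s j).1, (p.s j).2, p.w j⟩

open Classical in
noncomputable def A : ℤ → ℤ → Fin 4 → Bool := fun x y d =>
  decide (∃ j ≤ p.k, p.s j = (x, y) ∧ (d = p.u j ∨ d = p.w j))

lemma A_s {j} (hj : j ≤ p.k) : p.A (p.s j).1 (p.s j).2 = ind (p.u j) (p.w j) := by
  funext d
  simp only [A, ind]
  rw [decide_eq_decide]
  constructor
  · rintro ⟨i, hi, h1, h2⟩
    have : i = j := p.inj i hi j hj h1
    subst this; exact h2
  · intro h; exact ⟨j, hj, rfl, h⟩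

lemma Ad_iff (f : Dt) : Ad p.A f = true ↔ ∃ j ≤ p.k, f = p.U j ∨ f = p.V j := by
  obtain ⟨x, y, d⟩ := f
  simp only [Ad, A, decide_eq_true_eq, U, V, Dt.mk.injEq]
  constructor
  · rintro ⟨j, hj, h1, h2⟩
    refine ⟨j, hj, ?_⟩
    rw [h1]; simpa using h2
  · rintro ⟨j, hj, h⟩
    refine ⟨j, hj, ?_⟩
    rcases h with ⟨h1, h2, h3⟩ | ⟨h1, h2, h3⟩
    · exact ⟨Prod.ext h1.symm h2.symm, .inl h3⟩
    · exact ⟨Prod.ext h1.symm h2.symm, .inr h3⟩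

lemma lk {j} (hj : j < p.k) : (p.V j).rev = p.U (j+1) := p.link j hj

lemma Ad_col {f : Dt} (h : Ad p.A f = true) : K f.x f.y = K (p.s 0).1 (p.s 0).2 := by
  obtain ⟨j, hj, rfl | rfl⟩ := (p.Ad_iff f).1 h
  · exact p.mono j hj
  · exact p.mono j hj

lemma Ad_U {j} (hj : j ≤ p.k) : Ad p.A (p.U j) = true := (p.Ad_iff _).2 ⟨j, hj, .inl rfl⟩
lemma Ad_V {j} (hj : j ≤ p.k) : Ad p.A (p.V j) = true := (p.Ad_iff _).2 ⟨j, hj, .inr rfl⟩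

lemma a2 (f : Dt) (hf : bd K f) : ¬ (Ad p.A f = true ∧ Ad p.A f.rev = true) := by
  rintro ⟨h1, h2⟩
  exact hf ((p.Ad_col h1).trans (p.Ad_col h2).symm)

lemma Ad_or {f : Dt} (h : Ad p.A f = true) : Ad p.A f.rev = true ∨ f = p.U 0 ∨ f = p.V p.k := by
  obtain ⟨j, hj, rfl | rfl⟩ := (p.Ad_iff f).1 h
  · rcases j with _ | j
    · exact .inr (.inl rfl)
    · left
      rw [← p.lk (by omega), rev_rev]
      exact p.Ad_V (by omega)
  · rcases Nat.lt_or_ge j p.k with h | h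
    · left
      rw [p.lk h]; exact p.Ad_U (by omega)
    · have : j = p.k := by omega
      subst this
      exact .inr (.inr rfl)

lemma bdAd {f : Dt} (hf : bd K f) (h : Ad p.A f = true) : f = p.U 0 ∨ f = p.V p.k :=
  (p.Ad_or h).resolve_left fun h' => p.a2 f hf ⟨h, h'⟩

lemma bU : bd K (p.U 0) := p.b0
lemma bV : bd K (p.V p.k) := p.bk

lemma cons : Cons K p.A := by
  have key : ∀ f, ¬ bd K f → Ad p.A f = true → Ad p.A f.rev = true := by
    intro f hf h
    rcases p.Ad_or h with h | rfl | rfl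
    · exact h
    · exact absurd p.bU hf
    · exact absurd p.bV hf
  refine ⟨fun f hf => ?_, p.a2⟩
  rw [Bool.eq_iff_iff]
  refine ⟨key f hf, fun h => ?_⟩
  have := key f.rev (fun h' => hf (bd_rev.1 h')) h
  rwa [rev_rev] at this

lemma A_W : ∀ x y d, p.A x y d = true → (x, y) ∈ W := by
  intro x y d h
  simp only [A, decide_eq_true_eq] at h
  obtain ⟨j, hj, h1, _⟩ := h
  rw [← h1]; exact p.mem j hj

lemma A_fin : {c : ℤ × ℤ | ∃ d, p.A c.1 c.2 d = true}.Finite := by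
  refine ((Set.finite_Iic p.k).image p.s).subset ?_
  rintro ⟨x, y⟩ ⟨d, h⟩
  simp only [A, decide_eq_true_eq] at h
  obtain ⟨j, hj, h1, _⟩ := h
  exact ⟨j, hj, h1⟩

def Q : ℤ × ℤ → ℤ × ℤ → Prop := Cn (bd (rf K p.A))

lemma chain {j} (hj : j ≤ p.k) :
    p.Q (TT (p.U 0).x (p.U 0).y (p.U 0).d 1) (TT (p.V j).x (p.V j).y (p.V j).d 2) ∧
    p.Q (TT (p.U 0).x (p.U 0).y (p.U 0).d 2) (TT (p.V j).x (p.V j).y (p.V j).d 1) := by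
  induction j with
  | zero => exact ⟨strand1 (p.ne 0 hj) (p.A_s hj), strand2 (p.ne 0 hj) (p.A_s hj)⟩
  | succ j ih =>
    obtain ⟨h1, h2⟩ := ih (by omega)
    have e1 := TT_rev (p.V j) 1
    have e2 := TT_rev (p.V j) 2
    rw [p.lk (by omega)] at e1 e2
    norm_num at e1 e2
    rw [← e1] at h1
    rw [← e2] at h2
    exact ⟨h1.trans (strand1 (p.ne _ hj) (p.A_s hj)), h2.trans (strand2 (p.ne _ hj) (p.A_s hj))⟩

lemma chainU {j} (hj : j ≤ p.k) :
    p.Q (TT (p.U 0).x (p.U 0).y (p.U 0).d 1) (TT (p.U j).x (p.U j).y (p.U j).d 1) := by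
  rcases j with _ | j
  · exact Cn.refl _
  · have h1 := (p.chain (j := j) (by omega)).1
    have e1 := TT_rev (p.V j) 1
    rw [p.lk (by omega)] at e1
    norm_num at e1
    rwa [← e1] at h1

lemma q01 {f : Dt} (hf : bd K f) : p.Q (t3 f.st) (TT f.x f.y f.d 1) := by
  have := Cn01 (A := p.A) hf
  rwa [TT0] at this
lemma q23 {f : Dt} (hf : bd K f) : p.Q (TT f.x f.y f.d 2) (t3 f.en) := by
  have := Cn23 (A := p.A) hf
  rwa [TT3] at this

lemma qA : p.Q (t3 (p.U 0).st) (t3 (p.V p.k).en) :=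
  (p.q01 p.bU).trans ((p.chain le_rfl).1.trans (p.q23 p.bV))

lemma lift_av {e e' : Dt} (hn : ¬ Cn (bd K) e.st e'.st)
    (hee : ∀ f, bd K f → Ad p.A f = true → f = e ∨ f = e') (he' : bd K e') {v w}
    (h : Cn (fun f => bd K f ∧ f ≠ e ∧ f ≠ e.rev) v w) :
    Cn (bd K) v w ∧ (Cn (bd K) e.st v → p.Q (t3 v) (t3 w)) := by
  induction h with
  | refl v => exact ⟨Cn.refl _, fun _ => Cn.refl _⟩
  | symm v w _ ih => exact ⟨ih.1.symm, fun h => (ih.2 (h.trans ih.1.symm)).symm⟩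
  | trans u v w _ _ ih1 ih2 => exact ⟨ih1.1.trans ih2.1, fun h => (ih1.2 h).trans (ih2.2 (h.trans ih1.1))⟩
  | rel v w h =>
    obtain ⟨f, ⟨h1, h2, h3⟩, rfl, rfl⟩ := h
    refine ⟨Cn.of f h1, fun h => Cn03 h1 ?_ ?_⟩
    · by_contra hh
      rcases hee f h1 (by simpa using hh) with rfl | rfl
      · exact h2 rfl
      · exact hn h
    · by_contra hh
      rcases hee f.rev (bd_rev.2 h1) (by simpa using hh) with h' | h'
      · apply h3; rw [← h', rev_rev]
      · apply hn
        rw [← h', st_rev]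
        exact h.trans (Cn.of f h1)

lemma q1 (hK : Fin' K) (np : NP K) : p.Q (t3 (p.U 0).st) (t3 (p.U 0).en) :=
  (p.lift_av (e := p.U 0) (e' := p.V p.k) p.nc (fun f h1 h2 => p.bdAd h1 h2) p.bV (bridge hK p.bU)).2 (Cn.refl _)
lemma q2 (hK : Fin' K) (np : NP K) : p.Q (t3 (p.V p.k).st) (t3 (p.V p.k).en) :=
  (p.lift_av (e := p.V p.k) (e' := p.U 0) (fun h => p.nc h.symm) (fun f h1 h2 => (p.bdAd h1 h2).symm) p.bU (bridge hK p.bV)).2 (Cn.refl _)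

lemma q_dart (hK : Fin' K) (np : NP K) (f : Dt) (hf : bd K f) : p.Q (t3 f.st) (t3 f.en) := by
  by_cases h1 : Ad p.A f = true
  · rcases p.bdAd hf h1 with rfl | rfl
    · exact p.q1 hK np
    · exact p.q2 hK np
  by_cases h2 : Ad p.A f.rev = true
  · rw [← st_rev f, ← en_rev f]
    rcases p.bdAd (bd_rev.2 hf) h2 with h | h
    · rw [h]; exact (p.q1 hK np).symm
    · rw [h]; exact (p.q2 hK np).symm
  exact Cn03 hf (by simpa using h1) (by simpa using h2)

lemma q_lift (hK : Fin' K) (np : NP K) {v w} (h : Cn (bd K) v w) : p.Q (t3 v) (t3 w) := by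
  induction h with
  | refl v => exact Cn.refl _
  | symm v w _ ih => exact ih.symm
  | trans u v w _ _ ih1 ih2 => exact ih1.trans ih2
  | rel v w h =>
    obtain ⟨f, h1, rfl, rfl⟩ := h
    exact p.q_dart hK np f h1

lemma fine (hK : Fin' K) (np : NP K) (g : Dt) (hg : bd (rf K p.A) g) : ∃ f, bd K f ∧ p.Q g.st (t3 f.st) := by
  rcases fine_cases p.cons g hg with ⟨x, y, i, j, d, hv, rfl⟩ | ⟨f, i, hf, hi, rfl⟩
  · have : ∃ d, p.A x y d = true := by
      by_contra hcon
      push Not at hcon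
      have h0 : ∀ d, p.A x y d = false := fun d => by simpa using hcon d
      simp [valid, loc, h0] at hv
    obtain ⟨d', hd'⟩ := this
    simp only [A, decide_eq_true_eq] at hd'
    obtain ⟨n, hn, h1, _⟩ := hd'
    obtain ⟨rfl, rfl⟩ : (p.s n).1 = x ∧ (p.s n).2 = y := by rw [h1]; simp
    refine ⟨p.U 0, p.bU, ?_⟩
    rcases strand_complete (K := K) (p.ne n hn) (p.A_s hn) hv with h | h
    · exact h.symm.trans ((p.chainU hn).symm.trans (p.q01 p.bU).symm)
    · exact h.symm.trans ((p.chain hn).2.symm.trans ((p.q23 p.bU).trans (p.q1 hK np).symm))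
  · refine ⟨f, hf, ?_⟩
    rw [fd_st]
    rcases hi with rfl | rfl | rfl
    · rw [TT0]; exact Cn.refl _
    · exact (p.q01 hf).symm
    · exact (p.q23 hf).trans (p.q_dart hK np f hf).symm

end PathData

def Cov (K : Col) (R : Finset (ℤ × ℤ)) : Prop := ∀ f, bd K f → ∃ r ∈ R, Cn (bd K) f.st r

lemma step {K W} (p : PathData K W) (hK : Fin' K) (np : NP K) (hW : bdW K W) :
    ∃ K', Fin' K' ∧ NP K' ∧ bdW K' (W3 W) ∧ (∀ X Y, (X, Y) ∉ W3 W → K' X Y = K (X/3) (Y/3)) ∧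
      ∀ R, Cov K R → ∃ R', Cov K' R' ∧ R'.card < R.card := by
  refine ⟨rf K p.A, rf_fin hK p.A_fin, NP_rf p.cons np, bdW_rf p.cons hW p.A_W, fun X Y h => rf_off p.A_W h, ?_⟩
  intro R hR
  obtain ⟨r1, h1, c1⟩ := hR _ p.bU
  obtain ⟨r2, h2, c2⟩ := hR _ p.bV
  have hne : r1 ≠ r2 := by
    rintro rfl
    exact p.nc (c1.trans c2.symm)
  refine ⟨(R.erase r2).image t3, ?_, ?_⟩
  · intro g hg
    obtain ⟨f, hf, hq⟩ := p.fine hK np g hg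
    obtain ⟨r, hr, c⟩ := hR f hf
    by_cases hrr : r = r2
    · subst hrr
      refine ⟨t3 r1, Finset.mem_image_of_mem _ (Finset.mem_erase.2 ⟨hne, h1⟩), ?_⟩
      exact hq.trans ((p.q_lift hK np c).trans ((p.q_lift hK np c2).symm.trans ((p.q2 hK np).trans (p.qA.symm.trans (p.q_lift hK np c1)))))
    · exact ⟨t3 r, Finset.mem_image_of_mem _ (Finset.mem_erase.2 ⟨hrr, hr⟩), hq.trans (p.q_lift hK np c)⟩
  · exact lt_of_le_of_lt Finset.card_image_le (Finset.card_erase_lt_of_mem h2)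

lemma exists_cov {K} (hK : Fin' K) : ∃ R, Cov K R := by
  refine ⟨((BD_finite hK).toFinset).image Dt.st ∪ ((BD_finite hK).toFinset).image Dt.en, ?_⟩
  intro f hf
  refine ⟨f.st, ?_, Cn.refl _⟩
  rw [Finset.mem_union, Finset.mem_image, Finset.mem_image]
  rcases bd_BD hf with h | h
  · exact .inl ⟨f, by simpa using h, rfl⟩
  · exact .inr ⟨f.rev, by simpa using h, en_rev f⟩

def Wm (m : ℤ) (W : Set (ℤ × ℤ)) : Set (ℤ × ℤ) := {c | (c.1/m, c.2/m) ∈ W}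

lemma connect (n : ℕ) : ∀ (K : Col) (W : Set (ℤ × ℤ)) (R : Finset (ℤ × ℤ)), R.card = n → Cov K R → Fin' K → NP K → bdW K W → WConn W →
    ∃ (m : ℤ) (K' : Col), 0 < m ∧ Fin' K' ∧ NP K' ∧ bdW K' (Wm m W) ∧
      (∀ X Y, (X, Y) ∉ Wm m W → K' X Y = K (X/m) (Y/m)) ∧
      ∀ f g, bd K' f → bd K' g → Cn (bd K') f.st g.st := by
  induction n using Nat.strong_induction_on with
  | _ n ih =>
    intro K W R hn hR hK np hW hWc
    by_cases hcon : ∀ f g, bd K f → bd K g → Cn (bd K) f.st g.st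
    · refine ⟨1, K, one_pos, hK, np, by simpa [Wm] using hW, by simp, hcon⟩
    push Not at hcon
    obtain ⟨e, e', he, he', hn'⟩ := hcon
    obtain ⟨p⟩ := exists_path hW hWc he he' hn'
    obtain ⟨K1, a1, a2, a3, a4, a5⟩ := step p hK np hW
    obtain ⟨R1, b1, b2⟩ := a5 R hR
    obtain ⟨m, K', hm, c1, c2, c3, c4, c5⟩ := ih _ (hn ▸ b2) K1 (W3 W) R1 rfl b1 a1 a2 a3 (W3_conn hWc)
    have e : Wm m (W3 W) = Wm (m*3) W := by
      ext c; simp [W3, Wm, Int.ediv_ediv_of_nonneg hm.le]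
    rw [e] at c3 c4
    refine ⟨m*3, K', by positivity, c1, c2, c3, ?_, c5⟩
    intro X Y h
    rw [c4 X Y h, a4, Int.ediv_ediv_of_nonneg hm.le, Int.ediv_ediv_of_nonneg hm.le]
    rw [← e] at h; exact h

end JL

open Set
set_option linter.all false
namespace JL

lemma orbit_all {K : Col} (hK : Fin' K) (np : NP K) (hc : ∀ f g, bd K f → bd K g → Cn (bd K) f.st g.st)
    {e : Dt} (he : e ∈ BD K) {g : Dt} (hg : g ∈ BD K) :
    ∃ i < Function.minimalPeriod (nx K) e, (nx K)^[i] e = g := by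
  have hpos := nx_per hK he
  set n := Function.minimalPeriod (nx K) e with hn
  have key : ∀ v w, Cn (bd K) v w → ((∃ i, ((nx K)^[i] e).st = v) ↔ (∃ i, ((nx K)^[i] e).st = w)) := by
    intro v w h
    have hB : ∀ f ∈ BD K, ((∃ i, ((nx K)^[i] e).st = f.st) ↔ (∃ i, ((nx K)^[i] e).st = f.en)) := by
      intro f hf
      constructor
      · rintro ⟨i, hi⟩
        have := st_inj np (nx_iter_BD he i) hf hi
        refine ⟨i+1, ?_⟩
        rw [Function.iterate_succ_apply', this, nx_st]
      · rintro ⟨i, hi⟩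
        rw [← nx_st] at hi
        have h1 := st_inj np (nx_iter_BD he i) (nx_BD hf) hi
        refine ⟨i + n - 1, ?_⟩
        have h2 : (nx K)^[i + n] e = nx K f := by
          rw [Function.iterate_add_apply, hn, Function.iterate_minimalPeriod, h1]
        rw [show i + n = (i+n-1) + 1 by omega, Function.iterate_succ_apply'] at h2
        have h3 := congrArg (pv K) h2
        rw [pv_nx (nx_iter_BD he _), pv_nx hf] at h3
        rw [h3]
    induction h with
    | refl v => rfl
    | symm v w _ ih => exact ih.symm
    | trans u v w _ _ ih1 ih2 => exact ih1.trans ih2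
    | rel v w h =>
      obtain ⟨f, h1, rfl, rfl⟩ := h
      rcases bd_BD h1 with h | h
      · exact hB f h
      · have := hB _ h
        rw [st_rev, en_rev] at this
        exact this.symm
  obtain ⟨i, hi⟩ := (key _ _ (hc e g (BD_bd he) (BD_bd hg))).1 ⟨0, rfl⟩
  have h1 := st_inj np (nx_iter_BD he i) hg hi
  refine ⟨i % n, Nat.mod_lt _ hpos, ?_⟩
  rw [← h1]
  exact Function.iterate_mod_minimalPeriod_eq

noncomputable def toC (v : ℤ × ℤ) : ℂ := ⟨v.1, v.2⟩

/-- clamp -/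
noncomputable def cl (t : ℝ) : ℝ := max 0 (min 1 t)

lemma cl_of_nonpos {t : ℝ} (h : t ≤ 0) : cl t = 0 := by
  simp only [cl]; rw [min_eq_right (by linarith)]; exact max_eq_left h
lemma cl_of_one_le {t : ℝ} (h : 1 ≤ t) : cl t = 1 := by
  simp only [cl]; rw [min_eq_left h]; exact max_eq_right zero_le_one
lemma cl_mid {t : ℝ} (h : 0 ≤ t) (h' : t ≤ 1) : cl t = t := by
  simp only [cl]; rw [min_eq_right h']; exact max_eq_right h
lemma cl_cont : Continuous cl := by unfold cl; fun_prop

noncomputable def pl (n : ℕ) (P : ℕ → ℂ) (t : ℝ) : ℂ :=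
  P 0 + ∑ i ∈ Finset.range n, (cl (n * t - i) : ℂ) * (P (i+1) - P i)

lemma pl_cont (n P) : Continuous (pl n P) := by
  unfold pl
  refine continuous_const.add (continuous_finset_sum _ fun i _ => ?_)
  refine Continuous.mul ?_ continuous_const
  exact Complex.continuous_ofReal.comp (cl_cont.comp (by fun_prop))

lemma pl_eq {n : ℕ} {P : ℕ → ℂ} {k : ℕ} (hk : k < n) {s : ℝ} (h0 : 0 ≤ s) (h1 : s ≤ 1) :
    pl n P ((k + s)/n) = P k + s * (P (k+1) - P k) := by
  have hn : (n:ℝ) ≠ 0 := by have : 0 < n := by omega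
                            positivity
  have e : (n:ℝ) * ((k+s)/n) = k + s := by field_simp
  unfold pl
  rw [e]
  obtain ⟨m, rfl⟩ : ∃ m, n = (k + 1) + m := ⟨n - (k+1), by omega⟩
  rw [Finset.sum_range_add, Finset.sum_range_succ]
  have a1 : ∑ i ∈ Finset.range k, (cl (k + s - i) : ℂ) * (P (i+1) - P i) = P k - P 0 := by
    rw [← Finset.sum_range_sub]
    refine Finset.sum_congr rfl fun i hi => ?_
    have : (i:ℝ) + 1 ≤ k := by exact_mod_cast Finset.mem_range.1 hi
    rw [cl_of_one_le (by linarith)]; simp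
  have a2 : ∑ i ∈ Finset.range m, (cl (k + s - ((k + 1 + i : ℕ):ℝ)) : ℂ) * (P (k+1+i+1) - P (k+1+i)) = 0 := by
    refine Finset.sum_eq_zero fun i hi => ?_
    rw [cl_of_nonpos]; · simp
    push_cast
    have : (0:ℝ) ≤ i := by positivity
    linarith
  rw [a1, a2, show (k:ℝ) + s - k = s by ring, cl_mid h0 h1]
  ring

lemma pl_param {n : ℕ} (hn : 0 < n) {t : ℝ} (h0 : 0 ≤ t) (h1 : t < 1) :
    ∃ k < n, ∃ s : ℝ, 0 ≤ s ∧ s < 1 ∧ t = (k + s)/n := by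
  have hn' : (0:ℝ) < n := by positivity
  have h2 : (0:ℝ) ≤ n * t := by positivity
  refine ⟨⌊(n:ℝ) * t⌋₊, ?_, n*t - ⌊(n:ℝ) * t⌋₊, ?_, ?_, ?_⟩
  · rw [Nat.floor_lt h2]; nlinarith
  · linarith [Nat.floor_le h2]
  · linarith [Nat.lt_floor_add_one ((n:ℝ) * t)]
  · field_simp; ring

lemma pl_one {n : ℕ} (hn : 0 < n) (P) : pl n P 1 = P n := by
  have := pl_eq (n := n) (P := P) (k := n-1) (by omega) zero_le_one le_rfl
  have e : (((n-1:ℕ):ℝ) + 1)/n = 1 := by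
    rw [Nat.cast_sub (by omega)]; have : (0:ℝ) < n := by positivity
    field_simp; simp
  rw [e] at this
  rw [this, Nat.sub_add_cancel (by omega)]
  simp

lemma pl_zero {n : ℕ} (hn : 0 < n) (P) : pl n P 0 = P 0 := by
  have := pl_eq (n := n) (P := P) (k := 0) hn le_rfl zero_le_one
  simpa using this

lemma seg_mem {a b : ℂ} {s : ℝ} (h0 : 0 ≤ s) (h1 : s ≤ 1) : a + s * (b - a) ∈ segment ℝ a b := by
  rw [segment_eq_image']
  exact ⟨s, ⟨h0, h1⟩, by simp⟩

lemma pl_image {n : ℕ} (hn : 0 < n) (P) :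
    pl n P '' Icc 0 1 = ⋃ i : Fin n, segment ℝ (P i) (P (i+1)) := by
  have hn' : (0:ℝ) < n := by positivity
  ext z
  simp only [mem_iUnion, mem_image]
  constructor
  · rintro ⟨t, ⟨h0, h1⟩, rfl⟩
    rcases lt_or_eq_of_le h1 with h | rfl
    · obtain ⟨k, hk, s, s0, s1, rfl⟩ := pl_param hn h0 h
      refine ⟨⟨k, hk⟩, ?_⟩
      rw [pl_eq hk s0 s1.le]
      exact seg_mem s0 s1.le
    · refine ⟨⟨n-1, by omega⟩, ?_⟩
      rw [pl_one hn]
      simp only [Nat.sub_add_cancel (show 1 ≤ n by omega)]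
      exact right_mem_segment _ _ _
  · rintro ⟨⟨k, hk⟩, h⟩
    rw [segment_eq_image'] at h
    obtain ⟨s, ⟨s0, s1⟩, rfl⟩ := h
    refine ⟨(k+s)/n, ⟨by positivity, ?_⟩, ?_⟩
    · rw [div_le_one hn']
      have : (k:ℝ) + 1 ≤ n := by exact_mod_cast hk
      linarith
    · rw [pl_eq hk s0 s1]; simp

lemma int_small {N : ℤ} {r : ℝ} (h : (N:ℝ) = r) (h1 : -2 < r) (h2 : r < 2) : N = -1 ∨ N = 0 ∨ N = 1 := by
  have a : -2 < N := by exact_mod_cast (h ▸ h1 : (-2:ℝ) < N)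
  have b : N < 2 := by exact_mod_cast (h ▸ h2 : (N:ℝ) < 2)
  omega

lemma edge_inter {f g : Dt} {s s' : ℝ} (h0 : 0 ≤ s) (h1 : s < 1) (h0' : 0 ≤ s') (h1' : s' < 1)
    (h : toC f.st + s * (toC f.en - toC f.st) = toC g.st + s' * (toC g.en - toC g.st)) :
    f.st = g.st ∨ f = g.rev := by
  have hx := congrArg Complex.re h
  have hy := congrArg Complex.im h
  clear h
  obtain ⟨x, y, d⟩ := f
  obtain ⟨x', y', d'⟩ := g
  simp only [toC, Dt.st, Dt.en, Complex.add_re, Complex.add_im, Complex.re_ofReal_mul, Complex.im_ofReal_mul,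
    Complex.sub_re, Complex.sub_im, Int.cast_add] at hx hy
  simp only [Dt.st, Dt.rev, Dt.mk.injEq, Prod.mk.injEq]
  revert d d'
  apply forall4 <;> apply forall4 <;> intro hx hy <;>
  simp only [f01, f11, f21, f31, f02, f12, f22, f32, ox0, ox1, ox2, ox3, oy0, oy1, oy2, oy3, dx0, dx1, dx2, dx3, dy0, dy1, dy2, dy3, Int.cast_one, Int.cast_zero] at hx hy ⊢ <;>
  (
  have hX : ((x - x' : ℤ):ℝ) = x - x' := by push_cast; ring
  have hY : ((y - y' : ℤ):ℝ) = y - y' := by push_cast; ring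
  have bx1 : x ≤ x' + 2 := by
    have : (x:ℝ) < x' + 3 := by linarith
    have : x < x' + 3 := by exact_mod_cast this
    omega
  have bx2 : x' ≤ x + 2 := by
    have : (x':ℝ) < x + 3 := by linarith
    have : x' < x + 3 := by exact_mod_cast this
    omega
  have by1 : y ≤ y' + 2 := by
    have : (y:ℝ) < y' + 3 := by linarith
    have : y < y' + 3 := by exact_mod_cast this
    omega
  have by2 : y' ≤ y + 2 := by
    have : (y':ℝ) < y + 3 := by linarith
    have : y' < y + 3 := by exact_mod_cast this
    omega
  obtain ⟨a, rfl⟩ : ∃ a, x = x' + a := ⟨x - x', by ring⟩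
  obtain ⟨b, rfl⟩ : ∃ b, y = y' + b := ⟨y - y', by ring⟩
  push_cast at hx hy
  have ha : a = -2 ∨ a = -1 ∨ a = 0 ∨ a = 1 ∨ a = 2 := by omega
  have hb : b = -2 ∨ b = -1 ∨ b = 0 ∨ b = 1 ∨ b = 2 := by omega
  clear hX hY bx1 bx2 by1 by2
  rcases ha with rfl | rfl | rfl | rfl | rfl <;> rcases hb with rfl | rfl | rfl | rfl | rfl <;>
   first | (left; constructor <;> omega) | (right; refine ⟨?_, ?_, rfl⟩ <;> omega) | (right; refine ⟨?_, ?_, trivial⟩ <;> omega) | (right; constructor <;> omega) | (exfalso; push_cast at hx hy; linarith))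

end JL

open Set
set_option linter.all false
namespace JL

lemma slit {a b z : ℂ} (hz : z ∉ segment ℝ a b) {s : ℝ} (h0 : 0 ≤ s) (h1 : s ≤ 1) :
    1 + s * ((b - z)/(a - z) - 1) ∈ Complex.slitPlane := by
  rw [Complex.mem_slitPlane_iff_not_le_zero]
  intro h
  have ha : a - z ≠ 0 := by
    intro h; apply hz; rw [sub_eq_zero] at h; rw [← h]; exact left_mem_segment _ _ _
  have hre : ((1 + s * ((b - z)/(a - z) - 1)).re : ℂ) = 1 + s * ((b - z)/(a - z) - 1) := by
    rw [Complex.le_def] at h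
    have h2 := h.2
    apply Complex.ext
    · simp
    · rw [h2]; simp
  have hle := (Complex.le_def.1 h).1
  set q := (1 + s * ((b - z)/(a - z) - 1)).re with hq
  simp only [Complex.zero_re] at hle
  have e : a + s * (b - a) - z = q * (a - z) := by
    rw [hre]; field_simp; ring
  have hq1 : (1 - q) ≠ 0 := by linarith
  have hqc : (1 - q : ℂ) ≠ 0 := by exact_mod_cast hq1
  have e2 : z = a + ((s/(1-q) : ℝ) : ℂ) * (b - a) := by
    push_cast
    field_simp
    linear_combination -e
  apply hz
  rw [e2]
  apply seg_mem
  · apply div_nonneg h0; linarith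
  · rw [div_le_one (by linarith)]; linarith

lemma lift_const {g : ℝ → ℂ} (hg : ContinuousOn g (Icc 0 1)) {c : ℂ} (h : ∀ s ∈ Icc (0:ℝ) 1, Complex.exp (g s) = c) :
    g 1 = g 0 := by
  have hint : ∀ s ∈ Icc (0:ℝ) 1, ∃ n : ℤ, g s = g 0 + n * (2 * Real.pi * Complex.I) := by
    intro s hs
    rw [← Complex.exp_eq_exp_iff_exists_int, h s hs, h 0 (by simp)]
  set k : ℝ → ℝ := fun s => (g s - g 0).im / (2 * Real.pi) with hk
  have kc : ContinuousOn k (Icc 0 1) := by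
    apply ContinuousOn.div_const
    exact Complex.continuous_im.comp_continuousOn (hg.sub continuousOn_const)
  have kint : ∀ s ∈ Icc (0:ℝ) 1, ∃ n : ℤ, g s = g 0 + n * (2 * Real.pi * Complex.I) ∧ k s = n := by
    intro s hs
    obtain ⟨n, hn⟩ := hint s hs
    refine ⟨n, hn, ?_⟩
    simp only [hk, hn]
    have := Real.pi_pos
    field_simp
    simp; ring
  obtain ⟨n, hn, hkn⟩ := kint 1 (by simp)
  have k0 : k 0 = 0 := by simp [hk]
  rcases eq_or_ne n 0 with h0 | h0
  · rw [hn, h0]; simp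
  exfalso
  have hp := isPreconnected_Icc.image _ kc
  have hoc := hp.ordConnected
  have m0 : k 0 ∈ k '' Icc 0 1 := mem_image_of_mem _ (by simp)
  have m1 : k 1 ∈ k '' Icc 0 1 := mem_image_of_mem _ (by simp)
  have no : ∀ m : ℤ, (m:ℝ) + 1/2 ∉ k '' Icc 0 1 := by
    rintro m ⟨s, hs, h⟩
    obtain ⟨j, _, hj⟩ := kint s hs
    rw [hj] at h
    have h2 : (2 * j : ℝ) = 2 * m + 1 := by linarith
    have : 2 * j = 2 * m + 1 := by exact_mod_cast h2
    omega
  rcases lt_or_gt_of_ne h0 with h | h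
  · apply no (-1)
    refine hoc.out m1 m0 ⟨?_, ?_⟩
    · rw [hkn]; have : (n:ℝ) ≤ -1 := by exact_mod_cast (by omega : n ≤ -1)
      push_cast; linarith
    · rw [k0]; norm_num
  · apply no 0
    refine hoc.out m0 m1 ⟨?_, ?_⟩
    · rw [k0]; norm_num
    · rw [hkn]; have : (1:ℝ) ≤ n := by exact_mod_cast (by omega : 1 ≤ n)
      push_cast; linarith

noncomputable def L (z a b : ℂ) : ℂ := Complex.log ((b - z)/(a - z))

lemma pl_wind {n : ℕ} (hn : 0 < n) {P : ℕ → ℂ} {z : ℂ} (hz : z ∉ pl n P '' Icc 0 1)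
    {l : ℝ → ℂ} (hl : ContinuousOn l (Icc 0 1)) (he : ∀ t ∈ Icc (0:ℝ) 1, pl n P t - z = Complex.exp (l t)) :
    l 1 - l 0 = ∑ i ∈ Finset.range n, L z (P i) (P (i+1)) := by
  have hn' : (0:ℝ) < n := by positivity
  have e : l 1 - l 0 = ∑ i ∈ Finset.range n, (l ((i+1:ℕ)/n) - l ((i:ℕ)/n)) := by
    rw [Finset.sum_range_sub (fun i => l ((i:ℕ)/n))]
    simp [hn'.ne']
  rw [e]
  refine Finset.sum_congr rfl fun i hi => ?_
  have hi := Finset.mem_range.1 hi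
  have hi' : (i:ℝ) + 1 ≤ n := by exact_mod_cast hi
  have hzs : z ∉ segment ℝ (P i) (P (i+1)) := by
    intro h; apply hz; rw [pl_image hn]; exact mem_iUnion.2 ⟨⟨i, hi⟩, h⟩
  have ha : P i - z ≠ 0 := by
    intro h; apply hzs; rw [sub_eq_zero] at h; rw [← h]; exact left_mem_segment _ _ _
  set r := (P (i+1) - z)/(P i - z) with hr
  have hmaps : MapsTo (fun s : ℝ => (i + s)/n) (Icc 0 1) (Icc (0:ℝ) 1) := by
    rintro s ⟨s0, s1⟩
    refine ⟨by positivity, ?_⟩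
    rw [div_le_one hn']; linarith
  have key := lift_const (g := fun s : ℝ => l ((i + s)/n) - Complex.log (1 + s * (r - 1))) (c := P i - z) ?_ ?_
  · simp only [Complex.ofReal_one, Complex.ofReal_zero, add_zero, zero_mul, Complex.log_one, sub_zero] at key
    rw [L, ← hr]
    rw [show (1:ℂ) + 1 * (r - 1) = r by ring] at key
    push_cast
    rw [← key]; ring
  · apply ContinuousOn.sub
    · exact hl.comp (by fun_prop) hmaps
    · apply ContinuousOn.clog
      · fun_prop
      · rintro s ⟨s0, s1⟩; exact slit hzs s0 s1
  · rintro s ⟨s0, s1⟩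
    have h1 := slit hzs s0 s1
    rw [Complex.exp_sub, ← he _ (hmaps ⟨s0, s1⟩), Complex.exp_log (Complex.slitPlane_ne_zero h1), pl_eq hi s0 s1]
    rw [div_eq_iff (Complex.slitPlane_ne_zero h1)]
    field_simp
    ring

/- cell sums -/
lemma log_div_pos {a b : ℂ} (ha : 0 < a.re) (hb : 0 < b.re) : Complex.log (a / b) = Complex.log a - Complex.log b := by
  have ha0 : a ≠ 0 := by rintro rfl; simp at ha
  have hb0 : b ≠ 0 := by rintro rfl; simp at hb
  have h1 := abs_lt.1 (Complex.abs_arg_lt_pi_div_two_iff.2 (.inl ha))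
  have h2 := abs_lt.1 (Complex.abs_arg_lt_pi_div_two_iff.2 (.inl hb))
  rw [← Complex.log_exp (x := Complex.log a - Complex.log b), Complex.exp_sub, Complex.exp_log ha0, Complex.exp_log hb0]
  · simp only [Complex.sub_im, Complex.log_im]; linarith
  · simp only [Complex.sub_im, Complex.log_im]; linarith

lemma sum4_out {c : Fin 4 → ℂ} (u : ℂ) (hu : u ≠ 0) (h : ∀ d, 0 < (u * c d).re) :
    ∑ d, Complex.log (c (d+1) / c d) = 0 := by
  have : ∀ d, Complex.log (c (d+1) / c d) = Complex.log (u * c (d+1)) - Complex.log (u * c d) := by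
    intro d
    rw [← log_div_pos (h _) (h _), mul_div_mul_left _ _ hu]
  simp only [this, Finset.sum_sub_distrib]
  rw [sub_eq_zero]
  exact Equiv.sum_comp (Equiv.addRight (1 : Fin 4)) (fun d => Complex.log (u * c d))

lemma sum4_in {c : Fin 4 → ℂ} (h : ∀ d, 0 < (c (d+1) / c d).im) :
    ∑ d, Complex.log (c (d+1) / c d) = 2 * Real.pi * Complex.I := by
  have h0 : ∀ d, c d ≠ 0 := by
    intro d hd; have := h d; rw [hd] at this; simp at this
  have hexp : Complex.exp (∑ d, Complex.log (c (d+1) / c d)) = 1 := by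
    rw [Complex.exp_sum]
    rw [Finset.prod_congr rfl (fun d _ => Complex.exp_log (div_ne_zero (h0 (d+1)) (h0 d)))]
    rw [Finset.prod_div_distrib, div_eq_one_iff_eq (Finset.prod_ne_zero_iff.2 fun d _ => h0 d)]
    exact Equiv.prod_comp (Equiv.addRight (1 : Fin 4)) (fun d => c d)
  rw [Complex.exp_eq_one_iff] at hexp
  obtain ⟨n, hn⟩ := hexp
  have him : (∑ d, Complex.log (c (d+1) / c d)).im = n * (2 * Real.pi) := by rw [hn]; simp
  have hb : ∀ d, 0 < (Complex.log (c (d+1) / c d)).im ∧ (Complex.log (c (d+1) / c d)).im < Real.pi := by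
    intro d
    rw [Complex.log_im]
    refine ⟨?_, ?_⟩
    · refine lt_of_le_of_ne (Complex.arg_nonneg_iff.2 (h d).le) ?_
      intro h'
      have := (Complex.arg_eq_zero_iff.1 h'.symm).2
      linarith [h d]
    · exact Complex.arg_lt_pi_iff.2 (.inr (h d).ne')
  rw [Complex.im_sum, Fin.sum_univ_four] at him
  have b0 := hb 0; have b1 := hb 1; have b2 := hb 2; have b3 := hb 3
  have hpi := Real.pi_pos
  have n1 : 0 < n := by
    have : (0:ℝ) < n := by
      by_contra hh; push Not at hh
      nlinarith
    exact_mod_cast this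
  have n2 : n < 2 := by
    have : (n:ℝ) < 2 := by
      by_contra hh; push Not at hh
      nlinarith
    exact_mod_cast this
  have : n = 1 := by omega
  rw [hn, this]; simp

end JL

open Set
set_option linter.all false
namespace JL

def ocell (c : ℤ × ℤ) : Set ℂ := Ioo (c.1:ℝ) (c.1+1) ×ℂ Ioo (c.2:ℝ) (c.2+1)
def ccell (c : ℤ × ℤ) : Set ℂ := Icc (c.1:ℝ) (c.1+1) ×ℂ Icc (c.2:ℝ) (c.2+1)

lemma ccell_closure (c : ℤ × ℤ) : ccell c = closure (ocell c) := by
  rw [ocell, Complex.closure_reProdIm, closure_Ioo (by linarith), closure_Ioo (by linarith), ccell]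

noncomputable def LD (z : ℂ) (f : Dt) : ℂ := L z (toC f.st) (toC f.en)

lemma cr (x y : ℤ) (d : Fin 4) : Dt.en ⟨x, y, d⟩ = Dt.st ⟨x, y, d+1⟩ := rfl

lemma im_div_pos {a b : ℂ} (h : 0 < a.im * b.re - a.re * b.im) : 0 < (a / b).im := by
  have hb : b ≠ 0 := by rintro rfl; simp at h
  rw [Complex.div_im, ← sub_div]
  exact div_pos h (Complex.normSq_pos.2 hb)

lemma cell_sum (c c' : ℤ × ℤ) {z : ℂ} (hz : z ∈ ocell c) :
    ∑ d, LD z ⟨c'.1, c'.2, d⟩ = if c' = c then 2 * Real.pi * Complex.I else 0 := by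
  obtain ⟨x, y⟩ := c
  obtain ⟨x', y'⟩ := c'
  simp only [ocell, Complex.mem_reProdIm, mem_Ioo] at hz
  obtain ⟨⟨h1, h2⟩, h3, h4⟩ := hz
  simp only [LD, L, cr]
  set C : Fin 4 → ℂ := fun d => toC (Dt.st ⟨x', y', d⟩) - z with hC
  have re : ∀ d, (C d).re = x' + ox d - z.re := by intro d; simp [hC, toC, Dt.st]
  have im : ∀ d, (C d).im = y' + oy d - z.im := by intro d; simp [hC, toC, Dt.st]
  have ob : ∀ d, (0:ℝ) ≤ ox d ∧ (ox d : ℝ) ≤ 1 ∧ (0:ℝ) ≤ oy d ∧ (oy d : ℝ) ≤ 1 := by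
    apply forall4 <;> norm_num
  change ∑ d, Complex.log (C (d+1) / C d) = _
  split_ifs with h
  · simp only [Prod.mk.injEq] at h
    obtain ⟨rfl, rfl⟩ := h
    apply sum4_in
    intro d
    apply im_div_pos
    rw [re, re, im, im]
    revert d
    apply forall4 <;> simp [f01, f11, f21, f31] <;> nlinarith
  · have : x' < x ∨ x < x' ∨ y' < y ∨ y < y' := by
      simp only [Prod.mk.injEq] at h; omega
    rcases this with h | h | h | h
    · have : (x':ℝ) + 1 ≤ x := by exact_mod_cast h
      apply sum4_out (-1) (by simp)
      intro d
      have := ob d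
      simp [re]; linarith
    · have : (x:ℝ) + 1 ≤ x' := by exact_mod_cast h
      apply sum4_out 1 (by simp)
      intro d
      have := ob d
      simp [re]; linarith
    · have : (y':ℝ) + 1 ≤ y := by exact_mod_cast h
      apply sum4_out Complex.I (by simp)
      intro d
      have := ob d
      simp [im]; linarith
    · have : (y:ℝ) + 1 ≤ y' := by exact_mod_cast h
      apply sum4_out (-Complex.I) (by simp)
      intro d
      have := ob d
      simp [im]; linarith

/-- horizontal or vertical -/
lemma edge_hv (f : Dt) : (toC f.st).re = (toC f.en).re ∨ (toC f.st).im = (toC f.en).im := by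
  obtain ⟨x, y, d⟩ := f
  revert d; apply forall4 <;> simp [toC, Dt.st, Dt.en, f01, f11, f21, f31]

lemma ccell_convex (c : ℤ × ℤ) : Convex ℝ (ccell c) :=
  ((convex_Icc _ _).linear_preimage Complex.reLm).inter ((convex_Icc _ _).linear_preimage Complex.imLm)

lemma edge_cell (f : Dt) : segment ℝ (toC f.st) (toC f.en) ⊆ ccell (f.x, f.y) := by
  apply (ccell_convex _).segment_subset
  · obtain ⟨x, y, d⟩ := f
    revert d; apply forall4 <;> simp [toC, ccell, Complex.mem_reProdIm, Dt.st]
  · obtain ⟨x, y, d⟩ := f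
    revert d; apply forall4 <;> simp [toC, ccell, Complex.mem_reProdIm, Dt.en, f01, f11, f21, f31]

lemma not_edge {c : ℤ × ℤ} {z : ℂ} (hz : z ∈ ocell c) (f : Dt) : z ∉ segment ℝ (toC f.st) (toC f.en) := by
  intro h
  rw [segment_eq_image'] at h
  obtain ⟨s, _, rfl⟩ := h
  obtain ⟨cx, cy⟩ := c
  simp only [ocell, Complex.mem_reProdIm, mem_Ioo] at hz
  obtain ⟨⟨h1, h2⟩, h3, h4⟩ := hz
  have no : ∀ a b : ℤ, (a:ℝ) < b → (b:ℝ) < a + 1 → False := by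
    intro a b h h'
    have : a < b := by exact_mod_cast h
    have : b < a + 1 := by exact_mod_cast h'
    omega
  rcases edge_hv f with h | h
  · simp only [Complex.add_re, Complex.real_smul, Complex.re_ofReal_mul, Complex.sub_re, h, sub_self, mul_zero, add_zero] at h1 h2
    exact no _ _ h1 h2
  · simp only [Complex.add_im, Complex.real_smul, Complex.im_ofReal_mul, Complex.sub_im, h, sub_self, mul_zero, add_zero] at h3 h4
    exact no _ _ h3 h4

lemma slit' {a b z : ℂ} (hz : z ∉ segment ℝ a b) : (b - z)/(a - z) ∈ Complex.slitPlane := by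
  have := slit hz zero_le_one le_rfl
  simpa using this

lemma LD_rev {z : ℂ} {f : Dt} (hz : z ∉ segment ℝ (toC f.st) (toC f.en)) : LD z f + LD z f.rev = 0 := by
  simp only [LD, L, st_rev, en_rev]
  rw [← inv_div, Complex.log_inv]
  · ring
  · have := Complex.mem_slitPlane_iff_arg.1 (slit' hz)
    rw [← inv_div, Complex.arg_inv, if_neg this.1]
    intro h
    have := Complex.neg_pi_lt_arg ((toC f.en - z) / (toC f.st - z))
    linarith

open Classical in
lemma BD_sum {K : Col} (hK : Fin' K) (c : ℤ × ℤ) {z : ℂ} (hz : z ∈ ocell c) :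
    ∑ f ∈ (BD_finite hK).toFinset, LD z f = if K c.1 c.2 = true then 2 * Real.pi * Complex.I else 0 := by
  have hK2 : {c : ℤ × ℤ | K c.1 c.2 = true}.Finite := hK
  have h1 : ∑ c' ∈ hK2.toFinset, ∑ d, LD z ⟨c'.1, c'.2, d⟩ = if K c.1 c.2 = true then 2 * Real.pi * Complex.I else 0 := by
    simp only [cell_sum c _ hz]
    rw [Finset.sum_ite_eq']
    simp
  rw [← h1, ← Finset.sum_product']
  set emb : (ℤ × ℤ) × Fin 4 → Dt := fun p => ⟨p.1.1, p.1.2, p.2⟩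
  set T := (hK2.toFinset ×ˢ (Finset.univ : Finset (Fin 4))).image emb with hT
  have h2 : ∑ p ∈ hK2.toFinset ×ˢ (Finset.univ : Finset (Fin 4)), LD z ⟨p.1.1, p.1.2, p.2⟩ = ∑ f ∈ T, LD z f := by
    rw [hT, Finset.sum_image]
    rintro ⟨⟨a, b⟩, d⟩ _ ⟨⟨a', b'⟩, d'⟩ _ h
    simp only [emb, Dt.mk.injEq] at h
    simp [h]
  rw [h2]
  have mT : ∀ f, f ∈ T ↔ K f.x f.y = true := by
    intro f
    simp only [hT, Finset.mem_image, Finset.mem_product, Set.Finite.mem_toFinset, Set.mem_setOf_eq, Finset.mem_univ, and_true, emb]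
    constructor
    · rintro ⟨p, hp, rfl⟩; exact hp
    · intro h; exact ⟨((f.x, f.y), f.d), h, rfl⟩
  have hsub : (BD_finite hK).toFinset ⊆ T := by
    intro f hf
    rw [mT]; exact ((BD_finite hK).mem_toFinset.1 hf).1
  rw [← Finset.sum_sdiff hsub]
  have : ∑ f ∈ T \ (BD_finite hK).toFinset, LD z f = 0 := by
    have mm : ∀ f, f ∈ T \ (BD_finite hK).toFinset ↔ K f.x f.y = true ∧ K f.rev.x f.rev.y = true := by
      intro f
      rw [Finset.mem_sdiff, mT, Set.Finite.mem_toFinset]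
      simp only [BD, Set.mem_setOf_eq, Dt.rev]
      constructor
      · rintro ⟨a, b⟩; refine ⟨a, ?_⟩
        by_contra hh; exact b ⟨a, by simpa using hh⟩
      · rintro ⟨a, b⟩; refine ⟨a, ?_⟩
        rintro ⟨_, h⟩; rw [h] at b; exact absurd b (by simp)
    refine Finset.sum_involution (fun f _ => f.rev) ?_ ?_ ?_ ?_
    · intro f _; exact LD_rev (not_edge hz f)
    · intro f _ _ h
      have := congrArg Dt.d h
      obtain ⟨x, y, d⟩ := f
      simp only [Dt.rev] at this
      revert d; apply forall4 <;> simp [f02, f12, f22, f32]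
    · intro f hf; rw [mm] at hf ⊢; rw [rev_rev]; exact ⟨hf.2, hf.1⟩
    · intro f _; exact rev_rev f
  rw [this, zero_add]

open Classical in
lemma BD_sum' {K : Col} (hK : Fin' K) (c : ℤ × ℤ) {z : ℂ} (hz : z ∈ ccell c)
    (hn : ∀ f ∈ BD K, z ∉ segment ℝ (toC f.st) (toC f.en)) :
    ∑ f ∈ (BD_finite hK).toFinset, LD z f = if K c.1 c.2 = true then 2 * Real.pi * Complex.I else 0 := by
  have hcont : ContinuousAt (fun w => ∑ f ∈ (BD_finite hK).toFinset, LD w f) z := by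
    refine tendsto_finset_sum _ fun f hf => ?_
    have hf' := hn f ((BD_finite hK).mem_toFinset.1 hf)
    have h1 := slit' hf'
    have h2 : toC f.st - z ≠ 0 := by
      intro h; rw [h] at h1; simp at h1
    change ContinuousAt (fun w => LD w f) z
    unfold LD L
    have h3 : ContinuousAt (fun w => (toC f.en - w) / (toC f.st - w)) z :=
      ContinuousAt.div (by fun_prop) (by fun_prop) h2
    exact h3.clog h1
  rw [ccell_closure] at hz
  haveI := mem_closure_iff_nhdsWithin_neBot.1 hz
  have t1 : Filter.Tendsto (fun w => ∑ f ∈ (BD_finite hK).toFinset, LD w f) (nhdsWithin z (ocell c)) (nhds _) :=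
    hcont.tendsto.mono_left nhdsWithin_le_nhds
  refine tendsto_nhds_unique t1 ?_
  refine tendsto_const_nhds.congr' ?_
  filter_upwards [self_mem_nhdsWithin] with w hw
  exact (BD_sum hK c hw).symm

end JL

open Set
set_option linter.all false
namespace JL

lemma BD_nonempty {K : Col} (hK : Fin' K) {c : ℤ × ℤ} (hc : K c.1 c.2 = true) : (BD K).Nonempty := by
  have hK2 : {c : ℤ × ℤ | K c.1 c.2 = true}.Finite := hK
  obtain ⟨m, hm, hmax⟩ := Set.exists_max_image _ (fun c : ℤ × ℤ => c.1) hK2 ⟨c, hc⟩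
  refine ⟨⟨m.1, m.2, 0⟩, hm, ?_⟩
  by_contra h
  have := hmax (m.1 + 1, m.2) (by simpa using h)
  simp at this

open Classical in
theorem loop {K : Col} (hK : Fin' K) (np : NP K) (hc : ∀ f g, bd K f → bd K g → Cn (bd K) f.st g.st)
    (hne : ∃ c : ℤ × ℤ, K c.1 c.2 = true) :
    ∃ γ : ℝ → ℂ, IsJordanLoop γ ∧ FinUnionHV (γ '' Icc 0 1) ∧
      (∀ z ∈ γ '' Icc 0 1, ∃ f ∈ BD K, z ∈ ccell (f.x, f.y)) ∧
      ∀ c : ℤ × ℤ, ∀ z ∈ ccell c, z ∉ γ '' Icc 0 1 → IsWindingNumber γ z (if K c.1 c.2 = true then 1 else 0) := by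
  obtain ⟨c0, hc0⟩ := hne
  obtain ⟨e, he⟩ := BD_nonempty hK hc0
  have hpos := nx_per hK he
  set n := Function.minimalPeriod (nx K) e with hn
  set F : ℕ → Dt := fun i => (nx K)^[i] e with hF
  have hFB : ∀ i, F i ∈ BD K := fun i => nx_iter_BD he i
  have hen : ∀ i, (F i).en = (F (i+1)).st := by
    intro i; simp only [hF, Function.iterate_succ_apply']; rw [nx_st]
  have hFinj : ∀ i < n, ∀ j < n, F i = F j → i = j := by
    intro i hi j hj h
    exact Function.iterate_injOn_Iio_minimalPeriod hi hj h
  have hFall : ∀ g ∈ BD K, ∃ i < n, F i = g := fun g hg => orbit_all hK np hc he hg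
  have hFn : F n = F 0 := Function.iterate_minimalPeriod
  set P : ℕ → ℂ := fun i => toC (F i).st with hP
  have hPe : ∀ i, P (i+1) = toC (F i).en := by intro i; simp only [hP]; rw [hen]
  refine ⟨pl n P, ⟨(pl_cont n P).continuousOn, ?_, ?_⟩, ?_, ?_, ?_⟩
  · rw [pl_zero hpos, pl_one hpos]; simp only [hP]; rw [hFn]
  · rintro t ⟨t0, t1⟩ t' ⟨t0', t1'⟩ h
    obtain ⟨k, hk, s, s0, s1, rfl⟩ := pl_param hpos t0 t1
    obtain ⟨k', hk', s', s0', s1', rfl⟩ := pl_param hpos t0' t1'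
    rw [pl_eq hk s0 s1.le, pl_eq hk' s0' s1'.le, hPe, hPe] at h
    have hor := edge_inter s0 s1 s0' s1' h
    have hFF : F k = F k' := by
      rcases hor with h | h
      · exact st_inj np (hFB _) (hFB _) h
      · exact absurd (h ▸ hFB k) (rev_not_BD (hFB k'))
    have hkk := hFinj k hk k' hk' hFF
    subst hkk
    have h2 : (s:ℂ) * (toC (F k).en - toC (F k).st) = s' * (toC (F k).en - toC (F k).st) := by
      exact add_left_cancel h
    have hne : toC (F k).en - toC (F k).st ≠ 0 := by
      generalize F k = f
      obtain ⟨x, y, d⟩ := f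
      intro h
      have hr := congrArg Complex.re h
      have hi := congrArg Complex.im h
      clear * - hr hi
      revert d; apply forall4 <;> simp [toC, Dt.st, Dt.en, f01, f11, f21, f31]
    have h3 := mul_right_cancel₀ hne h2
    have : s = s' := by exact_mod_cast h3
    rw [this]
  · refine ⟨n, fun i => P i, fun i => P (i+1), ?_, pl_image hpos P⟩
    intro i
    simp only [hPe]
    exact edge_hv _
  · intro z hz
    rw [pl_image hpos, mem_iUnion] at hz
    obtain ⟨i, hi⟩ := hz
    rw [hPe] at hi
    exact ⟨F i, hFB i, edge_cell _ hi⟩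
  · intro c z hz hzn l hl hle
    rw [pl_wind hpos hzn hl hle]
    have e1 : ∑ i ∈ Finset.range n, L z (P i) (P (i+1)) = ∑ f ∈ (BD_finite hK).toFinset, LD z f := by
      refine Finset.sum_bij (fun i _ => F i) ?_ ?_ ?_ ?_
      · intro i _; simpa using hFB i
      · intro i hi j hj h; exact hFinj i (Finset.mem_range.1 hi) j (Finset.mem_range.1 hj) h
      · intro g hg
        obtain ⟨i, hi, h⟩ := hFall g (by simpa using hg)
        exact ⟨i, Finset.mem_range.2 hi, h⟩
      · intro i _; rw [hPe]; rfl
    rw [e1, BD_sum' hK c hz]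
    · split_ifs <;> simp
    · intro f hf h
      obtain ⟨i, hi, rfl⟩ := hFall f hf
      apply hzn
      rw [pl_image hpos, mem_iUnion]
      refine ⟨⟨i, hi⟩, ?_⟩
      rw [hPe]; exact h

/-- Scaled version. -/
lemma wind_scale {γ : ℝ → ℂ} {z : ℂ} {n : ℤ} {h : ℝ} (hh : 0 < h) (H : IsWindingNumber γ (z / h) n) :
    IsWindingNumber (fun t => h * γ t) z n := by
  intro l hl hle
  have hc : (h:ℂ) ≠ 0 := by exact_mod_cast hh.ne'
  have := H (fun t => l t - Complex.log h) (hl.sub continuousOn_const) ?_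
  · rw [← this]; ring
  · intro t ht
    rw [Complex.exp_sub, ← hle t ht, Complex.exp_log hc]
    field_simp

lemma hv_scale {S : Set ℂ} (h : ℝ) (H : FinUnionHV S) : FinUnionHV ((fun z => (h:ℂ) * z) '' S) := by
  obtain ⟨n, p, q, h1, rfl⟩ := H
  refine ⟨n, fun i => h * p i, fun i => h * q i, ?_, ?_⟩
  · intro i
    rcases h1 i with h | h
    · left; simp [h]
    · right; simp [h]
  · rw [image_iUnion]
    congr 1; ext1 i
    have := image_segment ℝ ((LinearMap.lsmul ℝ ℂ h).toAffineMap) (p i) (q i)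
    have e : (⇑((LinearMap.lsmul ℝ ℂ h).toAffineMap)) = fun z : ℂ => (h:ℂ)*z := by ext z <;> simp
    rw [e] at this
    exact this

open Classical in
theorem loop_scaled {K : Col} (hK : Fin' K) (np : NP K) (hc : ∀ f g, bd K f → bd K g → Cn (bd K) f.st g.st)
    (hne : ∃ c : ℤ × ℤ, K c.1 c.2 = true) {h : ℝ} (hh : 0 < h) :
    ∃ γ : ℝ → ℂ, IsJordanLoop γ ∧ FinUnionHV (γ '' Icc 0 1) ∧
      (∀ z ∈ γ '' Icc 0 1, ∃ f ∈ BD K, z / h ∈ ccell (f.x, f.y)) ∧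
      ∀ c : ℤ × ℤ, ∀ z : ℂ, z / h ∈ ccell c → z ∉ γ '' Icc 0 1 → IsWindingNumber γ z (if K c.1 c.2 = true then 1 else 0) := by
  obtain ⟨γ, ⟨a1, a2, a3⟩, a4, a5, a6⟩ := loop hK np hc hne
  have hc : (h:ℂ) ≠ 0 := by exact_mod_cast hh.ne'
  have him : (fun t => (h:ℂ) * γ t) '' Icc 0 1 = (fun z => (h:ℂ) * z) '' (γ '' Icc 0 1) := by
    rw [image_image]
  refine ⟨fun t => h * γ t, ⟨continuousOn_const.mul a1, by simp [a2], ?_⟩, ?_, ?_, ?_⟩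
  · intro t ht t' ht' he
    exact a3 ht ht' (mul_left_cancel₀ hc he)
  · rw [him]; exact hv_scale h a4
  · rw [him]
    rintro _ ⟨z, hz, rfl⟩
    obtain ⟨f, hf, h'⟩ := a5 z hz
    refine ⟨f, hf, ?_⟩
    simpa [mul_div_cancel_left₀ _ hc] using h'
  · intro c z hz hzn
    refine wind_scale hh (a6 c _ hz ?_)
    intro h'
    apply hzn
    rw [him]
    refine ⟨z / h, h', ?_⟩
    simp only; field_simp

end JL

open Set
set_option linter.all false
namespace JL

lemma mem_ccell {c : ℤ × ℤ} {z : ℂ} : z ∈ ccell c ↔ ((c.1:ℝ) ≤ z.re ∧ z.re ≤ c.1 + 1) ∧ ((c.2:ℝ) ≤ z.im ∧ z.im ≤ c.2 + 1) := by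
  simp [ccell, Complex.mem_reProdIm, mem_Icc]

lemma int_div_le {x m : ℤ} (hm : 0 < m) {r : ℝ} (h1 : (x:ℝ) ≤ r * m) (h2 : r * m ≤ x + 1) :
    ((x / m : ℤ) : ℝ) ≤ r ∧ r ≤ ((x / m : ℤ) : ℝ) + 1 := by
  have hm' : (0:ℝ) < m := by exact_mod_cast hm
  have a1 : x / m * m ≤ x := Int.ediv_mul_le x hm.ne'
  have a2 : x + 1 ≤ (x / m + 1) * m := by
    have := Int.lt_ediv_add_one_mul_self x hm
    omega
  have b1 : ((x / m : ℤ) : ℝ) * m ≤ x := by exact_mod_cast a1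
  have b2 : (x:ℝ) + 1 ≤ (((x / m : ℤ) : ℝ) + 1) * m := by exact_mod_cast a2
  constructor
  · exact le_of_mul_le_mul_right (b1.trans h1) hm'
  · exact le_of_mul_le_mul_right (h2.trans b2) hm'

lemma ccell_div {c : ℤ × ℤ} {m : ℤ} (hm : 0 < m) {z : ℂ} (h : z * (m:ℝ) ∈ ccell c) : z ∈ ccell (c.1/m, c.2/m) := by
  rw [mem_ccell] at h ⊢
  simp only [Complex.re_mul_ofReal, Complex.im_mul_ofReal] at h
  exact ⟨int_div_le hm h.1.1 h.1.2, int_div_le hm h.2.1 h.2.2⟩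

lemma ccell_floor (z : ℂ) : z ∈ ccell (⌊z.re⌋, ⌊z.im⌋) := by
  rw [mem_ccell]
  exact ⟨⟨Int.floor_le _, (Int.lt_floor_add_one _).le⟩, ⟨Int.floor_le _, (Int.lt_floor_add_one _).le⟩⟩

lemma ccell_isClosed (c : ℤ × ℤ) : IsClosed (ccell c) := by rw [ccell_closure]; exact isClosed_closure

lemma ccell_dist {c c' : ℤ × ℤ} {z w : ℂ} {k : ℤ} (hz : z ∈ ccell c) (hw : w ∈ ccell c') (h1 : |c.1 - c'.1| ≤ k)
    (h2 : |c.2 - c'.2| ≤ k) : dist z w ≤ 2 * (k + 1) := by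
  rw [mem_ccell] at hz hw
  have e1 : |(c.1:ℝ) - c'.1| ≤ k := by exact_mod_cast h1
  have e2 : |(c.2:ℝ) - c'.2| ≤ k := by exact_mod_cast h2
  rw [dist_eq_norm]
  refine (Complex.norm_le_abs_re_add_abs_im _).trans ?_
  rw [abs_le] at e1 e2
  have : |(z - w).re| ≤ k + 1 := by
    rw [abs_le, Complex.sub_re]; constructor <;> linarith [e1.1, e1.2, hz.1.1, hz.1.2, hw.1.1, hw.1.2]
  have : |(z - w).im| ≤ k + 1 := by
    rw [abs_le, Complex.sub_im]; constructor <;> linarith [e2.1, e2.2, hz.2.1, hz.2.2, hw.2.1, hw.2.2]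
  linarith

lemma ccell_isCompact (c : ℤ × ℤ) : IsCompact (ccell c) := by
  refine Metric.isCompact_of_isClosed_isBounded (ccell_isClosed c) ?_
  rw [Metric.isBounded_iff]
  exact ⟨2 * ((0:ℤ) + 1), fun z hz w hw => ccell_dist hz hw (by simp) (by simp)⟩

lemma cells_finite {S : Set ℂ} (hS : Bornology.IsBounded S) : {c : ℤ × ℤ | (ccell c ∩ S).Nonempty}.Finite := by
  obtain ⟨R, hR⟩ := hS.exists_norm_le
  refine Set.Finite.subset ((Set.finite_Icc (⌊-R-1⌋) ⌈R⌉).prod (Set.finite_Icc (⌊-R-1⌋) ⌈R⌉)) ?_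
  rintro ⟨x, y⟩ ⟨z, hz, hzS⟩
  have hn := hR z hzS
  have h1 := (abs_le.1 ((Complex.abs_re_le_norm z).trans hn))
  have h2 := (abs_le.1 ((Complex.abs_im_le_norm z).trans hn))
  rw [mem_ccell] at hz
  simp only [mem_prod, mem_Icc] at hz ⊢
  refine ⟨⟨?_, ?_⟩, ⟨?_, ?_⟩⟩
  · have := Int.floor_le (-R-1); have h : ((⌊-R-1⌋:ℤ):ℝ) ≤ x := by linarith
    exact_mod_cast h
  · have := Int.le_ceil R; have h : (x:ℝ) ≤ (⌈R⌉:ℤ) := by linarith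
    exact_mod_cast h
  · have := Int.floor_le (-R-1); have h : ((⌊-R-1⌋:ℤ):ℝ) ≤ y := by linarith
    exact_mod_cast h
  · have := Int.le_ceil R; have h : (y:ℝ) ≤ (⌈R⌉:ℤ) := by linarith
    exact_mod_cast h

lemma ccell_lf : LocallyFinite ccell := by
  intro z
  exact ⟨Metric.ball z 1, Metric.ball_mem_nhds _ one_pos, cells_finite Metric.isBounded_ball⟩

lemma cells_closed (S : Set (ℤ × ℤ)) : IsClosed (⋃ c : S, ccell c) :=
  (ccell_lf.comp_injective Subtype.val_injective).isClosed_iUnion fun c => ccell_isClosed _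

lemma step_v {W : Set (ℤ × ℤ)} {a b : ℤ × ℤ} (ha : a ∈ W) (hb : b ∈ W) (h1 : a.1 = b.1) (h2 : |a.2 - b.2| ≤ 1) :
    Relation.ReflTransGen (Wr W) a b := by
  obtain ⟨x, y⟩ := a; obtain ⟨x', y'⟩ := b
  simp only at h1 h2; subst h1
  rw [abs_le] at h2
  have : y' = y ∨ y' = y + 1 ∨ y' = y - 1 := by omega
  rcases this with rfl | rfl | rfl
  · exact .refl
  · exact .single ⟨ha, hb, 1, by simp⟩
  · exact .single ⟨ha, hb, 3, by simp [sub_eq_add_neg]⟩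

lemma step_h {W : Set (ℤ × ℤ)} {a b : ℤ × ℤ} (ha : a ∈ W) (hb : b ∈ W) (h1 : a.2 = b.2) (h2 : |a.1 - b.1| ≤ 1) :
    Relation.ReflTransGen (Wr W) a b := by
  obtain ⟨x, y⟩ := a; obtain ⟨x', y'⟩ := b
  simp only at h1 h2; subst h1
  rw [abs_le] at h2
  have : x' = x ∨ x' = x + 1 ∨ x' = x - 1 := by omega
  rcases this with rfl | rfl | rfl
  · exact .refl
  · exact .single ⟨ha, hb, 0, by simp⟩
  · exact .single ⟨ha, hb, 2, by simp [sub_eq_add_neg]⟩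

lemma int_close {x y : ℤ} {r : ℝ} (h1 : (x:ℝ) ≤ r ∧ r ≤ x + 1) (h2 : (y:ℝ) ≤ r ∧ r ≤ y + 1) : |x - y| ≤ 1 := by
  have a : (x:ℝ) ≤ y + 1 := by linarith [h1.1, h2.2]
  have b : (y:ℝ) ≤ x + 1 := by linarith [h2.1, h1.2]
  have a' : x ≤ y + 1 := by exact_mod_cast a
  have b' : y ≤ x + 1 := by exact_mod_cast b
  rw [abs_le]; constructor <;> omega

lemma WConn_of {J : Set ℂ} (hJ : IsPreconnected J) : WConn {c | (ccell c ∩ J).Nonempty} := by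
  set W : Set (ℤ × ℤ) := {c | (ccell c ∩ J).Nonempty} with hW
  intro a ha b hb
  by_contra hab
  let S : Set (ℤ × ℤ) := {c | c ∈ W ∧ Relation.ReflTransGen (Wr W) a c}
  let S' : Set (ℤ × ℤ) := {c | c ∈ W ∧ ¬ Relation.ReflTransGen (Wr W) a c}
  have key := isPreconnected_closed_iff.1 hJ _ _ (cells_closed S) (cells_closed S') ?_ ?_ ?_
  · obtain ⟨p, hp, h1, h2⟩ := key
    rw [mem_iUnion] at h1 h2
    obtain ⟨⟨c, hc, hc'⟩, h1⟩ := h1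
    obtain ⟨⟨e, he, he'⟩, h2⟩ := h2
    simp only at h1 h2
    apply he'
    have h1' := mem_ccell.1 h1
    have h2' := mem_ccell.1 h2
    have hm : (c.1, e.2) ∈ W := ⟨p, mem_ccell.2 ⟨h1'.1, h2'.2⟩, hp⟩
    exact (hc'.trans (step_v hc hm rfl (int_close h1'.2 h2'.2))).trans (step_h hm he rfl (int_close h1'.1 h2'.1))
  · intro p hp
    have hf : (⌊p.re⌋, ⌊p.im⌋) ∈ W := ⟨p, ccell_floor p, hp⟩
    by_cases h : Relation.ReflTransGen (Wr W) a (⌊p.re⌋, ⌊p.im⌋)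
    · left; exact mem_iUnion.2 ⟨⟨_, hf, h⟩, ccell_floor p⟩
    · right; exact mem_iUnion.2 ⟨⟨_, hf, h⟩, ccell_floor p⟩
  · obtain ⟨p, h1, h2⟩ := id ha
    exact ⟨p, h2, mem_iUnion.2 ⟨⟨_, ha, .refl⟩, h1⟩⟩
  · obtain ⟨p, h1, h2⟩ := id hb
    exact ⟨p, h2, mem_iUnion.2 ⟨⟨_, hb, hab⟩, h1⟩⟩

lemma exists_J {U : Set ℂ} (hU : IsOpen U) (hc : IsConnected U) {B : Set (ℤ × ℤ)} (hB : B.Finite)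
    (hBU : ∀ c ∈ B, ccell c ⊆ U) : ∃ J, IsCompact J ∧ IsPreconnected J ∧ J ⊆ U ∧ ∀ c ∈ B, ccell c ⊆ J := by
  have hp := (hU.isConnected_iff_isPathConnected).1 hc
  obtain ⟨p0, hp0⟩ := hc.nonempty
  have hcn : ∀ c : ℤ × ℤ, toC c ∈ ccell c := fun c => by rw [mem_ccell]; simp [toC]
  have hj : ∀ c ∈ B, ∃ T : Set ℂ, IsCompact T ∧ IsPreconnected T ∧ T ⊆ U ∧ p0 ∈ T ∧ ccell c ⊆ T := by
    intro c hcB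
    obtain ⟨g, hg⟩ := hp.joinedIn p0 hp0 (toC c) (hBU c hcB (hcn c))
    refine ⟨range g ∪ ccell c, (isCompact_range g.continuous).union (ccell_isCompact c), ?_, ?_, ?_, subset_union_right⟩
    · exact IsPreconnected.union (toC c) ⟨1, by simp⟩ (hcn c) (isPreconnected_range g.continuous) (ccell_convex c).isPreconnected
    · exact union_subset (range_subset_iff.2 hg) (hBU c hcB)
    · left; exact ⟨0, by simp⟩
  choose! T h1 h2 h3 h4 h5 using hj
  refine ⟨{p0} ∪ ⋃ c ∈ B, T c, isCompact_singleton.union (hB.isCompact_biUnion h1), ?_, ?_, ?_⟩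
  · have : {p0} ∪ ⋃ c ∈ B, T c = ⋃₀ ({{p0}} ∪ T '' B) := by
      rw [sUnion_union, sUnion_singleton, sUnion_image]
    rw [this]
    apply isPreconnected_sUnion p0
    · rintro s (rfl | ⟨c, hc, rfl⟩)
      · rfl
      · exact h4 c hc
    · rintro s (rfl | ⟨c, hc, rfl⟩)
      · exact isPreconnected_singleton
      · exact h2 c hc
  · exact union_subset (singleton_subset_iff.2 hp0) (iUnion₂_subset h3)
  · intro c hc
    exact (h5 c hc).trans ((subset_biUnion_of_mem hc).trans subset_union_right)

end JL

open Set
set_option linter.all false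
namespace JL

def near (X c : ℤ) : Prop := 3*(c/3) - 1 ≤ X ∧ X ≤ 3*(c/3) + 3

lemma near_mono (X : ℤ) : (∀ c, near X c → near (X+1) c) ∨ (∀ c, near (X+1) c → near X c) := by
  have : X % 3 = 0 ∨ X % 3 = 1 ∨ X % 3 = 2 := by omega
  unfold near
  rcases this with h | h | h
  · right; intro c; omega
  · left; intro c; omega
  · left; intro c; omega

lemma near_abs {X c : ℤ} (h : near X c) : |X - c| ≤ 4 := by
  unfold near at h; rw [abs_le]; omega

lemma near_nb {X c : ℤ} (h : |X - c| ≤ 1) : near X c := by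
  unfold near; rw [abs_le] at h; omega

open Classical in
noncomputable def DD (E : Set ℂ) : Col := fun X Y =>
  decide (∃ c : ℤ × ℤ, (ccell c ∩ E).Nonempty ∧ near X c.1 ∧ near Y c.2)

lemma DD_true {E : Set ℂ} {X Y : ℤ} : DD E X Y = true ↔ ∃ c : ℤ × ℤ, (ccell c ∩ E).Nonempty ∧ near X c.1 ∧ near Y c.2 := by
  simp [DD]

lemma NP_of_mono {K : Col} (h : ∀ x, (∀ y, K x y = true → K (x+1) y = true) ∨ (∀ y, K (x+1) y = true → K x y = true)) : NP K := by
  rintro x y ⟨h1, h2, h3⟩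
  rcases h x with h | h
  · have a := h y; have b := h (y+1)
    clear h
    revert h1 h2 h3 a b
    generalize K x y = p
    generalize K (x+1) y = q
    generalize K x (y+1) = r
    generalize K (x+1) (y+1) = s
    revert p q r s; decide
  · have a := h y; have b := h (y+1)
    clear h
    revert h1 h2 h3 a b
    generalize K x y = p
    generalize K (x+1) y = q
    generalize K x (y+1) = r
    generalize K (x+1) (y+1) = s
    revert p q r s; decide

lemma DD_mono (E : Set ℂ) : ∀ x, (∀ y, DD E x y = true → DD E (x+1) y = true) ∨ (∀ y, DD E (x+1) y = true → DD E x y = true) := by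
  intro x
  rcases near_mono x with h | h
  · left; intro y; rw [DD_true, DD_true]; rintro ⟨c, h1, h2, h3⟩; exact ⟨c, h1, h c.1 h2, h3⟩
  · right; intro y; rw [DD_true, DD_true]; rintro ⟨c, h1, h2, h3⟩; exact ⟨c, h1, h c.1 h2, h3⟩

lemma DD_fin {E : Set ℂ} (hE : Bornology.IsBounded E) : Fin' (DD E) := by
  have := (cells_finite hE)
  refine Set.Finite.subset (this.biUnion (t := fun c => Icc (c.1 - 4) (c.1+4) ×ˢ Icc (c.2-4) (c.2+4))
    (fun c _ => (Set.finite_Icc _ _).prod (Set.finite_Icc _ _))) ?_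
  rintro ⟨X, Y⟩ h
  obtain ⟨c, h1, h2, h3⟩ := DD_true.1 h
  have h2 := abs_le.1 (near_abs h2)
  have h3 := abs_le.1 (near_abs h3)
  refine mem_biUnion (show c ∈ _ from h1) ?_
  simp only [mem_prod, mem_Icc]
  omega

lemma DD_E {E : Set ℂ} {c : ℤ × ℤ} {z : ℂ} (hz : z ∈ ccell c) (hE : z ∈ E) {X Y : ℤ} (h1 : |X - c.1| ≤ 1) (h2 : |Y - c.2| ≤ 1) :
    DD E X Y = true := DD_true.2 ⟨c, ⟨z, hz, hE⟩, near_nb h1, near_nb h2⟩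

lemma DD_F {E F : Set ℂ} (hd : ∀ e ∈ E, ∀ f ∈ F, 100 ≤ dist e f) {c : ℤ × ℤ} {z : ℂ} (hz : z ∈ ccell c) (hF : z ∈ F)
    {X Y : ℤ} (h1 : |X - c.1| ≤ 1) (h2 : |Y - c.2| ≤ 1) : DD E X Y = false := by
  by_contra h
  rw [Bool.not_eq_false] at h
  obtain ⟨b, ⟨e, heb, he⟩, h3, h4⟩ := DD_true.1 h
  have h3 := abs_le.1 (near_abs h3)
  have h4 := abs_le.1 (near_abs h4)
  have h1 := abs_le.1 h1
  have h2 := abs_le.1 h2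
  have := ccell_dist (k := 5) heb hz (by rw [abs_le]; omega) (by rw [abs_le]; omega)
  have := hd e he z hF
  norm_num at *
  linarith

lemma dxa (d : Fin 4) (x : ℤ) : |x + dx d - x| ≤ 1 := by revert d; apply forall4 <;> simp
lemma dya (d : Fin 4) (x : ℤ) : |x + dy d - x| ≤ 1 := by revert d; apply forall4 <;> simp

lemma DD_bd {E F : Set ℂ} (hd : ∀ e ∈ E, ∀ f ∈ F, 100 ≤ dist e f) (f : Dt) (hf : bd (DD E) f) : ccell (f.x, f.y) ⊆ (E ∪ F)ᶜ := by
  rintro z hz (h | h)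
  · exact hf ((DD_E hz h (by simp) (by simp)).trans (DD_E hz h (dxa _ _) (dya _ _)).symm)
  · exact hf ((DD_F hd hz h (by simp) (by simp)).trans (DD_F hd hz h (dxa _ _) (dya _ _)).symm)

def Rf (m : ℤ) (K : Col) : Col := fun X Y => K (X/m) (Y/m)

lemma div_succ {m : ℤ} (hm : 0 < m) (x : ℤ) : (x+1)/m = x/m ∨ (x+1)/m = x/m+1 := by
  have h1 : x / m ≤ (x+1)/m := Int.ediv_le_ediv hm (by omega)
  have h2 : (x+1)/m ≤ x/m + 1 := by
    have : (x + m) / m = x/m + 1 := by rw [Int.add_ediv_of_dvd_right (dvd_refl m), Int.ediv_self hm.ne']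
    rw [← this]; exact Int.ediv_le_ediv hm (by omega)
  omega

lemma div_pred {m : ℤ} (hm : 0 < m) (x : ℤ) : (x+-1)/m = x/m ∨ (x+-1)/m = x/m+-1 := by
  have := div_succ hm (x+-1)
  rw [neg_add_cancel_right] at this
  omega

lemma Rf_mono {m : ℤ} (hm : 0 < m) {K : Col} (h : ∀ x, (∀ y, K x y = true → K (x+1) y = true) ∨ (∀ y, K (x+1) y = true → K x y = true)) :
    ∀ x, (∀ y, Rf m K x y = true → Rf m K (x+1) y = true) ∨ (∀ y, Rf m K (x+1) y = true → Rf m K x y = true) := by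
  intro x
  unfold Rf
  rcases div_succ hm x with e | e <;> rw [e]
  · left; intro y; exact id
  · exact (h (x/m)).imp (fun h y => h _) (fun h y => h _)

lemma Rf_fin {m : ℤ} (hm : 0 < m) {K : Col} (hK : Fin' K) : Fin' (Rf m K) := by
  refine Set.Finite.subset (hK.biUnion (t := fun c => Icc (c.1*m) (c.1*m+m) ×ˢ Icc (c.2*m) (c.2*m+m))
    (fun c _ => (Set.finite_Icc _ _).prod (Set.finite_Icc _ _))) ?_
  rintro ⟨X, Y⟩ h
  refine mem_biUnion (show (X/m, Y/m) ∈ _ from h) ?_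
  simp only [mem_prod, mem_Icc]
  have := Int.ediv_mul_le X hm.ne'
  have := Int.ediv_mul_le Y hm.ne'
  have := Int.lt_ediv_add_one_mul_self X hm
  have := Int.lt_ediv_add_one_mul_self Y hm
  refine ⟨⟨?_, ?_⟩, ⟨?_, ?_⟩⟩ <;> linarith

lemma Rf_bd {m : ℤ} (hm : 0 < m) {K : Col} (f : Dt) (hf : bd (Rf m K) f) : bd K ⟨f.x/m, f.y/m, f.d⟩ := by
  obtain ⟨x, y, d⟩ := f
  revert d
  unfold bd Rf
  simp only
  apply forall4 <;> simp only [dx0, dx1, dx2, dx3, dy0, dy1, dy2, dy3, add_zero] <;> intro h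
  · rcases div_succ hm x with e | e <;> rw [e] at h
    · exact absurd rfl h
    · exact h
  · rcases div_succ hm y with e | e <;> rw [e] at h
    · exact absurd rfl h
    · exact h
  · rcases div_pred hm x with e | e <;> rw [e] at h
    · exact absurd rfl h
    · exact h
  · rcases div_pred hm y with e | e <;> rw [e] at h
    · exact absurd rfl h
    · exact h

lemma bd_cells_finite {K : Col} (hK : Fin' K) : {c : ℤ × ℤ | ∃ f, bd K f ∧ (f.x, f.y) = c}.Finite := by
  refine Set.Finite.subset (hK.biUnion (t := fun c => Icc (c.1-1) (c.1+1) ×ˢ Icc (c.2-1) (c.2+1))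
    (fun c _ => (Set.finite_Icc _ _).prod (Set.finite_Icc _ _))) ?_
  rintro _ ⟨f, hf, rfl⟩
  by_cases h : K f.x f.y = true
  · refine mem_biUnion (show (f.x, f.y) ∈ _ from h) ?_
    simp only [mem_prod, mem_Icc]; omega
  · have : K (f.x + dx f.d) (f.y + dy f.d) = true := by
      unfold bd at hf
      cases h1 : K f.x f.y <;> cases h2 : K (f.x + dx f.d) (f.y + dy f.d) <;> simp_all
    refine mem_biUnion (show (f.x + dx f.d, f.y + dy f.d) ∈ _ from this) ?_
    have h1 := abs_le.1 (dxa f.d f.x)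
    have h2 := abs_le.1 (dya f.d f.y)
    simp only [mem_prod, mem_Icc]; omega

theorem core {E F : Set ℂ} (hE : IsCompact E) (hEn : E.Nonempty) (hF : IsClosed F)
    (hd : ∀ e ∈ E, ∀ f ∈ F, 100 ≤ dist e f) (hU : IsConnected (E ∪ F)ᶜ) :
    ∃ (m : ℝ) (K : Col), 0 < m ∧ Fin' K ∧ NP K ∧ (∀ f g, bd K f → bd K g → Cn (bd K) f.st g.st) ∧
      (∃ c : ℤ × ℤ, K c.1 c.2 = true) ∧ (∀ f ∈ BD K, ∀ z : ℂ, z * m ∈ ccell (f.x, f.y) → z ∈ (E ∪ F)ᶜ) ∧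
      (∀ c : ℤ × ℤ, ∀ z : ℂ, z * m ∈ ccell c → z ∈ E → K c.1 c.2 = true) ∧
      (∀ c : ℤ × ℤ, ∀ z : ℂ, z * m ∈ ccell c → z ∈ F → K c.1 c.2 = false) := by
  have hUo : IsOpen (E ∪ F)ᶜ := (hE.isClosed.union hF).isOpen_compl
  have hDf := DD_fin hE.isBounded
  obtain ⟨J, hJc, hJp, hJU, hJB⟩ := exists_J hUo hU (bd_cells_finite hDf) (by
    rintro _ ⟨f, hf, rfl⟩; exact DD_bd hd f hf)
  obtain ⟨δ, hδ, hJδ⟩ := hJc.exists_thickening_subset_open hUo hJU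
  obtain ⟨n, hn⟩ := exists_nat_gt (max 1 (2 / δ))
  have hn1 : (1:ℝ) < n := (le_max_left _ _).trans_lt hn
  have hn2 : 2 / δ < n := (le_max_right _ _).trans_lt hn
  obtain ⟨m, hmdef⟩ : ∃ m : ℤ, m = (n : ℤ) := ⟨_, rfl⟩
  have hm : 0 < m := by
    have : (0:ℝ) < n := by linarith
    rw [hmdef]; exact_mod_cast this
  have hmn : (m:ℝ) = n := by simp [hmdef]
  rw [← hmn] at hn1 hn2
  have hmR : (0:ℝ) < m := by linarith
  let J' : Set ℂ := (fun z : ℂ => z * (m:ℝ)) '' J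
  have hJ' : IsPreconnected J' := hJp.image _ (by fun_prop)
  let W : Set (ℤ × ℤ) := {c | (ccell c ∩ J').Nonempty}
  have hW : WConn W := WConn_of hJ'
  have hWU : ∀ c ∈ W, ∀ z : ℂ, z * (m:ℝ) ∈ ccell c → z ∈ (E ∪ F)ᶜ := by
    rintro c ⟨_, hw, w, hwJ, rfl⟩ z hz
    apply hJδ
    rw [Metric.mem_thickening_iff]
    refine ⟨w, hwJ, ?_⟩
    have := ccell_dist (k := 0) hz hw (by simp) (by simp)
    simp only at this
    rw [dist_eq_norm, ← sub_mul, norm_mul, Complex.norm_real, Real.norm_of_nonneg hmR.le] at this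
    rw [dist_eq_norm]
    rw [div_lt_iff₀ hδ] at hn2
    norm_num at this
    by_contra hcon
    push Not at hcon
    nlinarith
  let K := Rf m (DD E)
  have hKf : Fin' K := Rf_fin hm hDf
  have hKW : bdW K W := by
    intro f hf
    have h1 := hJB (f.x/m, f.y/m) ⟨_, Rf_bd hm f hf, rfl⟩
    have h2 : (toC (f.x, f.y)) / (m:ℝ) * (m:ℝ) = toC (f.x, f.y) := by
      have : ((m:ℝ):ℂ) ≠ 0 := by exact_mod_cast hmR.ne'
      field_simp
    have h3 : toC (f.x, f.y) ∈ ccell (f.x, f.y) := by rw [mem_ccell]; simp [toC]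
    refine ⟨toC (f.x, f.y), h3, _, h1 (ccell_div (c := (f.x, f.y)) hm ?_), h2⟩
    rw [h2]; exact h3
  obtain ⟨R, hR⟩ := exists_cov hKf
  obtain ⟨m', K', hm', hf', np', hbW', hK', hcn'⟩ := connect R.card K W R rfl hR hKf (NP_of_mono (Rf_mono hm (DD_mono E))) hKW hW
  have hm'R : (0:ℝ) < m' := by exact_mod_cast hm'
  have hdiv : ∀ c : ℤ × ℤ, ∀ z : ℂ, z * ((m * m' : ℝ):ℂ) ∈ ccell c → z * (m:ℝ) ∈ ccell (c.1/m', c.2/m') := by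
    intro c z hz
    apply ccell_div hm'
    rwa [mul_assoc, ← Complex.ofReal_mul]
  have hout : ∀ c : ℤ × ℤ, ∀ z : ℂ, z * ((m * m' : ℝ):ℂ) ∈ ccell c → z ∈ E ∪ F → K' c.1 c.2 = DD E (c.1/m'/m) (c.2/m'/m) := by
    intro c z hz hzz
    rw [hK' c.1 c.2]
    · rfl
    · intro h
      exact hWU _ h z (hdiv c z hz) hzz
  have hEt : ∀ c : ℤ × ℤ, ∀ z : ℂ, z * ((m * m' : ℝ):ℂ) ∈ ccell c → z ∈ E → K' c.1 c.2 = true := by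
    intro c z hz hzE
    rw [hout c z hz (Or.inl hzE)]
    exact DD_E (ccell_div hm (hdiv c z hz)) hzE (by simp) (by simp)
  refine ⟨m * m', K', by positivity, hf', np', hcn', ?_, ?_, hEt, ?_⟩
  · obtain ⟨e, he⟩ := hEn
    exact ⟨_, hEt _ e (ccell_floor _) he⟩
  · intro f hf z hz
    exact hWU _ (hbW' f (BD_bd hf)) z (hdiv _ z hz)
  · intro c z hz hzF
    rw [hout c z hz (Or.inr hzF)]
    exact DD_F hd (ccell_div hm (hdiv c z hz)) hzF (by simp) (by simp)

end JL

open Set OnePoint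
set_option linter.all false

theorem stmt1 (E F : Set (OnePoint ℂ))
    (hEne : E.Nonempty) (hFne : F.Nonempty)
    (hEcl : IsClosed E) (hFcl : IsClosed F)
    (hdisj : Disjoint E F) (hinf : ∞ ∈ F)
    (hU : IsConnected ((E ∪ F)ᶜ)) :
    ∃ γ : ℝ → ℂ, IsJordanLoop γ ∧
      (fun z : ℂ => (z : OnePoint ℂ)) '' (γ '' Set.Icc 0 1) ⊆ (E ∪ F)ᶜ ∧
      FinUnionHV (γ '' Set.Icc 0 1) ∧
      (∀ z : ℂ, (z : OnePoint ℂ) ∈ E → IsWindingNumber γ z 1) ∧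
      (∀ z : ℂ, (z : OnePoint ℂ) ∈ F → IsWindingNumber γ z 0) := by
  have hEinf : ∞ ∉ E := fun h => disjoint_left.1 hdisj h hinf
  let c : ℂ → OnePoint ℂ := fun z => (z : OnePoint ℂ)
  have hc : Topology.IsOpenEmbedding c := OnePoint.isOpenEmbedding_coe
  have hrE : E ⊆ range c := by
    intro x hx
    induction x using OnePoint.rec with
    | infty => exact absurd hx hEinf
    | coe z => exact ⟨z, rfl⟩
  have hrU : (E ∪ F)ᶜ ⊆ range c := by
    intro x hx
    induction x using OnePoint.rec with
    | infty => exact absurd (Or.inr hinf) hx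
    | coe z => exact ⟨z, rfl⟩
  have hE0 : IsCompact (c ⁻¹' E) := hc.isInducing.isCompact_preimage_iff hrE |>.2 hEcl.isCompact
  have hF0 : IsClosed (c ⁻¹' F) := hFcl.preimage hc.continuous
  have hU0 : IsConnected (c ⁻¹' (E ∪ F)ᶜ) := by
    have h1 := hc.isInducing.isPreconnected_image (s := c ⁻¹' (E ∪ F)ᶜ)
    rw [image_preimage_eq_of_subset hrU] at h1
    obtain ⟨x, hx⟩ := hU.nonempty
    obtain ⟨z, rfl⟩ := hrU hx
    exact ⟨⟨z, hx⟩, h1.1 hU.isPreconnected⟩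
  have hE0n : (c ⁻¹' E).Nonempty := by
    obtain ⟨x, hx⟩ := hEne
    obtain ⟨z, rfl⟩ := hrE hx
    exact ⟨z, hx⟩
  have hdj : Disjoint (c ⁻¹' E) (c ⁻¹' F) := hdisj.preimage c
  obtain ⟨r, hr, hrd⟩ := Metric.exists_pos_forall_lt_edist hE0 hF0 hdj
  have hrR : (0:ℝ) < r := by exact_mod_cast hr
  let h : ℝ := r / 100
  have hh : 0 < h := by positivity
  have hhC : (h:ℂ) ≠ 0 := by exact_mod_cast hh.ne'
  let s : ℂ → ℂ := fun z => z * h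
  let S : ℂ ≃ₜ ℂ := Homeomorph.mulRight₀ (h:ℂ) hhC
  obtain ⟨m, K, hm, hKf, np, hcn, hne, hb, ht, hf⟩ := JL.core (E := S ⁻¹' (c ⁻¹' E)) (F := S ⁻¹' (c ⁻¹' F))
    (S.isCompact_preimage.2 hE0) (hE0n.preimage S.surjective) (hF0.preimage S.continuous) (by
      intro e he f hf
      have := hrd _ he _ hf
      rw [edist_nndist] at this
      have h2 : (r:ℝ) < dist (S e) (S f) := by exact_mod_cast this
      have h3 : dist (S e) (S f) = dist e f * h := by
        change dist (e * h) (f * h) = _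
        rw [dist_eq_norm, dist_eq_norm, ← sub_mul, norm_mul, Complex.norm_real, Real.norm_of_nonneg hh.le]
      rw [h3] at h2
      have : (r:ℝ) = 100 * h := by simp only [h]; ring
      rw [this] at h2
      exact (lt_of_mul_lt_mul_right h2 hh.le).le) (by
      have := S.isConnected_preimage.2 hU0
      exact this)
  have hmC : (m:ℂ) ≠ 0 := by exact_mod_cast hm.ne'
  obtain ⟨γ, g1, g2, g3, g4⟩ := JL.loop_scaled hKf np hcn hne (h := h / m) (by positivity)
  have hz : ∀ z : ℂ, z / ((h/m : ℝ):ℂ) = z / h * m := by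
    intro z; push_cast; field_simp
  have hS : ∀ z : ℂ, S (z / h) = z := by
    intro z; change z / h * h = z; field_simp
  have hγ : ∀ z ∈ γ '' Icc 0 1, c z ∈ (E ∪ F)ᶜ := by
    intro z hzg
    obtain ⟨f, hf, hzc⟩ := g3 z hzg
    rw [hz] at hzc
    have := hb f hf _ hzc
    have h2 : S (z/h) ∈ c ⁻¹' (E ∪ F)ᶜ := this
    rw [hS] at h2
    exact h2
  refine ⟨γ, g1, ?_, g2, ?_, ?_⟩
  · rintro _ ⟨z, hzg, rfl⟩
    exact hγ z hzg
  · intro z hzE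
    have h1 := JL.ccell_floor (z / ((h/m : ℝ):ℂ))
    have h2 := g4 _ z h1 (fun hg => hγ z hg (Or.inl hzE))
    have h3 := ht _ (z / h) (by rw [← hz]; exact h1) (by change S (z/h) ∈ c ⁻¹' E; rw [hS]; exact hzE)
    rw [if_pos h3] at h2
    exact h2
  · intro z hzF
    have h1 := JL.ccell_floor (z / ((h/m : ℝ):ℂ))
    have h2 := g4 _ z h1 (fun hg => hγ z hg (Or.inr hzF))
    have h3 := hf _ (z / h) (by rw [← hz]; exact h1) (by change S (z/h) ∈ c ⁻¹' F; rw [hS]; exact hzF)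
    rw [if_neg (by rw [h3]; simp)] at h2
    exact h2
end

section
/- Let E ⊆ ℂ be nonempty and compact and let F ⊆ ℂ be closed with E ∩ F = ∅. Then there exist finitely many Jordan loops γ₁, …, γₙ with pairwise disjoint images, each image contained in ℂ ∖ (E ∪ F) and each image a finite union of horizontal and vertical segments, such that for every z ∈ E the sum of the winding numbers n(γ₁, z) + ⋯ + n(γₙ, z) equals 1, and for every z ∈ F this sum equals 0. -/
open Set

theorem lift_branch (A : Set ℂ) (f : ℂ → ℂ) (hf : ContinuousOn f A)
    (hfe : ∀ w ∈ A, Complex.exp (f w) = w) (g l : ℝ → ℂ)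
    (hg : ContinuousOn g (Icc 0 1)) (hgA : MapsTo g (Icc 0 1) A)
    (hl : ContinuousOn l (Icc 0 1)) (h : ∀ t ∈ Icc (0:ℝ) 1, g t = Complex.exp (l t)) :
    l 1 - l 0 = f (g 1) - f (g 0) := by
  have hc : ContinuousOn (fun t => (l t - f (g t)) / (2 * Real.pi * Complex.I)) (Icc (0:ℝ) 1) :=
    (hl.sub (hf.comp hg hgA)).div_const _
  have hm : MapsTo (fun t => (l t - f (g t)) / (2 * Real.pi * Complex.I)) (Icc (0:ℝ) 1)
      (Set.range (Int.cast : ℤ → ℂ)) := by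
    intro t ht
    have : Complex.exp (l t - f (g t)) = 1 := by
      rw [Complex.exp_sub, ← h t ht, hfe _ (hgA ht)]
      refine div_self ?_
      rw [h t ht]; exact Complex.exp_ne_zero _
    obtain ⟨n, hn⟩ := Complex.exp_eq_one_iff.1 this
    refine ⟨n, ?_⟩
    simp only [hn]
    field_simp
  have hD : DiscreteTopology (Set.range (Int.cast : ℤ → ℂ)) := by
    have e : Topology.IsEmbedding (Int.cast : ℤ → ℂ) := Complex.isClosedEmbedding_intCast.isEmbedding
    exact e.toHomeomorph.symm.isEmbedding.discreteTopology
  have := isPreconnected_Icc.constant_of_mapsTo (isDiscrete_iff_discreteTopology.2 hD) hc hm (left_mem_Icc.2 zero_le_one) (right_mem_Icc.2 zero_le_one)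
  have h2 : (2 * Real.pi * Complex.I : ℂ) ≠ 0 := Complex.two_pi_I_ne_zero
  rw [div_left_inj' h2] at this
  linear_combination -this

open Classical in
noncomputable def crs (a b : ℂ) : ℤ :=
  if a.re < 0 ∧ a.im < 0 ∧ 0 ≤ b.im then -1
  else if a.re < 0 ∧ b.im < 0 ∧ 0 ≤ a.im then 1 else 0

theorem log_contOn_upper : ContinuousOn Complex.log {w : ℂ | 0 ≤ w.im ∧ w ≠ 0} := by
  intro w hw
  by_cases hs : w ∈ Complex.slitPlane
  · exact (continuousAt_clog hs).continuousWithinAt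
  · have h1 : w.im = 0 := by
      by_contra h; exact hs (Or.inr h)
    have h2 : w.re < 0 := by
      by_contra h
      rcases lt_or_eq_of_le (not_lt.1 h) with h | h
      · exact hs (Or.inl h)
      · exact hw.2 (Complex.ext h.symm h1)
    exact (Complex.continuousWithinAt_log_of_re_neg_of_im_zero h2 h1).mono fun x hx => hx.1

theorem edge_lift (a b : ℂ) (l : ℝ → ℂ) (hl : ContinuousOn l (Icc 0 1))
    (h : ∀ t ∈ Icc (0:ℝ) 1, a + t * (b - a) = Complex.exp (l t))
    (hv : a.re = b.re ∨ a.im = b.im) :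
    l 1 - l 0 = Complex.log b - Complex.log a + 2 * Real.pi * Complex.I * crs a b := by
  have hg : ContinuousOn (fun t : ℝ => a + t * (b - a)) (Icc 0 1) := by fun_prop
  have hne : ∀ t ∈ Icc (0:ℝ) 1, a + t * (b - a) ≠ 0 := fun t ht => by
    rw [h t ht]; exact Complex.exp_ne_zero _
  have him : ∀ t : ℝ, (a + t * (b - a)).im = (1 - t) * a.im + t * b.im := fun t => by
    simp; ring
  have hre : ∀ t : ℝ, (a + t * (b - a)).re = (1 - t) * a.re + t * b.re := fun t => by
    simp; ring
  have up : 0 ≤ a.im → 0 ≤ b.im → l 1 - l 0 = Complex.log b - Complex.log a := by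
    intro ha hb
    have := lift_branch {w : ℂ | 0 ≤ w.im ∧ w ≠ 0} Complex.log log_contOn_upper
      (fun w hw => Complex.exp_log hw.2) _ l hg ?_ hl h
    · simpa using this
    · intro t ht
      refine ⟨?_, hne t ht⟩
      rw [him]
      have := ht.1; have := ht.2
      have : 0 ≤ 1 - t := by linarith
      positivity
  have sl : (∀ t ∈ Icc (0:ℝ) 1, a + t * (b - a) ∈ Complex.slitPlane) →
      l 1 - l 0 = Complex.log b - Complex.log a := by
    intro hs
    have := lift_branch Complex.slitPlane Complex.log
      (fun w hw => (continuousAt_clog hw).continuousWithinAt)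
      (fun w hw => Complex.exp_log (Complex.slitPlane_ne_zero hw)) _ l hg hs hl h
    simpa using this
  have dn : a.im < 0 → b.im < 0 → l 1 - l 0 = Complex.log b - Complex.log a := by
    intro ha hb
    refine sl fun t ht => Or.inr ?_
    rw [him]
    have h0 := ht.1
    have h1 := ht.2
    refine ne_of_lt ?_
    rcases le_total t (1/2) with h | h <;> nlinarith
  by_cases hopp : (a.im < 0 ∧ 0 ≤ b.im) ∨ (b.im < 0 ∧ 0 ≤ a.im)
  · have hr : a.re = b.re := by
      rcases hv with h | h
      · exact h
      · rcases hopp with h' | h' <;> linarith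
    have hr' : ∀ t : ℝ, (a + t * (b - a)).re = a.re := fun t => by rw [hre, ← hr]; ring
    rcases lt_trichotomy a.re 0 with h0 | h0 | h0
    · have key : l 1 - l 0 = Complex.log (-b) - Complex.log (-a) := by
        have := lift_branch {w : ℂ | w.re < 0} (fun w => Complex.log (-w) + Real.pi * Complex.I)
          (fun w hw => by
            have h' : -w ∈ Complex.slitPlane := Or.inl (by simpa using hw)
            exact (((continuousAt_clog h').comp continuousAt_neg).add
              continuousAt_const).continuousWithinAt)
          (fun w hw => by
            have : w ≠ 0 := by rintro rfl; simp at hw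
            rw [Complex.exp_add, Complex.exp_log (neg_ne_zero.2 this), Complex.exp_pi_mul_I]; ring)
          _ l hg (fun t ht => by rw [mem_ofPred_eq, hr']; exact h0) hl h
        simpa using this
      have lneg : ∀ w : ℂ, w.re < 0 → w.im < 0 → Complex.log w = Complex.log (-w) - Real.pi * Complex.I := by
        intro w h1 h2
        simp only [Complex.log, norm_neg]
        rw [Complex.arg_neg_eq_arg_add_pi_of_im_neg h2]
        push_cast; ring
      have lpos : ∀ w : ℂ, w.re < 0 → 0 ≤ w.im → Complex.log w = Complex.log (-w) + Real.pi * Complex.I := by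
        intro w h1 h2
        simp only [Complex.log, norm_neg]
        have : (-w).arg = w.arg - Real.pi := by
          rw [Complex.arg_neg_eq_arg_sub_pi_iff]
          rcases lt_or_eq_of_le h2 with h2 | h2
          · exact Or.inl h2
          · exact Or.inr ⟨h2.symm, h1⟩
        rw [this]
        push_cast; ring
      rcases hopp with ⟨h1, h2⟩ | ⟨h1, h2⟩
      · rw [key, lneg a h0 h1, lpos b (hr ▸ h0) h2, crs, if_pos ⟨h0, h1, h2⟩]; push_cast; ring
      · rw [key, lneg b (hr ▸ h0) h1, lpos a h0 h2, crs, if_neg (by rintro ⟨_, h, _⟩; linarith),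
          if_pos ⟨h0, h1, h2⟩]; push_cast; ring
    · exfalso
      have hd : b.im - a.im ≠ 0 := by rcases hopp with h' | h' <;> intro h <;> linarith
      refine hne (-a.im / (b.im - a.im)) ?_ (Complex.ext ?_ ?_)
      · rcases hopp with h' | h'
        · exact ⟨div_nonneg (by linarith) (by linarith), (div_le_one (by linarith)).2 (by linarith)⟩
        · exact ⟨div_nonneg_of_nonpos (by linarith) (by linarith), (div_le_one_of_neg (by linarith)).2 (by linarith)⟩
      · rw [hr', h0]; rfl
      · rw [him]; simp; field_simp; ring
    · rw [crs, if_neg (by rintro ⟨h, _⟩; linarith), if_neg (by rintro ⟨h, _⟩; linarith)]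
      simp only [Int.cast_zero, mul_zero, add_zero]
      exact sl fun t ht => Or.inl (by rw [hr']; exact h0)
  · have : crs a b = 0 := by
      rw [crs, if_neg (fun h => hopp (Or.inl h.2)), if_neg (fun h => hopp (Or.inr h.2))]
    rw [this]
    simp only [Int.cast_zero, mul_zero, add_zero]
    push Not at hopp
    by_cases ha : a.im < 0
    · exact dn ha (hopp.1 ha)
    · refine up (not_lt.1 ha) ?_
      by_contra hb
      exact absurd (hopp.2 (not_le.1 hb)) ha


def nxt (S : ℤ → ℤ → Bool) (v : ℤ × ℤ) : ℤ × ℤ :=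
  if S v.1 v.2 = true ∧ S v.1 (v.2 - 1) = false then (v.1 + 1, v.2)
  else if S (v.1 - 1) v.2 = true ∧ S v.1 v.2 = false then (v.1, v.2 + 1)
  else if S (v.1 - 1) (v.2 - 1) = true ∧ S (v.1 - 1) v.2 = false then (v.1 - 1, v.2)
  else if S v.1 (v.2 - 1) = true ∧ S (v.1 - 1) (v.2 - 1) = false then (v.1, v.2 - 1)
  else v

theorem nxt_cases (S : ℤ → ℤ → Bool) (x y : ℤ) :
    (nxt S (x, y) = (x + 1, y) ∧ S x y = true ∧ S x (y - 1) = false) ∨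
    (nxt S (x, y) = (x, y + 1) ∧ S (x - 1) y = true ∧ S x y = false) ∨
    (nxt S (x, y) = (x - 1, y) ∧ S (x - 1) (y - 1) = true ∧ S (x - 1) y = false) ∨
    (nxt S (x, y) = (x, y - 1) ∧ S x (y - 1) = true ∧ S (x - 1) (y - 1) = false) ∨
    (nxt S (x, y) = (x, y) ∧ S x y = S x (y-1) ∧ S x y = S (x-1) y ∧ S x y = S (x-1) (y-1)) := by
  unfold nxt
  grind

def Dom (S : ℤ → ℤ → Bool) : Prop := ∀ i j : ℤ, (i + j) % 2 = 0 → S i j = S (i + 1) j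

theorem nxt_north (S : ℤ → ℤ → Bool) (hS : Dom S) (x y : ℤ) :
    nxt S (x, y) = (x, y + 1) ↔ S (x - 1) y = true ∧ S x y = false := by
  have h1 := hS (x - 1) y
  have h2 := hS (x - 1) (y - 1)
  simp only [sub_add_cancel] at h1 h2
  rcases nxt_cases S x y with h | h | h | h | h <;> simp only [h.1, Prod.mk.injEq] <;> grind

theorem nxt_south (S : ℤ → ℤ → Bool) (hS : Dom S) (x y : ℤ) :
    nxt S (x, y) = (x, y - 1) ↔ S x (y - 1) = true ∧ S (x - 1) (y - 1) = false := by
  have h1 := hS (x - 1) y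
  have h2 := hS (x - 1) (y - 1)
  simp only [sub_add_cancel] at h1 h2
  rcases nxt_cases S x y with h | h | h | h | h <;> simp only [h.1, Prod.mk.injEq] <;> grind

theorem nxt_inj (S : ℤ → ℤ → Bool) (hS : Dom S) : Function.Injective (nxt S) := by
  rintro ⟨x, y⟩ ⟨x', y'⟩ e
  have key : ∀ a b : ℤ, nxt S (x, y) = (a, b) → nxt S (x', y') = (a, b) → (x, y) = (x', y') := by
    intro a b h1 h2
    have d1 := hS (a - 1) b
    have d2 := hS (a - 1) (b - 1)
    simp only [sub_add_cancel] at d1 d2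
    rcases nxt_cases S x y with h | h | h | h | h <;>
    rcases nxt_cases S x' y' with h' | h' | h' | h' | h' <;>
    · rw [h1, Prod.mk.injEq] at h
      rw [h2, Prod.mk.injEq] at h'
      obtain ⟨⟨ha, hb⟩, h⟩ := h
      obtain ⟨⟨ha', hb'⟩, h'⟩ := h'
      first
      | (refine Prod.ext ?_ ?_ <;> simp only <;> omega)
      | (subst ha hb; exfalso; grind)
  exact key _ _ rfl e.symm

/-- Half open edges are disjoint (in lattice units). -/
theorem pos_inj (S : ℤ → ℤ → Bool) (hS : Dom S) (u v : ℤ × ℤ) (hu : nxt S u ≠ u) (hv : nxt S v ≠ v)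
    (s t : ℝ) (hs : s ∈ Ico (0:ℝ) 1) (ht : t ∈ Ico (0:ℝ) 1)
    (h1 : (u.1:ℝ) + s * ((nxt S u).1 - u.1) = v.1 + t * ((nxt S v).1 - v.1))
    (h2 : (u.2:ℝ) + s * ((nxt S u).2 - u.2) = v.2 + t * ((nxt S v).2 - v.2)) : u = v ∧ s = t := by
  obtain ⟨x, y⟩ := u
  obtain ⟨x', y'⟩ := v
  obtain ⟨hs0, hs1⟩ := hs
  obtain ⟨ht0, ht1⟩ := ht
  have M : ∀ a b : ℤ, -1 < (a:ℝ) - b → (a:ℝ) - b < 1 → a = b := by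
    intro a b h0 h1
    have h3 : -1 < a - b := by exact_mod_cast h0
    have h4 : a - b < 1 := by exact_mod_cast h1
    omega
  have M2 : ∀ a b : ℤ, -1 < (b:ℝ) - a → (b:ℝ) - a < 2 → b = a ∨ b = a + 1 := by
    intro a b h0 h1
    have h3 : -1 < b - a := by exact_mod_cast h0
    have h4 : b - a < 2 := by exact_mod_cast h1
    omega
  have C1 := nxt_cases S x y
  have C2 := nxt_cases S x' y'
  simp only [hu, hv, false_and, or_false] at C1 C2
  rcases C1 with h | h | h | h <;> rcases C2 with h' | h' | h' | h' <;>
  · simp only [h.1, h'.1] at h1 h2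
    push_cast at h1 h2
    replace h := h.2
    replace h' := h'.2
    first
    | (have q1 := M x x' (by linarith) (by linarith)
       have q2 := M y y' (by linarith) (by linarith)
       subst q1 q2
       exact ⟨rfl, by linarith⟩)
    | (have q2 := M y y' (by linarith) (by linarith)
       subst q2
       rcases M2 x x' (by linarith) (by linarith) with q | q
       · subst q
         exact ⟨rfl, by linarith⟩
       · subst q
         exfalso
         simp only [add_sub_cancel_right] at h h'
         simp_all)
    | (have q2 := M y y' (by linarith) (by linarith)
       subst q2
       rcases M2 x' x (by linarith) (by linarith) with q | q
       · subst q
         exact ⟨rfl, by linarith⟩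
       · subst q
         exfalso
         simp only [add_sub_cancel_right] at h h'
         simp_all)
    | (have q2 := M x x' (by linarith) (by linarith)
       subst q2
       rcases M2 y y' (by linarith) (by linarith) with q | q
       · subst q
         exact ⟨rfl, by linarith⟩
       · subst q
         exfalso
         simp only [add_sub_cancel_right] at h h'
         simp_all)
    | (have q2 := M x x' (by linarith) (by linarith)
       subst q2
       rcases M2 y' y (by linarith) (by linarith) with q | q
       · subst q
         exact ⟨rfl, by linarith⟩
       · subst q
         exfalso
         simp only [add_sub_cancel_right] at h h'
         simp_all)


theorem orbit_decomp {α : Type} [Fintype α] (g : α → α) (hg : Function.Injective g) :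
    ∃ (n : ℕ) (r : Fin n → α), (∀ i, 0 < Function.minimalPeriod g (r i)) ∧
      (∀ i j k l, g^[k] (r i) = g^[l] (r j) → i = j) ∧
      (∀ c : α → ℤ, ∑ i, ∑ k ∈ Finset.range (Function.minimalPeriod g (r i)), c (g^[k] (r i))
        = ∑ a, c a) := by
  classical
  have per : ∀ a, a ∈ Function.periodicPts g := fun a => hg.mem_periodicPts a
  have pos : ∀ a, 0 < Function.minimalPeriod g a := fun a =>
    Function.minimalPeriod_pos_of_mem_periodicPts (per a)
  let σ : Equiv.Perm α := Equiv.ofBijective g (Finite.injective_iff_bijective.1 hg)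
  have hσ : ∀ k : ℕ, ∀ a, (σ ^ k) a = g^[k] a := by
    intro k a
    rw [← Equiv.Perm.iterate_eq_pow]; rfl
  let st := Equiv.Perm.SameCycle.setoid σ
  let Q := Quotient st
  let e : Fin (Fintype.card Q) ≃ Q := (Fintype.equivFin Q).symm
  have hmk : ∀ k : ℕ, ∀ a : α, (Quotient.mk st (g^[k] a)) = Quotient.mk st a := by
    intro k a
    apply Quotient.sound
    show σ.SameCycle _ _
    rw [← hσ]
    exact (Equiv.Perm.sameCycle_pow_left).2 (Equiv.Perm.SameCycle.refl _ _)
  refine ⟨Fintype.card Q, fun i => (e i).out, fun i => pos _, ?_, ?_⟩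
  · intro i j k l h
    have := congrArg (Quotient.mk st) h
    rw [hmk, hmk, Quotient.out_eq, Quotient.out_eq] at this
    exact e.injective this
  · intro c
    rw [e.sum_comp (fun q => ∑ k ∈ Finset.range (Function.minimalPeriod g q.out), c (g^[k] q.out))]
    rw [← Finset.sum_fiberwise Finset.univ (fun a => Quotient.mk st a) c]
    refine Finset.sum_congr rfl fun q _ => ?_
    have : Finset.univ.filter (fun a => Quotient.mk st a = q)
        = (Finset.range (Function.minimalPeriod g q.out)).image (fun k => g^[k] q.out) := by
      ext a
      simp only [Finset.mem_filter, Finset.mem_univ, true_and, Finset.mem_image, Finset.mem_range]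
      constructor
      · intro h
        have h2 : σ.SameCycle q.out a := by
          have : Quotient.mk st q.out = Quotient.mk st a := by rw [Quotient.out_eq, h]
          exact Quotient.exact this
        obtain ⟨k, hk⟩ := h2.exists_nat_pow_eq
        refine ⟨k % Function.minimalPeriod g q.out, Nat.mod_lt _ (pos _), ?_⟩
        rw [Function.iterate_mod_minimalPeriod_eq, ← hσ, hk]
      · rintro ⟨k, _, rfl⟩
        rw [hmk, Quotient.out_eq]
    rw [this, Finset.sum_image]
    intro k hk l hl h
    exact Function.iterate_injOn_Iio_minimalPeriod (by simpa using hk) (by simpa using hl) h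

noncomputable def ploop (p : ℕ → ℂ) (N : ℕ) (t : ℝ) : ℂ :=
  p 0 + ∑ k ∈ Finset.range N, ((max 0 (min (N * t - k) 1) : ℝ) : ℂ) * (p (k + 1) - p k)

theorem ploop_cont (p : ℕ → ℂ) (N : ℕ) : Continuous (ploop p N) := by
  unfold ploop
  refine continuous_const.add (continuous_finsetSum _ fun k _ => ?_)
  refine Continuous.mul (Complex.continuous_ofReal.comp ?_) continuous_const
  fun_prop

theorem ploop_eval (p : ℕ → ℂ) (N k : ℕ) (hk : k < N) (f : ℝ) (hf : f ∈ Icc (0:ℝ) 1) :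
    ploop p N ((k + f) / N) = p k + f * (p (k + 1) - p k) := by
  have hN : (N:ℝ) ≠ 0 := by have : 0 < N := by omega
                            positivity
  unfold ploop
  rw [mul_div_cancel₀ _ hN]
  obtain ⟨m, rfl⟩ : ∃ m, N = k + 1 + m := ⟨N - (k+1), by omega⟩
  rw [Finset.sum_range_add, Finset.sum_range_succ]
  have h1 : ∑ x ∈ Finset.range k, ((max 0 (min ((k:ℝ) + f - x) 1) : ℝ) : ℂ) * (p (x + 1) - p x)
      = p k - p 0 := by
    rw [← Finset.sum_range_sub]
    refine Finset.sum_congr rfl fun x hx => ?_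
    have hx : (x:ℝ) + 1 ≤ k := by exact_mod_cast Finset.mem_range.1 hx
    rw [min_eq_right (by linarith [hf.1]), max_eq_right zero_le_one]
    simp
  have h2 : ∑ x ∈ Finset.range m, ((max 0 (min ((k:ℝ) + f - ((k + 1 + x : ℕ):ℝ)) 1) : ℝ) : ℂ) *
      (p (k + 1 + x + 1) - p (k + 1 + x)) = 0 := by
    refine Finset.sum_eq_zero fun x hx => ?_
    rw [max_eq_left]
    · simp
    · refine (min_le_left _ _).trans ?_
      push_cast
      have : (0:ℝ) ≤ x := by positivity
      linarith [hf.2]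
  rw [h1, h2, add_sub_cancel_left, min_eq_left hf.2, max_eq_right hf.1]
  ring

theorem ploop_param (N : ℕ) (hN : 0 < N) (t : ℝ) (ht : t ∈ Ico (0:ℝ) 1) :
    ∃ k < N, ∃ f ∈ Ico (0:ℝ) 1, t = (k + f) / N := by
  have hN' : (0:ℝ) < N := by positivity
  have h0 : 0 ≤ N * t := mul_nonneg hN'.le ht.1
  refine ⟨⌊N * t⌋₊, ?_, N * t - ⌊N * t⌋₊, ⟨?_, ?_⟩, ?_⟩
  · rw [Nat.floor_lt h0]; nlinarith [ht.2]
  · linarith [Nat.floor_le h0]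
  · linarith [Nat.lt_floor_add_one (N * t)]
  · field_simp; ring

theorem ploop_param' (N : ℕ) (hN : 0 < N) (t : ℝ) (ht : t ∈ Icc (0:ℝ) 1) :
    ∃ k < N, ∃ f ∈ Icc (0:ℝ) 1, t = (k + f) / N := by
  rcases lt_or_eq_of_le ht.2 with h | rfl
  · obtain ⟨k, hk, f, hf, e⟩ := ploop_param N hN t ⟨ht.1, h⟩
    exact ⟨k, hk, f, Ico_subset_Icc_self hf, e⟩
  · refine ⟨N - 1, by omega, 1, by simp, ?_⟩
    have hN' : (0:ℝ) < N := by positivity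
    rw [Nat.cast_sub (by omega)]; field_simp; simp

theorem ploop_zero (p : ℕ → ℂ) (N : ℕ) (hN : 0 < N) : ploop p N 0 = p 0 := by
  have := ploop_eval p N 0 hN 0 (by simp)
  simpa using this

theorem ploop_one (p : ℕ → ℂ) (N : ℕ) (hN : 0 < N) : ploop p N 1 = p N := by
  have := ploop_eval p N (N-1) (by omega) 1 (by simp)
  rw [Nat.cast_sub (by omega), Nat.sub_add_cancel (by omega)] at this
  have hN' : (N:ℝ) ≠ 0 := by positivity
  simpa [hN'] using this

theorem param_mem (N k : ℕ) (hk : k < N) (f : ℝ) (hf : f ∈ Icc (0:ℝ) 1) :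
    (k + f) / N ∈ Icc (0:ℝ) 1 := by
  have hN' : (0:ℝ) < N := by have : 0 < N := by omega
                             positivity
  have : (k:ℝ) + 1 ≤ N := by exact_mod_cast hk
  exact ⟨div_nonneg (add_nonneg (by positivity) hf.1) hN'.le, (div_le_one hN').2 (by linarith [hf.2])⟩

theorem ploop_hv (p : ℕ → ℂ) (N : ℕ) (hN : 0 < N) :
    ploop p N '' Icc 0 1 = ⋃ i : Fin N, segment ℝ (p i) (p (i + 1)) := by
  ext z
  simp only [mem_image, mem_iUnion, segment_eq_image']
  constructor
  · rintro ⟨t, ht, rfl⟩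
    obtain ⟨k, hk, f, hf, rfl⟩ := ploop_param' N hN t ht
    refine ⟨⟨k, hk⟩, f, hf, ?_⟩
    rw [ploop_eval p N k hk f hf]; simp
  · rintro ⟨⟨k, hk⟩, f, hf, rfl⟩
    refine ⟨_, param_mem N k hk f hf, ?_⟩
    rw [ploop_eval p N k hk f hf]; simp


noncomputable def gpt (d : ℝ) (v : ℤ × ℤ) : ℂ := ⟨d * v.1, d * v.2⟩

theorem crs_lat (S : ℤ → ℤ → Bool) (d : ℝ) (hd : 0 < d) (z : ℂ) (i j : ℤ)
    (hi : i = ⌈z.re / d⌉ - 1) (hj : j = ⌈z.im / d⌉ - 1) (u v : ℤ × ℤ) :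
    crs (gpt d u - z) (gpt d v - z) =
      if u.1 ≤ i ∧ u.2 ≤ j ∧ j < v.2 then -1
      else if u.1 ≤ i ∧ v.2 ≤ j ∧ j < u.2 then 1 else 0 := by
  have key : ∀ (x : ℤ) (r : ℝ), d * x - r < 0 ↔ x ≤ ⌈r / d⌉ - 1 := by
    intro x r
    rw [Int.le_sub_one_iff, Int.lt_ceil, lt_div_iff₀ hd, sub_neg, mul_comm]
  have key2 : ∀ (x : ℤ) (r : ℝ), 0 ≤ d * x - r ↔ ⌈r / d⌉ - 1 < x := by
    intro x r
    rw [← not_lt, key, not_le]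
  subst hi hj
  unfold crs
  simp only [gpt, Complex.sub_re, Complex.sub_im, key, key2]

theorem crs_sum (S : ℤ → ℤ → Bool) (hS : Dom S) (d : ℝ) (hd : 0 < d) (z : ℂ) (i j : ℤ)
    (hi : i = ⌈z.re / d⌉ - 1) (hj : j = ⌈z.im / d⌉ - 1) (M : ℤ)
    (hM : ∀ i j, S i j = true → -M ≤ i) (V : Finset (ℤ × ℤ)) (hV : ∀ v, v ∈ V ↔ nxt S v ≠ v) :
    ∑ v ∈ V, crs (gpt d v - z) (gpt d (nxt S v) - z) = if S i j = true then 1 else 0 := by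
  classical
  have hc := fun v => crs_lat S d hd z i j hi hj v (nxt S v)
  simp only [hc]
  clear hc hi hj
  set c : ℤ × ℤ → ℤ := fun v => if v.1 ≤ i ∧ v.2 ≤ j ∧ j < (nxt S v).2 then -1
      else if v.1 ≤ i ∧ (nxt S v).2 ≤ j ∧ j < v.2 then 1 else 0 with hcdef
  let b : ℤ → ℤ := fun x => if S x j = true then 1 else 0
  have hlow : ∀ i j, i < -M → S i j = false := fun i j h => by
    by_contra h'
    have := hM i j (by simpa using h')
    omega
  have c1 : ∀ x, x ≤ i → c (x, j) = if S (x-1) j = true ∧ S x j = false then -1 else 0 := by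
    intro x hx
    have hn := nxt_north S hS x j
    rcases nxt_cases S x j with h | h | h | h | h <;>
      rw [h.1] at hn <;> simp only [← hn, hcdef, h.1, Prod.mk.injEq] <;> (split_ifs <;> omega)
  have c2 : ∀ x, x ≤ i → c (x, j + 1) = if S x j = true ∧ S (x-1) j = false then 1 else 0 := by
    intro x hx
    have hn := nxt_south S hS x (j + 1)
    simp only [add_sub_cancel_right] at hn
    rcases nxt_cases S x (j + 1) with h | h | h | h | h <;>
      rw [h.1] at hn <;> simp only [← hn, hcdef, h.1, Prod.mk.injEq] <;> (split_ifs <;> simp_all <;> omega)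
  have c3 : ∀ x, x ≤ i → c (x, j) + c (x, j + 1) = b x - b (x - 1) := by
    intro x hx
    rw [c1 x hx, c2 x hx]
    simp only [b]
    cases S x j <;> cases S (x-1) j <;> simp
  have csupp : ∀ x y, c (x, y) ≠ 0 → x ≤ i ∧ (y = j ∨ y = j + 1) ∧ -M ≤ x ∧ nxt S (x,y) ≠ (x,y) := by
    intro x y h
    have e1 := hlow x y
    have e2 := hlow (x-1) y
    have e3 := hlow x (y-1)
    have e4 := hlow (x-1) (y-1)
    have hne : nxt S (x,y) ≠ (x,y) := by
      intro h'
      apply h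
      simp only [hcdef, h']
      rw [if_neg (by omega), if_neg (by omega)]
    refine ⟨?_, ?_, ?_, hne⟩
    · by_contra hx
      exact h (by simp [hcdef, hx])
    · by_contra hy
      apply h
      simp only [hcdef]
      rcases nxt_cases S x y with h | h | h | h | h <;> simp only [h.1] <;>
        rw [if_neg (by omega), if_neg (by omega)]
    · by_contra hx
      apply hne
      rcases nxt_cases S x y with h | h | h | h | h
      · rw [e1 (by omega)] at h; simp at h
      · rw [e2 (by omega)] at h; simp at h
      · rw [e4 (by omega)] at h; simp at h
      · rw [e3 (by omega)] at h; simp at h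
      · exact h.1
  let K := (i + M + 1).toNat
  let T : Finset (ℤ × ℤ) := (Finset.range K ×ˢ ({j, j+1} : Finset ℤ)).image (fun p => (i - p.1, p.2))
  have s1 : ∑ᶠ v, c v = ∑ v ∈ V, c v := by
    apply finsum_eq_sum_of_support_subset
    rintro ⟨x, y⟩ h
    exact (hV _).2 (csupp x y h).2.2.2
  have s2 : ∑ᶠ v, c v = ∑ v ∈ T, c v := by
    apply finsum_eq_sum_of_support_subset
    rintro ⟨x, y⟩ h
    obtain ⟨h1, h2, h3, -⟩ := csupp x y h
    simp only [T, Finset.coe_image, mem_image, Finset.mem_coe, Finset.mem_product, Finset.mem_range,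
      Finset.mem_insert, Finset.mem_singleton]
    refine ⟨((i - x).toNat, y), ⟨?_, h2⟩, ?_⟩
    · simp only [K]; omega
    · simp only [Prod.mk.injEq, and_true]; omega
  rw [← s1, s2]
  simp only [T]
  rw [Finset.sum_image, Finset.sum_product]
  · have : ∀ k ∈ Finset.range K, ∑ y ∈ ({j, j+1} : Finset ℤ), c (i - (k:ℤ), y)
        = (fun n : ℕ => - b (i - n)) (k+1) - (fun n : ℕ => - b (i - n)) k := by
      intro k hk
      rw [Finset.sum_pair (by omega), c3 _ (by omega)]
      simp only
      push_cast
      rw [show i - ((k:ℤ) + 1) = i - k - 1 by ring]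
      ring
    rw [Finset.sum_congr rfl this, Finset.sum_range_sub (fun n : ℕ => - b (i - n))]
    by_cases hK : i < -M
    · have : K = 0 := by simp only [K]; omega
      rw [this, hlow i j hK]; simp
    · have : b (i - K) = 0 := by
        simp only [b]
        rw [hlow _ _ (by simp only [K]; omega)]; simp
      simp [this, b]
  · rintro ⟨k, y⟩ _ ⟨k', y'⟩ _ h
    simp only [Prod.mk.injEq] at h ⊢
    omega

theorem nxt_hv (S : ℤ → ℤ → Bool) (d : ℝ) (v : ℤ × ℤ) :
    (gpt d v).re = (gpt d (nxt S v)).re ∨ (gpt d v).im = (gpt d (nxt S v)).im := by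
  obtain ⟨x, y⟩ := v
  rcases nxt_cases S x y with h | h | h | h | h <;> rw [h.1] <;> simp [gpt]

/-- winding number of a closed lattice polygon -/
theorem ploop_wind (p : ℕ → ℂ) (N : ℕ) (hN : 0 < N) (hp : p N = p 0)
    (hv : ∀ k, (p k).re = (p (k+1)).re ∨ (p k).im = (p (k+1)).im) (z : ℂ) :
    IsWindingNumber (ploop p N) z (∑ k ∈ Finset.range N, crs (p k - z) (p (k+1) - z)) := by
  intro l hl h
  have hN' : (0:ℝ) < N := by positivity
  have step : ∀ k ∈ Finset.range N, l (((k + 1 : ℕ):ℝ) / N) - l ((k:ℝ) / N) =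
      (Complex.log (p (k+1) - z) - Complex.log (p k - z)) +
        2 * Real.pi * Complex.I * (crs (p k - z) (p (k+1) - z) : ℤ) := by
    intro k hk
    have hk := Finset.mem_range.1 hk
    have := edge_lift (p k - z) (p (k+1) - z) (fun f => l ((k + f) / N)) ?_ ?_ ?_
    · simpa using this
    · refine hl.comp (by fun_prop) fun f hf => param_mem N k hk f hf
    · intro f hf
      rw [← h _ (param_mem N k hk f hf), ploop_eval p N k hk f hf]
      ring
    · simpa using hv k
  have tot := Finset.sum_congr rfl step
  rw [Finset.sum_range_sub (fun k : ℕ => l ((k:ℝ) / N)), Finset.sum_add_distrib,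
    Finset.sum_range_sub (fun k : ℕ => Complex.log (p k - z)), hp, ← Finset.mul_sum] at tot
  simp only [div_self hN'.ne', Nat.cast_zero, zero_div, sub_self, zero_add] at tot
  rw [tot]
  push_cast
  rfl

theorem gpt_inj (S : ℤ → ℤ → Bool) (hS : Dom S) (d : ℝ) (hd : 0 < d) (u v : ℤ × ℤ)
    (hu : nxt S u ≠ u) (hv : nxt S v ≠ v)
    (s t : ℝ) (hs : s ∈ Ico (0:ℝ) 1) (ht : t ∈ Ico (0:ℝ) 1)
    (h : gpt d u + s * (gpt d (nxt S u) - gpt d u) = gpt d v + t * (gpt d (nxt S v) - gpt d v)) :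
    u = v ∧ s = t := by
  apply pos_inj S hS u v hu hv s t hs ht
  · have := congrArg Complex.re h
    simp [gpt] at this
    apply mul_left_cancel₀ hd.ne'
    linear_combination this
  · have := congrArg Complex.im h
    simp [gpt] at this
    apply mul_left_cancel₀ hd.ne'
    linear_combination this

theorem main_loops (S : ℤ → ℤ → Bool) (hS : Dom S) (d : ℝ) (hd : 0 < d) (M : ℤ)
    (hM : ∀ i j, S i j = true → -M ≤ i ∧ i ≤ M ∧ -M ≤ j ∧ j ≤ M) (B : Set ℂ)
    (hB : ∀ v, nxt S v ≠ v → ∀ f ∈ Icc (0:ℝ) 1, gpt d v + f * (gpt d (nxt S v) - gpt d v) ∉ B) :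
    ∃ (n : ℕ) (γ : Fin n → ℝ → ℂ),
      (∀ i, IsJordanLoop (γ i)) ∧
      (∀ i j, i ≠ j → Disjoint (γ i '' Set.Icc 0 1) (γ j '' Set.Icc 0 1)) ∧
      (∀ i, γ i '' Set.Icc 0 1 ⊆ Bᶜ) ∧
      (∀ i, FinUnionHV (γ i '' Set.Icc 0 1)) ∧
      (∀ z, ∃ w : Fin n → ℤ,
        (∀ i, IsWindingNumber (γ i) z (w i)) ∧
          ∑ i, w i = if S (⌈z.re / d⌉ - 1) (⌈z.im / d⌉ - 1) = true then 1 else 0) := by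
  classical
  let V : Finset (ℤ × ℤ) := (Finset.Icc (-M) (M+1) ×ˢ Finset.Icc (-M) (M+1)).filter
    (fun v => nxt S v ≠ v)
  have hV : ∀ v, v ∈ V ↔ nxt S v ≠ v := by
    rintro ⟨x, y⟩
    simp only [V, Finset.mem_filter, Finset.mem_product, Finset.mem_Icc, and_iff_right_iff_imp]
    intro hne
    rcases nxt_cases S x y with h | h | h | h | h
    · have := hM _ _ h.2.1; omega
    · have := hM _ _ h.2.1; omega
    · have := hM _ _ h.2.1; omega
    · have := hM _ _ h.2.1; omega
    · exact absurd h.1 hne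
  have hinj := nxt_inj S hS
  let g : V → V := fun v => ⟨nxt S v, (hV _).2 fun h => (hV _).1 v.2 (hinj h)⟩
  have hg : Function.Injective g := fun u v h => Subtype.ext (hinj (congrArg Subtype.val h))
  obtain ⟨n, r, hpos, hdis, hsum⟩ := orbit_decomp g hg
  let N : Fin n → ℕ := fun i => Function.minimalPeriod g (r i)
  let p : Fin n → ℕ → ℂ := fun i k => gpt d (g^[k] (r i) : V)
  have hne : ∀ i k, nxt S (g^[k] (r i) : V) ≠ (g^[k] (r i) : V) := fun i k => (hV _).1 (g^[k] (r i)).2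
  have psucc : ∀ i k, p i (k+1) = gpt d (nxt S (g^[k] (r i) : V)) := by
    intro i k
    simp only [p, Function.iterate_succ_apply']
    rfl
  have pN : ∀ i, p i (N i) = p i 0 := by
    intro i
    simp only [p, N, Function.iterate_minimalPeriod, Function.iterate_zero, id]
  have hv : ∀ i k, (p i k).re = (p i (k+1)).re ∨ (p i k).im = (p i (k+1)).im := by
    intro i k
    rw [psucc]
    exact nxt_hv S d _
  have h01 : ∀ i, ploop (p i) (N i) 0 = ploop (p i) (N i) 1 := fun i => by
    rw [ploop_zero _ _ (hpos i), ploop_one _ _ (hpos i), pN]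
  have himg : ∀ i, ∀ z ∈ ploop (p i) (N i) '' Icc 0 1, ∃ t ∈ Ico (0:ℝ) 1, ploop (p i) (N i) t = z := by
    rintro i z ⟨t, ht, rfl⟩
    rcases lt_or_eq_of_le ht.2 with h | rfl
    · exact ⟨t, ⟨ht.1, h⟩, rfl⟩
    · exact ⟨0, by simp, h01 i⟩
  have big : ∀ i j, ∀ s ∈ Ico (0:ℝ) 1, ∀ t ∈ Ico (0:ℝ) 1,
      ploop (p i) (N i) s = ploop (p j) (N j) t → i = j ∧ s = t := by
    intro i j s hs t ht h
    obtain ⟨k, hk, f, hf, rfl⟩ := ploop_param (N i) (hpos i) s hs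
    obtain ⟨l, hl, e, he, rfl⟩ := ploop_param (N j) (hpos j) t ht
    rw [ploop_eval _ _ k hk f (Ico_subset_Icc_self hf), ploop_eval _ _ l hl e (Ico_subset_Icc_self he),
      psucc, psucc] at h
    obtain ⟨h1, h2⟩ := gpt_inj S hS d hd _ _ (hne i k) (hne j l) f e hf he h
    have h1 := Subtype.ext h1
    have hij := hdis i j k l h1
    subst hij
    have hkl : k = l := Function.iterate_injOn_Iio_minimalPeriod (f := g) (x := r i) hk hl h1
    subst hkl h2
    exact ⟨rfl, rfl⟩
  refine ⟨n, fun i => ploop (p i) (N i), ?_, ?_, ?_, ?_, ?_⟩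
  · intro i
    exact ⟨(ploop_cont _ _).continuousOn, h01 i, fun s hs t ht h => (big i i s hs t ht h).2⟩
  · intro i j hij
    rw [Set.disjoint_left]
    intro z hz hz'
    obtain ⟨s, hs, h1⟩ := himg i z hz
    obtain ⟨t, ht, h2⟩ := himg j z hz'
    exact hij (big i j s hs t ht (h1.trans h2.symm)).1
  · rintro i z ⟨t, ht, rfl⟩
    obtain ⟨k, hk, f, hf, rfl⟩ := ploop_param' (N i) (hpos i) t ht
    show ploop (p i) (N i) _ ∈ _
    rw [ploop_eval _ _ k hk f hf, psucc]
    exact hB _ (hne i k) f hf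
  · intro i
    exact ⟨N i, fun k => p i k, fun k => p i (k+1), fun k => hv i k, ploop_hv _ _ (hpos i)⟩
  · intro z
    refine ⟨_, fun i => ploop_wind (p i) (N i) (hpos i) (pN i) (hv i) z, ?_⟩
    rw [← crs_sum S hS d hd z _ _ rfl rfl M (fun i j h => (hM i j h).1) V hV]
    rw [← Finset.sum_coe_sort V]
    rw [← hsum]
    refine Finset.sum_congr rfl fun i _ => Finset.sum_congr rfl fun k _ => ?_
    rw [psucc]

/-- closed brick containing the cell `(i,j)` -/
def InBrick (d : ℝ) (z : ℂ) (i j : ℤ) : Prop :=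
  d * ((i - (i + j) % 2 : ℤ) : ℝ) ≤ z.re ∧ z.re ≤ d * ((i - (i + j) % 2 : ℤ) : ℝ) + 2 * d ∧
    d * j ≤ z.im ∧ z.im ≤ d * j + d

theorem inBrick_of_cell (d : ℝ) (hd : 0 < d) (z : ℂ) (i j : ℤ) (h1 : d * i ≤ z.re)
    (h2 : z.re ≤ d * i + d) (h3 : d * j ≤ z.im) (h4 : z.im ≤ d * j + d) : InBrick d z i j := by
  rcases Int.emod_two_eq (i + j) with h | h
  · simp only [InBrick, h, sub_zero]
    exact ⟨h1, by linarith, h3, h4⟩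
  · simp only [InBrick, h]
    push_cast
    exact ⟨by linarith, by linarith, h3, h4⟩

theorem inBrick_dist (d : ℝ) (z w : ℂ) (i j : ℤ) (hz : InBrick d z i j) (hw : InBrick d w i j) :
    dist z w ≤ 3 * d := by
  obtain ⟨a1, a2, a3, a4⟩ := hz
  obtain ⟨b1, b2, b3, b4⟩ := hw
  rw [Complex.dist_eq]
  refine (Complex.norm_le_abs_re_add_abs_im _).trans ?_
  have h1 : |(z - w).re| ≤ 2 * d := by
    rw [Complex.sub_re, abs_le]; constructor <;> linarith
  have h2 : |(z - w).im| ≤ d := by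
    rw [Complex.sub_im, abs_le]; constructor <;> linarith
  linarith

theorem inBrick_dom (d : ℝ) (z : ℂ) (i j : ℤ) (h : (i + j) % 2 = 0) :
    InBrick d z i j ↔ InBrick d z (i + 1) j := by
  have h' : (i + 1 + j) % 2 = 1 := by omega
  simp only [InBrick, h, h', sub_zero, add_sub_cancel_right]

theorem edge_bricks (S : ℤ → ℤ → Bool) (d : ℝ) (hd : 0 < d) (v : ℤ × ℤ) (hv : nxt S v ≠ v)
    (f : ℝ) (hf : f ∈ Icc (0:ℝ) 1) : ∃ a b a' b' : ℤ, S a b = true ∧ S a' b' = false ∧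
      InBrick d (gpt d v + f * (gpt d (nxt S v) - gpt d v)) a b ∧
      InBrick d (gpt d v + f * (gpt d (nxt S v) - gpt d v)) a' b' := by
  obtain ⟨x, y⟩ := v
  have f1 : 0 ≤ d * f := mul_nonneg hd.le hf.1
  have f2 : d * f ≤ d := mul_le_of_le_one_right hd.le hf.2
  rcases nxt_cases S x y with h | h | h | h | h
  on_goal 5 => exact absurd h.1 hv
  all_goals
    refine ⟨_, _, _, _, h.2.1, h.2.2, ?_, ?_⟩ <;> rw [h.1] <;> apply inBrick_of_cell d hd <;>
      simp [gpt] <;> linarith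

theorem stmt2 (E F : Set ℂ) (hEne : E.Nonempty) (hEcomp : IsCompact E)
    (hFcl : IsClosed F) (hdisj : E ∩ F = ∅) :
    ∃ (n : ℕ) (γ : Fin n → ℝ → ℂ),
      (∀ i, IsJordanLoop (γ i)) ∧
      (∀ i j, i ≠ j → Disjoint (γ i '' Set.Icc 0 1) (γ j '' Set.Icc 0 1)) ∧
      (∀ i, γ i '' Set.Icc 0 1 ⊆ (E ∪ F)ᶜ) ∧
      (∀ i, FinUnionHV (γ i '' Set.Icc 0 1)) ∧
      (∀ z ∈ E, ∃ w : Fin n → ℤ,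
        (∀ i, IsWindingNumber (γ i) z (w i)) ∧ ∑ i, w i = 1) ∧
      (∀ z ∈ F, ∃ w : Fin n → ℤ,
        (∀ i, IsWindingNumber (γ i) z (w i)) ∧ ∑ i, w i = 0) := by
  classical
  obtain ⟨δ, hδ, hth⟩ := (Set.disjoint_iff_inter_eq_empty.2 hdisj).exists_thickenings hEcomp hFcl
  have hEF : ∀ e ∈ E, ∀ f ∈ F, δ ≤ dist e f := by
    intro e he f hf
    by_contra h
    refine Set.disjoint_left.1 hth (Metric.self_subset_thickening hδ E he) ?_
    exact Metric.mem_thickening_iff.2 ⟨f, hf, not_le.1 h⟩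
  obtain ⟨d, hd, hdδ⟩ : ∃ d : ℝ, 0 < d ∧ 3 * d < δ := ⟨δ / 4, by positivity, by linarith⟩
  obtain ⟨R, hR⟩ := hEcomp.isBounded.exists_norm_le
  let S : ℤ → ℤ → Bool := fun i j => decide (∃ e ∈ E, InBrick d e i j)
  have hSt : ∀ i j, S i j = true ↔ ∃ e ∈ E, InBrick d e i j := fun i j => by simp [S]
  have hSF : ∀ i j z, S i j = true → InBrick d z i j → z ∉ F := by
    intro i j z h hz hzF
    obtain ⟨e, he, hb⟩ := (hSt i j).1 h
    have := inBrick_dist d e z i j hb hz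
    have := hEF e he z hzF
    linarith
  have hSE : ∀ i j z, S i j = false → InBrick d z i j → z ∉ E := by
    intro i j z h hz hzE
    have := (hSt i j).2 ⟨z, hzE, hz⟩
    simp [h] at this
  have hS : Dom S := by
    intro i j h
    simp only [S, inBrick_dom d _ i j h]
  have hcell : ∀ z : ℂ, InBrick d z (⌈z.re / d⌉ - 1) (⌈z.im / d⌉ - 1) := by
    intro z
    have key : ∀ r : ℝ, d * ((⌈r / d⌉ - 1 : ℤ) : ℝ) ≤ r ∧ r ≤ d * ((⌈r / d⌉ - 1 : ℤ) : ℝ) + d := by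
      intro r
      have h1 := Int.le_ceil (r / d)
      have h2 := Int.ceil_lt_add_one (r / d)
      rw [div_le_iff₀ hd] at h1
      have h3 : d * (⌈r / d⌉ : ℝ) ≤ d * (r / d + 1) := mul_le_mul_of_nonneg_left h2.le hd.le
      rw [mul_add, mul_div_cancel₀ _ hd.ne'] at h3
      push_cast
      constructor <;> linarith
    exact inBrick_of_cell d hd z _ _ (key _).1 (key _).2 (key _).1 (key _).2
  have hM : ∀ i j, S i j = true → -(⌈R / d⌉ + 3) ≤ i ∧ i ≤ ⌈R / d⌉ + 3 ∧
      -(⌈R / d⌉ + 3) ≤ j ∧ j ≤ ⌈R / d⌉ + 3 := by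
    intro i j h
    obtain ⟨e, he, h1, h2, h3, h4⟩ := (hSt i j).1 h
    have hn := hR e he
    have r1 := abs_le.1 ((Complex.abs_re_le_norm e).trans hn)
    have r2 := abs_le.1 ((Complex.abs_im_le_norm e).trans hn)
    have hc : R ≤ d * ⌈R / d⌉ := by
      have h1 := Int.le_ceil (R / d)
      rw [div_le_iff₀ hd] at h1
      linarith
    have tr : ∀ a b : ℤ, d * (a:ℝ) ≤ d * b → a ≤ b := by
      intro a b h
      exact_mod_cast le_of_mul_le_mul_left h hd
    have q1 := tr (i - (i + j) % 2) (⌈R / d⌉) (by linarith)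
    have q2 := tr (-⌈R / d⌉) (i - (i + j) % 2 + 2) (by push_cast at *; linarith)
    have q3 := tr j (⌈R / d⌉) (by linarith)
    have q4 := tr (-⌈R / d⌉) (j + 1) (by push_cast; linarith)
    omega
  obtain ⟨n, γ, g1, g2, g3, g4, g5⟩ := main_loops S hS d hd (⌈R / d⌉ + 3) hM (E ∪ F) (by
    intro v hv f hf
    obtain ⟨a, b, a', b', h1, h2, h3, h4⟩ := edge_bricks S d hd v hv f hf
    rintro (h | h)
    · exact hSE _ _ _ h2 h4 h
    · exact hSF _ _ _ h1 h3 h)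
  refine ⟨n, γ, g1, g2, g3, g4, ?_, ?_⟩
  · intro z hz
    obtain ⟨w, hw, hs⟩ := g5 z
    refine ⟨w, hw, ?_⟩
    rw [hs, if_pos ((hSt _ _).2 ⟨z, hz, hcell z⟩)]
  · intro z hz
    obtain ⟨w, hw, hs⟩ := g5 z
    refine ⟨w, hw, ?_⟩
    rw [hs, if_neg fun h => hSF _ _ _ h (hcell z) hz]
end

section
/- Let U ⊆ ℂ be open and connected and let a, b ∈ U with a ≠ b. Then there exists an injective continuous map η : [0,1] → U with η 0 = a and η 1 = b whose image is a finite union of horizontal and vertical segments. -/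
open Set

theorem FinUnionHV.union_seg {S : Set ℂ} (h : FinUnionHV S) (x y : ℂ)
    (hxy : x.re = y.re ∨ x.im = y.im) : FinUnionHV (S ∪ segment ℝ x y) := by
  obtain ⟨n, p, q, hpq, rfl⟩ := h
  refine ⟨n + 1, Fin.cons x p, Fin.cons y q, ?_, ?_⟩
  · intro i
    refine Fin.cases ?_ ?_ i
    · simpa using hxy
    · intro j; simpa using hpq j
  · ext z
    simp only [mem_union, mem_iUnion, Fin.exists_fin_succ, Fin.cons_zero, Fin.cons_succ]
    tauto

def GoodArc (U : Set ℂ) (a z : ℂ) : Prop :=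
  ∃ (L : ℝ) (η : ℝ → ℂ), 0 ≤ L ∧ ContinuousOn η (Icc 0 L) ∧ InjOn η (Icc 0 L) ∧
    η 0 = a ∧ η L = z ∧ η '' Icc 0 L ⊆ U ∧ ∀ u ∈ Icc 0 L, FinUnionHV (η '' Icc 0 u)

theorem GoodArc.refl {U : Set ℂ} {a : ℂ} (ha : a ∈ U) : GoodArc U a a := by
  refine ⟨0, fun _ => a, le_rfl, continuousOn_const, by simp, rfl, rfl, by simpa using ha, ?_⟩
  intro u hu
  refine ⟨1, fun _ => a, fun _ => a, by simp, ?_⟩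
  have : (Icc 0 u).Nonempty := ⟨0, by simpa using hu.1⟩
  simp [this.image_const]

theorem GoodArc.extend {U : Set ℂ} {a z w : ℂ} (h : GoodArc U a z)
    (hzw : z.re = w.re ∨ z.im = w.im) (hs : segment ℝ w z ⊆ U) : GoodArc U a w := by
  obtain ⟨L, γ, hL, hc, hi, h0, h1, hU, hF⟩ := h
  have hK : IsCompact (γ '' Icc 0 L) := isCompact_Icc.image_of_continuousOn hc
  have hsc : Continuous (fun t : ℝ => w + t • (z - w)) := by fun_prop
  have hT : IsCompact (Icc (0:ℝ) 1 ∩ (fun t : ℝ => w + t • (z - w)) ⁻¹' (γ '' Icc 0 L)) :=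
    isCompact_Icc.inter_right (hK.isClosed.preimage hsc)
  obtain ⟨t, ⟨⟨ht0, ht1⟩, u, hu, hut⟩, hmin⟩ := hT.exists_isLeast
    ⟨1, by simp, L, by simpa using hL, by simp [h1]⟩
  simp only at hut
  have hsub : Icc 0 u ⊆ Icc 0 L := Icc_subset_Icc_right hu.2
  by_cases hw : w ∈ γ '' Icc 0 L
  · obtain ⟨v, hv, rfl⟩ := hw
    have hsub : Icc 0 v ⊆ Icc 0 L := Icc_subset_Icc_right hv.2
    exact ⟨v, γ, hv.1, hc.mono hsub, hi.mono hsub, h0, rfl, (image_mono hsub).trans hU,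
      fun r hr => hF r (hsub hr)⟩
  have htpos : 0 < t := by
    rcases ht0.lt_or_eq with h | h
    · exact h
    · subst h
      exact absurd ⟨u, hu, by simpa using hut⟩ hw
  have hxw : w - γ u ≠ 0 := by
    intro h
    exact hw ⟨u, hu, (sub_eq_zero.1 h).symm⟩
  have hnot : ∀ r : ℝ, 0 < r → r ≤ 1 → γ u + r • (w - γ u) ∉ γ '' Icc 0 L := by
    intro r hr hr1 hmem
    have h2 : γ u + r • (w - γ u) = w + (t * (1 - r)) • (z - w) := by
      rw [hut]; simp only [Complex.real_smul]; push_cast; ring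
    rw [h2] at hmem
    have h3 := hmin ⟨⟨by nlinarith, by nlinarith⟩, hmem⟩
    nlinarith
  have hinU : ∀ r : ℝ, 0 ≤ r → r ≤ 1 → γ u + r • (w - γ u) ∈ U := by
    intro r hr hr1
    apply hs
    rw [segment_eq_image']
    refine ⟨t * (1 - r), ⟨by nlinarith, by nlinarith⟩, ?_⟩
    rw [hut]; simp only [Complex.real_smul]; push_cast; ring
  have hHV : ∀ r : ℝ, (γ u).re = (γ u + r • (w - γ u)).re ∨
      (γ u).im = (γ u + r • (w - γ u)).im := by
    intro r
    rw [hut]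
    rcases hzw with h | h
    · left; simp [h]
    · right; simp [h]
  let η : ℝ → ℂ := fun s => if s ≤ u then γ s else γ u + (s - u) • (w - γ u)
  have e1 : ∀ s, s ≤ u → η s = γ s := fun s hs => if_pos hs
  have e2 : ∀ s, u ≤ s → η s = γ u + (s - u) • (w - γ u) := by
    intro s hs
    rcases hs.lt_or_eq with h | h
    · exact if_neg (not_le.2 h)
    · subst h; simp [η]
  have hu0 := hu.1
  refine ⟨u + 1, η, by linarith, ?_, ?_, ?_, ?_, ?_, ?_⟩
  · have : Icc 0 (u + 1) = Icc 0 u ∪ Icc u (u + 1) :=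
      (Icc_union_Icc_eq_Icc hu0 (by linarith)).symm
    rw [this]
    refine ContinuousOn.union_of_isClosed ?_ ?_ isClosed_Icc isClosed_Icc
    · exact (hc.mono hsub).congr fun s hs => e1 s hs.2
    · refine ContinuousOn.congr (f := fun s : ℝ => γ u + (s - u) • (w - γ u)) ?_
        fun s hs => e2 s hs.1
      fun_prop
  · have key : ∀ s ∈ Icc 0 (u + 1), ∀ s' ∈ Icc 0 (u + 1), s ≤ u → ¬ s' ≤ u → η s ≠ η s' := by
      intro s hs s' hs' h h' he
      rw [e1 s h, e2 s' (not_le.1 h').le] at he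
      exact hnot (s' - u) (by linarith) (by linarith [hs'.2]) (he ▸ ⟨s, ⟨hs.1, h.trans hu.2⟩, rfl⟩)
    intro s hs s' hs' he
    by_cases h : s ≤ u <;> by_cases h' : s' ≤ u
    · rw [e1 s h, e1 s' h'] at he
      exact hi ⟨hs.1, h.trans hu.2⟩ ⟨hs'.1, h'.trans hu.2⟩ he
    · exact absurd he (key s hs s' hs' h h')
    · exact absurd he.symm (key s' hs' s hs h' h)
    · rw [e2 s (not_le.1 h).le, e2 s' (not_le.1 h').le] at he
      have := smul_left_injective ℝ hxw (add_left_cancel he)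
      linarith
  · rw [e1 0 hu0, h0]
  · rw [e2 _ (by linarith)]; simp
  · rintro _ ⟨s, hs, rfl⟩
    by_cases h : s ≤ u
    · rw [e1 s h]; exact hU ⟨s, ⟨hs.1, h.trans hu.2⟩, rfl⟩
    · rw [e2 s (not_le.1 h).le]
      exact hinU _ (by linarith) (by linarith [hs.2])
  · intro v hv
    by_cases h : v ≤ u
    · have : η '' Icc 0 v = γ '' Icc 0 v :=
        image_congr fun s hs => e1 s (hs.2.trans h)
      rw [this]
      exact hF v ⟨hv.1, h.trans hu.2⟩
    · have hvu : 0 < v - u := by linarith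
      have : η '' Icc 0 v = γ '' Icc 0 u ∪ segment ℝ (γ u) (γ u + (v - u) • (w - γ u)) := by
        rw [← Icc_union_Icc_eq_Icc hu0 (not_le.1 h).le, image_union,
          image_congr (fun s (hs : s ∈ Icc 0 u) => e1 s hs.2),
          image_congr (fun s (hs : s ∈ Icc u v) => e2 s hs.1), segment_eq_image']
        congr 1
        ext y
        constructor
        · rintro ⟨s, hs, rfl⟩
          refine ⟨(s - u) / (v - u), ⟨div_nonneg (by linarith [hs.1]) hvu.le,
            (div_le_one hvu).2 (by linarith [hs.2])⟩, ?_⟩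
          simp only [add_sub_cancel_left, smul_smul]
          rw [div_mul_cancel₀ _ hvu.ne']
        · rintro ⟨r, hr, rfl⟩
          refine ⟨u + r * (v - u), ⟨by nlinarith [hr.1], by nlinarith [hr.2]⟩, ?_⟩
          simp only [add_sub_cancel_left, smul_smul]
      rw [this]
      exact (hF u hu).union_seg _ _ (hHV _)

theorem GoodArc.ball {U : Set ℂ} {a z w c : ℂ} {r : ℝ} (hb : Metric.ball c r ⊆ U)
    (hz : z ∈ Metric.ball c r) (hw : w ∈ Metric.ball c r)
    (hm : (⟨w.re, z.im⟩ : ℂ) ∈ Metric.ball c r) (h : GoodArc U a z) : GoodArc U a w := by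
  have hcx := convex_ball c r
  exact (h.extend (w := ⟨w.re, z.im⟩) (Or.inr rfl) ((hcx.segment_subset hm hz).trans hb)).extend
    (Or.inl rfl) ((hcx.segment_subset hw hm).trans hb)

theorem stmt3 (U : Set ℂ) (hUo : IsOpen U) (hUconn : IsConnected U)
    (a b : ℂ) (ha : a ∈ U) (hb : b ∈ U) (hab : a ≠ b) :
    ∃ η : ℝ → ℂ, ContinuousOn η (Set.Icc 0 1) ∧ Set.InjOn η (Set.Icc 0 1) ∧
      η 0 = a ∧ η 1 = b ∧ η '' Set.Icc 0 1 ⊆ U ∧ FinUnionHV (η '' Set.Icc 0 1) := by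
  have hG : GoodArc U a a ↔ GoodArc U a b := by
    refine hUconn.isPreconnected.induction₂ (fun x y => GoodArc U a x ↔ GoodArc U a y)
      ?_ (fun x y z _ _ _ h1 h2 => h1.trans h2) (fun x y _ _ h => h.symm) ha hb
    intro x hx
    obtain ⟨r, hr, hball⟩ := Metric.isOpen_iff.1 hUo x hx
    refine Filter.Eventually.filter_mono nhdsWithin_le_nhds ?_
    filter_upwards [Metric.ball_mem_nhds x hr] with y hy
    have hy' : ‖y - x‖ < r := by rwa [← dist_eq_norm]
    have hre : (⟨y.re, x.im⟩ : ℂ) ∈ Metric.ball x r := by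
      rw [Metric.mem_ball, Complex.dist_of_im_eq (z := ⟨y.re, x.im⟩) (w := x) rfl, Real.dist_eq]
      exact lt_of_le_of_lt (by simpa using Complex.abs_re_le_norm (y - x)) hy'
    have him : (⟨x.re, y.im⟩ : ℂ) ∈ Metric.ball x r := by
      rw [Metric.mem_ball, Complex.dist_of_re_eq (z := ⟨x.re, y.im⟩) (w := x) rfl, Real.dist_eq]
      exact lt_of_le_of_lt (by simpa using Complex.abs_im_le_norm (y - x)) hy'
    have hx' := Metric.mem_ball_self (x := x) hr
    exact ⟨GoodArc.ball hball hx' hy hre, GoodArc.ball hball hy hx' him⟩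
  obtain ⟨L, γ, hL, hc, hi, h0, h1, hU, hF⟩ := hG.1 (GoodArc.refl ha)
  have hLpos : 0 < L := by
    rcases hL.lt_or_eq with h | h
    · exact h
    · subst h; exact absurd (h0.symm.trans h1) hab
  have him : (fun t : ℝ => L * t) '' Icc 0 1 = Icc 0 L := by
    rw [image_mul_left_Icc hL zero_le_one]; simp
  have hmaps : MapsTo (fun t : ℝ => L * t) (Icc 0 1) (Icc 0 L) := by
    rw [← him]; exact mapsTo_image _ _
  have hIm : (fun t => γ (L * t)) '' Icc (0:ℝ) 1 = γ '' Icc 0 L := by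
    rw [← him, image_image]
  refine ⟨fun t => γ (L * t), hc.comp (by fun_prop) hmaps, ?_, by simpa using h0,
    by simpa using h1, hIm ▸ hU, hIm ▸ hF L ⟨hL, le_rfl⟩⟩
  exact hi.comp (fun x _ y _ h => mul_left_cancel₀ hLpos.ne' h) hmaps
end
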